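/- Let A, B ∈ H₂ with A < B, and let φ : [A,B] → U₂ satisfy rank(X − Y) ≤ 1 ⟹ rank(φ(X) − φ(Y)) ≤ 1 for all X, Y ∈ [A,B]. Suppose φ is not standard, i.e. there is no automorphism Φ of U₂ with φ(X) = Φ(𝔠(X)) for all X ∈ [A,B]. Then φ is degenerate: either (type 𝒞) there exist A₀ ∈ [A,B] and B₀ in the image φ([A,B]) such that rank(φ(X) − B₀) ≤ 1 for every X ∈ [A,B] with X ≠ A₀; or (type ℓ) there exist lines ℓ, ℓ' in U₂ such that φ(X) ∈ ℓ' for every X ∈ [A,B] with 𝔠(X) ∉ ℓ. -/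

import Mathlib

open Matrix
open scoped ComplexOrder

noncomputable section

/-- The space of `2×2` complex matrices. -/
abbrev Mat2 : Type := Matrix (Fin 2) (Fin 2) ℂ

/-- The group of `2×2` complex unitary matrices. -/
abbrev U2 : Type := Matrix.unitaryGroup (Fin 2) ℂ

/-- Coherency for matrices: `A ∼ B` iff `rank (A − B) ≤ 1`. -/
def Coherent (A B : Mat2) : Prop := (A - B).rank ≤ 1

/-- Coherency for unitaries: `U ∼ V` iff `rank (U − V) ≤ 1`. -/
def CoherentU (U V : U2) : Prop := ((U : Mat2) - (V : Mat2)).rank ≤ 1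

/-- The Cayley transform, as a matrix: `𝔠(A) = (A − iI)(A + iI)⁻¹`. -/
def cayleyMat (A : Mat2) : Mat2 :=
  (A - Complex.I • (1 : Mat2)) * (A + Complex.I • (1 : Mat2))⁻¹

open Classical in
/-- The Cayley transform, landing in the unitary group.  For every hermitian `A` the matrix
`cayleyMat A` is unitary, so the junk value `1` is never used for the matrices considered here. -/
def cayley (A : Mat2) : U2 :=
  if h : cayleyMat A ∈ Matrix.unitaryGroup (Fin 2) ℂ then ⟨cayleyMat A, h⟩ else 1

/-- An automorphism of `U₂`: a bijection preserving coherency in both directions. -/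
def IsAut (Φ : U2 → U2) : Prop :=
  Function.Bijective Φ ∧ ∀ U V : U2, CoherentU U V ↔ CoherentU (Φ U) (Φ V)

/-- A line in `U₂`: a maximal subset all of whose elements are pairwise coherent. -/
def IsLine (ℓ : Set U2) : Prop :=
  (∀ U ∈ ℓ, ∀ V ∈ ℓ, CoherentU U V) ∧
  ∀ m : Set U2, ℓ ⊆ m → (∀ U ∈ m, ∀ V ∈ m, CoherentU U V) → m = ℓ

/-- The matrix interval `[A, B] = {X : A ≤ X ≤ B}` (in the Loewner order). -/
def matIcc (A B : Mat2) : Set Mat2 := {X | (X - A).PosSemidef ∧ (B - X).PosSemidef}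

/-- Rank one projections: `P = P* = P²` of rank one. -/
def IsProj1 (P : Mat2) : Prop := P.IsHermitian ∧ P * P = P ∧ P.rank = 1

theorem rank_le_one_iff_det_eq_zero (M : Mat2) : M.rank ≤ 1 ↔ M.det = 0 := by
  constructor
  · intro h
    by_contra hd
    have := Matrix.rank_of_det_ne_zero hd
    simp at this
    omega
  · intro h
    by_contra hr
    have h2 : M.rank ≤ 2 := by simpa using M.rank_le_card_width
    have h3 : M.rank = 2 := by omega
    obtain ⟨v, hv, hMv⟩ := (Matrix.exists_mulVec_eq_zero_iff (M := M)).2 h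
    have hrn := LinearMap.finrank_range_add_finrank_ker M.mulVecLin
    have hr' : Module.finrank ℂ (LinearMap.range M.mulVecLin) = 2 := h3
    rw [hr'] at hrn
    simp only [Module.finrank_fintype_fun_eq_card, Fintype.card_fin] at hrn
    have hrn : Module.finrank ℂ (LinearMap.ker M.mulVecLin) = 0 := by omega
    have : v ∈ LinearMap.ker M.mulVecLin := by simpa using hMv
    rw [LinearMap.ker_eq_bot'.2] at this
    · exact hv (by simpa using this)
    · intro m hm
      have : m ∈ LinearMap.ker M.mulVecLin := hm
      have hker : LinearMap.ker M.mulVecLin = ⊥ := Submodule.finrank_eq_zero.1 hrn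
      rw [hker] at this
      simpa using this

theorem coherent_iff_det (X Y : Mat2) : Coherent X Y ↔ (X - Y).det = 0 :=
  rank_le_one_iff_det_eq_zero _

theorem coherentU_iff_det (U V : U2) : CoherentU U V ↔ ((U : Mat2) - (V : Mat2)).det = 0 :=
  rank_le_one_iff_det_eq_zero _

theorem CoherentU.refl (U : U2) : CoherentU U U := by
  rw [coherentU_iff_det]; simp

theorem CoherentU.symm {U V : U2} (h : CoherentU U V) : CoherentU V U := by
  rw [coherentU_iff_det] at h ⊢
  rw [← neg_sub, Matrix.det_neg, h, mul_zero]

/-- The symplectic pairing of two pairs of matrices. -/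
def pairing (S T S' T' : Mat2) : Mat2 := Sᴴ * T' - Tᴴ * S'

/-- The columns of the pair `(S, T)` span a Lagrangian plane. -/
def IsLag (S T : Mat2) : Prop :=
  pairing S T S T = 0 ∧ ∀ v : Fin 2 → ℂ, S *ᵥ v = 0 → T *ᵥ v = 0 → v = 0

theorem dotProduct_conj_add (a b : Fin 2 → ℂ) (h : star a ⬝ᵥ a + star b ⬝ᵥ b = 0) :
    a = 0 ∧ b = 0 := by
  have ha : (0 : ℂ) ≤ star a ⬝ᵥ a := dotProduct_star_self_nonneg a
  have hb : (0 : ℂ) ≤ star b ⬝ᵥ b := dotProduct_star_self_nonneg b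
  have h1 := (add_eq_zero_iff_of_nonneg ha hb).1 h
  exact ⟨dotProduct_star_self_eq_zero.1 h1.1, dotProduct_star_self_eq_zero.1 h1.2⟩

theorem conjTranspose_mul_plus (S T S' T' : Mat2) :
    (S + Complex.I • T)ᴴ * (S' + Complex.I • T')
      = Sᴴ * S' + Tᴴ * T' + Complex.I • pairing S T S' T' := by
  have hI := Complex.I_mul_I
  simp only [pairing, conjTranspose_add, conjTranspose_smul, add_mul, mul_add, Matrix.smul_mul,
    Matrix.mul_smul, smul_smul, Complex.star_def, Complex.conj_I, neg_mul, hI, neg_neg, one_smul,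
    smul_sub, neg_smul]
  abel

theorem conjTranspose_mul_minus (S T S' T' : Mat2) :
    (S - Complex.I • T)ᴴ * (S' - Complex.I • T')
      = Sᴴ * S' + Tᴴ * T' - Complex.I • pairing S T S' T' := by
  have hI := Complex.I_mul_I
  simp only [pairing, conjTranspose_sub, conjTranspose_smul, sub_mul, mul_sub, Matrix.smul_mul,
    Matrix.mul_smul, smul_smul, Complex.star_def, Complex.conj_I, neg_mul, hI, neg_neg, one_smul,
    smul_sub, neg_smul]
  abel

theorem IsLag.det_ne_zero {S T : Mat2} (h : IsLag S T) : (S + Complex.I • T).det ≠ 0 := by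
  intro hd
  obtain ⟨v, hv, hMv⟩ := (Matrix.exists_mulVec_eq_zero_iff).2 hd
  apply hv
  have h1 := conjTranspose_mul_plus S T S T
  rw [h.1, smul_zero, add_zero] at h1
  have h2 : star v ⬝ᵥ ((Sᴴ * S + Tᴴ * T) *ᵥ v) = 0 := by
    rw [← h1, ← Matrix.mulVec_mulVec, hMv]; simp
  have h3 : star (S *ᵥ v) ⬝ᵥ (S *ᵥ v) + star (T *ᵥ v) ⬝ᵥ (T *ᵥ v) = 0 := by
    rw [← h2, Matrix.add_mulVec, dotProduct_add, ← Matrix.mulVec_mulVec, ← Matrix.mulVec_mulVec,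
      star_mulVec, star_mulVec, ← Matrix.dotProduct_mulVec, ← Matrix.dotProduct_mulVec]
  exact h.2 v (dotProduct_conj_add _ _ h3).1 (dotProduct_conj_add _ _ h3).2

theorem isLag_of_det {S T : Mat2} (h : pairing S T S T = 0) (hd : (S + Complex.I • T).det ≠ 0) :
    IsLag S T := by
  refine ⟨h, fun v hS hT => ?_⟩
  by_contra hv
  apply hd
  rw [← Matrix.exists_mulVec_eq_zero_iff]
  exact ⟨v, hv, by rw [Matrix.add_mulVec, Matrix.smul_mulVec, hS, hT]; simp⟩

open Classical in
/-- The unitary matrix attached to a Lagrangian pair. -/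
def pt (S T : Mat2) : U2 :=
  if h : (S - Complex.I • T) * (S + Complex.I • T)⁻¹ ∈ Matrix.unitaryGroup (Fin 2) ℂ
  then ⟨(S - Complex.I • T) * (S + Complex.I • T)⁻¹, h⟩ else 1

theorem cayley_eq_pt (X : Mat2) : cayley X = pt X 1 := rfl

theorem coe_pt {S T : Mat2} (h : IsLag S T) :
    (pt S T : Mat2) = (S - Complex.I • T) * (S + Complex.I • T)⁻¹ := by
  have hu : (S - Complex.I • T) * (S + Complex.I • T)⁻¹ ∈ Matrix.unitaryGroup (Fin 2) ℂ := by
    rw [Matrix.mem_unitaryGroup_iff', star_eq_conjTranspose, conjTranspose_mul, Matrix.mul_assoc,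
      ← Matrix.mul_assoc (S - Complex.I • T)ᴴ, conjTranspose_mul_minus, h.1, smul_zero, sub_zero]
    have h1 := conjTranspose_mul_plus S T S T
    rw [h.1, smul_zero, add_zero] at h1
    rw [← h1, Matrix.mul_assoc, Matrix.mul_nonsing_inv _ (isUnit_iff_ne_zero.2 h.det_ne_zero),
      Matrix.mul_one, ← conjTranspose_mul,
      Matrix.mul_nonsing_inv _ (isUnit_iff_ne_zero.2 h.det_ne_zero), conjTranspose_one]
  rw [pt, dif_pos hu]

theorem conj_pt_mul_pt {S T S' T' : Mat2} (h : IsLag S T) (h' : IsLag S' T') :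
    (pt S T : Mat2)ᴴ * (pt S' T' : Mat2) - 1
      = ((S + Complex.I • T)⁻¹)ᴴ * ((-2 * Complex.I) • pairing S T S' T')
        * (S' + Complex.I • T')⁻¹ := by
  have e : (-2 * Complex.I) • pairing S T S' T'
      = (S - Complex.I • T)ᴴ * (S' - Complex.I • T')
        - (S + Complex.I • T)ᴴ * (S' + Complex.I • T') := by
    rw [conjTranspose_mul_minus, conjTranspose_mul_plus]
    module
  rw [e, coe_pt h, coe_pt h', conjTranspose_mul,
    Matrix.mul_sub ((S + Complex.I • T)⁻¹)ᴴ, Matrix.sub_mul (((S + Complex.I • T)⁻¹)ᴴ * _)]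
  congr 1
  · simp only [Matrix.mul_assoc]
  · rw [Matrix.mul_assoc, Matrix.mul_assoc,
      Matrix.mul_nonsing_inv _ (isUnit_iff_ne_zero.2 h'.det_ne_zero), Matrix.mul_one,
      ← conjTranspose_mul, Matrix.mul_nonsing_inv _ (isUnit_iff_ne_zero.2 h.det_ne_zero),
      conjTranspose_one]

theorem sub_eq_neg_mul (U V : U2) :
    (U : Mat2) - (V : Mat2) = -((U : Mat2) * ((U : Mat2)ᴴ * (V : Mat2) - 1)) := by
  have h : (U : Mat2) * (U : Mat2)ᴴ = 1 := Matrix.mem_unitaryGroup_iff.1 U.2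
  rw [Matrix.mul_sub, ← Matrix.mul_assoc, h]
  simp

theorem det_coe_ne_zero (U : U2) : (U : Mat2).det ≠ 0 := by
  have h : (U : Mat2) * (U : Mat2)ᴴ = 1 := Matrix.mem_unitaryGroup_iff.1 U.2
  intro h0
  have := congrArg Matrix.det h
  rw [Matrix.det_mul, h0] at this
  simp at this

theorem coherentU_pt {S T S' T' : Mat2} (h : IsLag S T) (h' : IsLag S' T') :
    CoherentU (pt S T) (pt S' T') ↔ (pairing S T S' T').det = 0 := by
  have hM : ((S + Complex.I • T)⁻¹).det ≠ 0 := by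
    rw [Matrix.det_nonsing_inv]; simpa using h.det_ne_zero
  have hM' : ((S' + Complex.I • T')⁻¹).det ≠ 0 := by
    rw [Matrix.det_nonsing_inv]; simpa using h'.det_ne_zero
  rw [coherentU_iff_det, sub_eq_neg_mul, conj_pt_mul_pt h h', Matrix.det_neg, Matrix.det_mul,
    Matrix.det_mul, Matrix.det_mul, Matrix.det_smul, Matrix.det_conjTranspose]
  simp only [mul_eq_zero, hM', det_coe_ne_zero, star_eq_zero, hM]
  simp

theorem pt_eq_pt {S T S' T' : Mat2} (h : IsLag S T) (h' : IsLag S' T') :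
    pt S T = pt S' T' ↔ pairing S T S' T' = 0 := by
  constructor
  · intro e
    have h1 := conj_pt_mul_pt h h'
    have h2 : (pt S T : Mat2)ᴴ * (pt S' T' : Mat2) = 1 := by
      rw [← e]; exact Matrix.mem_unitaryGroup_iff'.1 (pt S T).2
    rw [h2, sub_self] at h1
    have h3 := congrArg (fun Z => (S + Complex.I • T)ᴴ * Z * (S' + Complex.I • T')) h1
    rw [Matrix.mul_assoc, Matrix.mul_assoc, Matrix.mul_assoc, Matrix.nonsing_inv_mul _
      (isUnit_iff_ne_zero.2 h'.det_ne_zero), Matrix.mul_one, ← Matrix.mul_assoc,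
      ← Matrix.mul_assoc,
      ← conjTranspose_mul, Matrix.nonsing_inv_mul _ (isUnit_iff_ne_zero.2 h.det_ne_zero)] at h3
    simpa using h3.symm
  · intro e
    have h1 := sub_eq_neg_mul (pt S T) (pt S' T')
    rw [conj_pt_mul_pt h h', e] at h1
    apply Subtype.ext
    simpa [sub_eq_zero] using h1

theorem exists_rep (U : U2) : ∃ S T, IsLag S T ∧ pt S T = U := by
  have hU : (U : Mat2)ᴴ * (U : Mat2) = 1 := Matrix.mem_unitaryGroup_iff'.1 U.2
  have hI := Complex.I_mul_I
  have e1 : ((1 + U : Mat2) + Complex.I • (Complex.I • ((U : Mat2) - 1))) = (2 : ℂ) • 1 := by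
    rw [smul_smul, hI]; module
  have e2 : ((1 + U : Mat2) - Complex.I • (Complex.I • ((U : Mat2) - 1))) = (2 : ℂ) • (U : Mat2) := by
    rw [smul_smul, hI]; module
  have hL : IsLag (1 + U : Mat2) (Complex.I • ((U : Mat2) - 1)) := by
    apply isLag_of_det
    · simp only [pairing, conjTranspose_add, conjTranspose_smul, conjTranspose_sub,
        conjTranspose_one, add_mul, mul_add, sub_mul, mul_sub, Matrix.smul_mul, Matrix.mul_smul, hU,
        Complex.star_def, Complex.conj_I, Matrix.one_mul, Matrix.mul_one]
      module
    · rw [e1]; simp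
  refine ⟨_, _, hL, ?_⟩
  apply Subtype.ext
  rw [coe_pt hL, e1, e2, Matrix.inv_smul _ _ (by simp)]
  simp [smul_smul]

/-! ### Automorphisms -/

theorem IsAut.comp {Φ Ψ : U2 → U2} (h : IsAut Φ) (h' : IsAut Ψ) : IsAut (Φ ∘ Ψ) :=
  ⟨h.1.comp h'.1, fun U V => (h'.2 U V).trans (h.2 _ _)⟩

theorem IsAut.exists_inverse {Φ : U2 → U2} (h : IsAut Φ) :
    ∃ Ψ : U2 → U2, IsAut Ψ ∧ (∀ U, Ψ (Φ U) = U) ∧ ∀ U, Φ (Ψ U) = U := by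
  obtain ⟨Ψ, hl, hr⟩ := Function.bijective_iff_has_inverse.1 h.1
  refine ⟨Ψ, ⟨Function.bijective_iff_has_inverse.2 ⟨Φ, hr, hl⟩, fun U V => ?_⟩, hl, hr⟩
  rw [h.2 (Ψ U) (Ψ V), hr, hr]

theorem isAut_mul_left (V : U2) : IsAut (fun U => V * U) := by
  refine ⟨Group.mulLeft_bijective V, fun U W => ?_⟩
  rw [coherentU_iff_det, coherentU_iff_det]
  have : ((V * U : U2) : Mat2) - ((V * W : U2) : Mat2) = (V : Mat2) * ((U : Mat2) - (W : Mat2)) := by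
    simp [Matrix.mul_sub]
  rw [this, Matrix.det_mul]
  simp [det_coe_ne_zero]

theorem exists_isAut_of_pairs (m : Mat2 × Mat2 → Mat2 × Mat2)
    (hL : ∀ x : Mat2 × Mat2, IsLag x.1 x.2 → IsLag (m x).1 (m x).2)
    (hd : ∀ x y : Mat2 × Mat2, (pairing (m x).1 (m x).2 (m y).1 (m y).2).det = 0 ↔
      (pairing x.1 x.2 y.1 y.2).det = 0)
    (h0 : ∀ x y : Mat2 × Mat2, pairing (m x).1 (m x).2 (m y).1 (m y).2 = 0 ↔
      pairing x.1 x.2 y.1 y.2 = 0)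
    (hs : ∀ y : Mat2 × Mat2, IsLag y.1 y.2 → ∃ x : Mat2 × Mat2, IsLag x.1 x.2 ∧ m x = y) :
    ∃ Φ : U2 → U2, IsAut Φ ∧ ∀ S T, IsLag S T → Φ (pt S T) = pt (m (S, T)).1 (m (S, T)).2 := by
  choose s t hst hpt using exists_rep
  have key : ∀ S T : Mat2, IsLag S T →
      pt (m (s (pt S T), t (pt S T))).1 (m (s (pt S T), t (pt S T))).2
        = pt (m (S, T)).1 (m (S, T)).2 := by
    intro S T h
    exact (pt_eq_pt (hL (s (pt S T), t (pt S T)) (hst _)) (hL (S, T) h)).2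
      ((h0 (s (pt S T), t (pt S T)) (S, T)).2 ((pt_eq_pt (hst _) h).1 (hpt _)))
  refine ⟨fun U => pt (m (s U, t U)).1 (m (s U, t U)).2, ⟨⟨?_, ?_⟩, ?_⟩, key⟩
  · intro U V h
    have h' := (h0 (s U, t U) (s V, t V)).1
      ((pt_eq_pt (hL (s U, t U) (hst _)) (hL (s V, t V) (hst _))).1 h)
    rw [← hpt U, ← hpt V]
    exact (pt_eq_pt (hst _) (hst _)).2 h'
  · intro V
    obtain ⟨x, hx, hm⟩ := hs (s V, t V) (hst V)
    refine ⟨pt x.1 x.2, ?_⟩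
    have := key x.1 x.2 hx
    rw [Prod.mk.eta, hm, hpt V] at this
    exact this
  · intro U V
    have := coherentU_pt (hst U) (hst V)
    rw [hpt U, hpt V] at this
    exact this.trans ((hd (s U, t U) (s V, t V)).symm.trans
      (coherentU_pt (hL (s U, t U) (hst _)) (hL (s V, t V) (hst _))).symm)

theorem exists_isAut_of_blocks (a b c d : Mat2) (r : ℝ) (hr : r ≠ 0)
    (hac : aᴴ * c = cᴴ * a) (hbd : bᴴ * d = dᴴ * b) (had : aᴴ * d - cᴴ * b = (r : ℂ) • 1) :
    ∃ Φ : U2 → U2, IsAut Φ ∧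
      ∀ S T, IsLag S T → Φ (pt S T) = pt (a * S + b * T) (c * S + d * T) := by
  have hrc : (r : ℂ) ≠ 0 := by exact_mod_cast hr
  have had' : dᴴ * a - bᴴ * c = (r : ℂ) • 1 := by
    have := congrArg conjTranspose had
    simpa [conjTranspose_sub, conjTranspose_mul] using this
  have hp : ∀ S T S' T' : Mat2,
      pairing (a * S + b * T) (c * S + d * T) (a * S' + b * T') (c * S' + d * T')
        = (r : ℂ) • pairing S T S' T' := by
    intro S T S' T'
    have e : pairing (a * S + b * T) (c * S + d * T) (a * S' + b * T') (c * S' + d * T')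
      = Sᴴ * (aᴴ * c - cᴴ * a) * S' + Tᴴ * (bᴴ * d - dᴴ * b) * T' + Sᴴ * (aᴴ * d - cᴴ * b) * T'
        - Tᴴ * (dᴴ * a - bᴴ * c) * S' := by
      simp only [pairing, conjTranspose_add, conjTranspose_mul]
      noncomm_ring
    rw [e, hac, hbd, had, had']
    simp [pairing, smul_sub]
  have hinv : Matrix.fromBlocks ((r : ℂ)⁻¹ • dᴴ) (-((r : ℂ)⁻¹ • bᴴ)) (-((r : ℂ)⁻¹ • cᴴ))
      ((r : ℂ)⁻¹ • aᴴ) * Matrix.fromBlocks a b c d = 1 := by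
    rw [Matrix.fromBlocks_multiply, ← Matrix.fromBlocks_one]
    congr 1
    · have : (r : ℂ)⁻¹ • dᴴ * a + -((r : ℂ)⁻¹ • bᴴ) * c = (r : ℂ)⁻¹ • (dᴴ * a - bᴴ * c) := by
        simp [smul_sub, sub_eq_add_neg]
      rw [this, had', smul_smul, inv_mul_cancel₀ hrc, one_smul]
    · simp [hbd]
    · simp [hac]
    · have : -((r : ℂ)⁻¹ • cᴴ) * b + (r : ℂ)⁻¹ • aᴴ * d = (r : ℂ)⁻¹ • (aᴴ * d - cᴴ * b) := by
        simp [smul_sub, sub_eq_add_neg, add_comm]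
      rw [this, had, smul_smul, inv_mul_cancel₀ hrc, one_smul]
  have hinv' := mul_eq_one_comm.1 hinv
  rw [Matrix.fromBlocks_multiply, ← Matrix.fromBlocks_one, Matrix.fromBlocks_inj] at hinv hinv'
  obtain ⟨i1, i2, i3, i4⟩ := hinv
  obtain ⟨j1, j2, j3, j4⟩ := hinv'
  set a' := (r : ℂ)⁻¹ • dᴴ
  set b' := -((r : ℂ)⁻¹ • bᴴ)
  set c' := -((r : ℂ)⁻¹ • cᴴ)
  set d' := (r : ℂ)⁻¹ • aᴴ
  have back1 : ∀ S T : Mat2, a' * (a * S + b * T) + b' * (c * S + d * T) = S := by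
    intro S T
    have : a' * (a * S + b * T) + b' * (c * S + d * T)
      = (a' * a + b' * c) * S + (a' * b + b' * d) * T := by noncomm_ring
    rw [this, i1, i2]; simp
  have back2 : ∀ S T : Mat2, c' * (a * S + b * T) + d' * (c * S + d * T) = T := by
    intro S T
    have : c' * (a * S + b * T) + d' * (c * S + d * T)
      = (c' * a + d' * c) * S + (c' * b + d' * d) * T := by noncomm_ring
    rw [this, i3, i4]; simp
  have forw1 : ∀ S T : Mat2, a * (a' * S + b' * T) + b * (c' * S + d' * T) = S := by
    intro S T
    have : a * (a' * S + b' * T) + b * (c' * S + d' * T)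
      = (a * a' + b * c') * S + (a * b' + b * d') * T := by noncomm_ring
    rw [this, j1, j2]; simp
  have forw2 : ∀ S T : Mat2, c * (a' * S + b' * T) + d * (c' * S + d' * T) = T := by
    intro S T
    have : c * (a' * S + b' * T) + d * (c' * S + d' * T)
      = (c * a' + d * c') * S + (c * b' + d * d') * T := by noncomm_ring
    rw [this, j3, j4]; simp
  refine exists_isAut_of_pairs (fun x => (a * x.1 + b * x.2, c * x.1 + d * x.2)) ?_ ?_ ?_ ?_
  · intro x hx
    refine ⟨by simp only; rw [hp, hx.1, smul_zero], fun v h1 h2 => ?_⟩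
    simp only at h1 h2
    apply hx.2
    · rw [← back1 x.1 x.2, Matrix.add_mulVec, ← Matrix.mulVec_mulVec, ← Matrix.mulVec_mulVec, h1, h2]
      simp
    · rw [← back2 x.1 x.2, Matrix.add_mulVec, ← Matrix.mulVec_mulVec, ← Matrix.mulVec_mulVec, h1, h2]
      simp
  · intro x y
    simp only
    rw [hp, Matrix.det_smul]
    simp [hrc]
  · intro x y
    simp only
    rw [hp, smul_eq_zero]
    simp only [hrc, false_or]
  · intro y hy
    refine ⟨(a' * y.1 + b' * y.2, c' * y.1 + d' * y.2), ⟨?_, fun v h1 h2 => ?_⟩, ?_⟩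
    · have := hp (a' * y.1 + b' * y.2) (c' * y.1 + d' * y.2) (a' * y.1 + b' * y.2)
        (c' * y.1 + d' * y.2)
      rw [forw1, forw2, hy.1] at this
      simpa only [smul_eq_zero, hrc, false_or] using this.symm
    · simp only at h1 h2
      apply hy.2
      · rw [← forw1 y.1 y.2, Matrix.add_mulVec, ← Matrix.mulVec_mulVec, ← Matrix.mulVec_mulVec, h1,
          h2]
        simp
      · rw [← forw2 y.1 y.2, Matrix.add_mulVec, ← Matrix.mulVec_mulVec, ← Matrix.mulVec_mulVec, h1,
          h2]
        simp
    · simp only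
      rw [forw1, forw2]

theorem exists_isAut_translation (H : Mat2) (hH : H.IsHermitian) :
    ∃ Φ : U2 → U2, IsAut Φ ∧ ∀ S T, IsLag S T → Φ (pt S T) = pt (S + H * T) T := by
  obtain ⟨Φ, h, h'⟩ := exists_isAut_of_blocks 1 H 0 1 1 one_ne_zero (by simp)
    (by simp [hH.eq]) (by simp)
  exact ⟨Φ, h, fun S T hL => by rw [h' S T hL]; simp⟩

theorem exists_isAut_congruence (g k : Mat2) (hk : k * g = 1) (r : ℝ) (hr : r ≠ 0) :
    ∃ Φ : U2 → U2, IsAut Φ ∧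
      ∀ S T, IsLag S T → Φ (pt S T) = pt ((r : ℂ) • (g * S)) (kᴴ * T) := by
  obtain ⟨Φ, h, h'⟩ := exists_isAut_of_blocks ((r : ℂ) • g) 0 0 kᴴ r hr (by simp) (by simp)
    (by simp [← conjTranspose_mul, hk])
  exact ⟨Φ, h, fun S T hL => by rw [h' S T hL]; simp⟩

theorem exists_isAut_conj :
    ∃ Φ : U2 → U2, IsAut Φ ∧ ∀ S T, IsLag S T →
      Φ (pt S T) = pt (S.map (starRingEnd ℂ)) (T.map (starRingEnd ℂ)) := by
  have hp : ∀ S T S' T' : Mat2, pairing (S.map (starRingEnd ℂ)) (T.map (starRingEnd ℂ))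
      (S'.map (starRingEnd ℂ)) (T'.map (starRingEnd ℂ))
      = (pairing S T S' T').map (starRingEnd ℂ) := by
    intro S T S' T'
    ext i j
    simp [pairing, Matrix.mul_apply]
  have hd : ∀ M : Mat2, (M.map (starRingEnd ℂ)).det = 0 ↔ M.det = 0 := by
    intro M
    have := RingHom.map_det (starRingEnd ℂ) M
    rw [RingHom.mapMatrix_apply] at this
    rw [← this]; simp
  have h0 : ∀ M : Mat2, M.map (starRingEnd ℂ) = 0 ↔ M = 0 := by
    intro M
    constructor
    · intro h
      ext i j
      have := congrFun (congrFun h i) j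
      simpa using this
    · rintro rfl
      ext i j; simp
  have hv : ∀ (M : Mat2) v, M.map (starRingEnd ℂ) *ᵥ v = 0 → M *ᵥ (star v) = 0 := by
    intro M v h
    ext i
    have := congrArg (starRingEnd ℂ) (congrFun h i)
    simpa [Matrix.mulVec, dotProduct] using this
  have hL : ∀ x : Mat2 × Mat2, IsLag x.1 x.2 →
      IsLag (x.1.map (starRingEnd ℂ)) (x.2.map (starRingEnd ℂ)) := by
    intro x hx
    refine ⟨by rw [hp, h0]; exact hx.1, fun v h1 h2 => ?_⟩
    have := hx.2 _ (hv _ _ h1) (hv _ _ h2)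
    simpa using this
  refine exists_isAut_of_pairs
    (fun x => (x.1.map (starRingEnd ℂ), x.2.map (starRingEnd ℂ))) hL ?_ ?_ ?_
  · intro x y; simp only; rw [hp, hd]
  · intro x y; simp only; rw [hp, h0]
  · intro y hy
    refine ⟨(y.1.map (starRingEnd ℂ), y.2.map (starRingEnd ℂ)), hL y hy, ?_⟩
    ext i j <;> simp

/-! ### Coordinates on `U₂` -/

/-- Coordinates on the compactification: finite points are hermitian matrices
`[[a, b], [conj b, d]]`, the points at infinity are indexed by a direction and a real number,
and there is one vertex `top`. -/
inductive MP : Type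
  | fin (a : ℝ) (b : ℂ) (d : ℝ) : MP
  | inf (z : Option ℂ) (s : ℝ) : MP
  | top : MP

/-- The value of the hermitian form `[[a, b], [conj b, d]]` on the direction `z`. -/
def lf (z : Option ℂ) (a : ℝ) (b : ℂ) (d : ℝ) : ℝ :=
  match z with
  | none => d
  | some z => a - 2 * (z.re * b.re + z.im * b.im) + (z.re ^ 2 + z.im ^ 2) * d

/-- Coherency in coordinates. -/
def coh : MP → MP → Prop
  | .fin a b d, .fin a' b' d' =>
      (a - a') * (d - d') = (b.re - b'.re) ^ 2 + (b.im - b'.im) ^ 2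
  | .fin a b d, .inf z s => lf z a b d = s
  | .fin _ _ _, .top => False
  | .inf z s, .fin a b d => lf z a b d = s
  | .inf z _, .inf z' _ => z = z'
  | .inf _ _, .top => True
  | .top, .fin _ _ _ => False
  | .top, .inf _ _ => True
  | .top, .top => True

/-- The hermitian matrix with prescribed entries. -/
def hmat (a : ℝ) (b : ℂ) (d : ℝ) : Mat2 := !![(a : ℂ), b; (starRingEnd ℂ) b, (d : ℂ)]

/-- The first half of a basis of the Lagrangian plane with given coordinates. -/
def repS : MP → Mat2
  | .fin a b d => hmat a b d
  | .inf (some z) s => !![(s : ℂ), z; 0, 1]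
  | .inf none s => !![0, 1; (s : ℂ), 0]
  | .top => 1

/-- The second half of a basis of the Lagrangian plane with given coordinates. -/
def repT : MP → Mat2
  | .fin _ _ _ => 1
  | .inf (some z) _ => !![1, 0; -(starRingEnd ℂ) z, 0]
  | .inf none _ => !![0, 0; 1, 0]
  | .top => 0

theorem isLag_rep (x : MP) : IsLag (repS x) (repT x) := by
  rcases x with ⟨a, b, d⟩ | ⟨_ | z, s⟩ | _
  · refine ⟨?_, fun v _ h => by simpa [repT] using h⟩
    ext i j
    fin_cases i <;> fin_cases j <;> simp [pairing, repS, repT, hmat]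
  · refine ⟨?_, fun v h1 h2 => ?_⟩
    · ext i j
      fin_cases i <;> fin_cases j <;>
        simp [pairing, repS, repT, Matrix.mul_apply, Fin.sum_univ_two]
    · have e1 := congrFun h1 0
      have e2 := congrFun h2 1
      simp [repS, repT, Matrix.mulVec, dotProduct, Fin.sum_univ_two] at e1 e2
      ext i; fin_cases i <;> simp [e1, e2]
  · refine ⟨?_, fun v h1 h2 => ?_⟩
    · ext i j
      fin_cases i <;> fin_cases j <;>
        simp [pairing, repS, repT, Matrix.mul_apply, Fin.sum_univ_two]
    · have e1 := congrFun h1 1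
      have e2 := congrFun h2 0
      simp [repS, repT, Matrix.mulVec, dotProduct, Fin.sum_univ_two] at e1 e2
      ext i; fin_cases i <;> simp [e1, e2]
  · refine ⟨by simp [pairing, repT], fun v h _ => by simpa [repS] using h⟩

/-- The point of `U₂` with given coordinates. -/
def toU (x : MP) : U2 := pt (repS x) (repT x)

theorem det_pairing_fin_fin (a a' : ℝ) (b b' : ℂ) (d d' : ℝ) :
    (pairing (repS (.fin a b d)) (repT (.fin a b d)) (repS (.fin a' b' d'))
      (repT (.fin a' b' d'))).det
      = (((a - a') * (d - d') - ((b.re - b'.re) ^ 2 + (b.im - b'.im) ^ 2) : ℝ) : ℂ) := by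
  rw [Matrix.det_fin_two]
  apply Complex.ext <;>
    simp [pairing, repS, repT, hmat, Matrix.mul_apply, Fin.sum_univ_two, pow_two] <;> ring

theorem det_pairing_fin_inf (a : ℝ) (b : ℂ) (d : ℝ) (z : Option ℂ) (s : ℝ) :
    ∃ r : ℝ, r ≠ 0 ∧ (pairing (repS (.fin a b d)) (repT (.fin a b d)) (repS (.inf z s))
      (repT (.inf z s))).det = ((r * (lf z a b d - s) : ℝ) : ℂ) := by
  rcases z with _ | z
  · refine ⟨1, one_ne_zero, ?_⟩
    rw [Matrix.det_fin_two]
    apply Complex.ext <;>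
      simp [pairing, repS, repT, hmat, lf, Matrix.mul_apply, Fin.sum_univ_two, pow_two]
  · refine ⟨-1, by norm_num, ?_⟩
    rw [Matrix.det_fin_two]
    apply Complex.ext <;>
      simp [pairing, repS, repT, hmat, lf, Matrix.mul_apply, Fin.sum_univ_two, pow_two] <;> ring

theorem det_pairing_inf_inf (z z' : Option ℂ) (s s' : ℝ) :
    (pairing (repS (.inf z s)) (repT (.inf z s)) (repS (.inf z' s'))
      (repT (.inf z' s'))).det = 0 ↔ z = z' := by
  rcases z with _ | z <;> rcases z' with _ | z' <;> rw [Matrix.det_fin_two]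
  · simp [pairing, repS, repT, Matrix.mul_apply, Fin.sum_univ_two]
  · simp [pairing, repS, repT, Matrix.mul_apply, Fin.sum_univ_two]
  · simp [pairing, repS, repT, Matrix.mul_apply, Fin.sum_univ_two]
  · have h1 : z + -z' = 0 ↔ z = z' := by rw [← sub_eq_add_neg, sub_eq_zero]
    have h2 : (starRingEnd ℂ) z + -(starRingEnd ℂ) z' = 0 ↔ z = z' := by
      rw [← sub_eq_add_neg, sub_eq_zero]
      exact (starRingEnd ℂ).injective.eq_iff
    simp [pairing, repS, repT, Matrix.mul_apply, Fin.sum_univ_two, h1, h2]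

theorem coh_symm {x y : MP} (h : coh x y) : coh y x := by
  rcases x with ⟨a, b, d⟩ | ⟨z, s⟩ | _ <;> rcases y with ⟨a', b', d'⟩ | ⟨z', s'⟩ | _ <;>
    simp only [coh] at h ⊢ <;> first | exact h | exact h.symm | skip
  linear_combination h

theorem coherentU_toU (x y : MP) : CoherentU (toU x) (toU y) ↔ coh x y := by
  have fi : ∀ (a : ℝ) (b : ℂ) (d : ℝ) (z : Option ℂ) (s : ℝ),
      CoherentU (toU (.fin a b d)) (toU (.inf z s)) ↔ coh (.fin a b d) (.inf z s) := by
    intro a b d z s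
    rw [toU, toU, coherentU_pt (isLag_rep _) (isLag_rep _)]
    obtain ⟨r, hr, h⟩ := det_pairing_fin_inf a b d z s
    rw [h, Complex.ofReal_eq_zero, mul_eq_zero, or_iff_right hr, sub_eq_zero]
    rfl
  have ft : ∀ (a : ℝ) (b : ℂ) (d : ℝ), ¬ CoherentU (toU (.fin a b d)) (toU .top) := by
    intro a b d
    rw [toU, toU, coherentU_pt (isLag_rep _) (isLag_rep _), Matrix.det_fin_two]
    simp [pairing, repS, repT]
  have it : ∀ (z : Option ℂ) (s : ℝ), CoherentU (toU (.inf z s)) (toU .top) := by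
    intro z s
    rw [toU, toU, coherentU_pt (isLag_rep _) (isLag_rep _)]
    rcases z with _ | z <;> rw [Matrix.det_fin_two] <;> simp [pairing, repS, repT]
  rcases x with ⟨a, b, d⟩ | ⟨z, s⟩ | _ <;> rcases y with ⟨a', b', d'⟩ | ⟨z', s'⟩ | _
  · rw [toU, toU, coherentU_pt (isLag_rep _) (isLag_rep _), det_pairing_fin_fin,
      Complex.ofReal_eq_zero, sub_eq_zero]
    rfl
  · exact fi _ _ _ _ _
  · exact iff_of_false (ft _ _ _) (by simp [coh])
  · exact ⟨fun h => coh_symm ((fi _ _ _ _ _).1 h.symm),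
      fun h => ((fi _ _ _ _ _).2 (coh_symm h)).symm⟩
  · rw [toU, toU, coherentU_pt (isLag_rep _) (isLag_rep _), det_pairing_inf_inf]
    rfl
  · exact iff_of_true (it _ _) trivial
  · exact iff_of_false (fun h => ft _ _ _ h.symm) (by simp [coh])
  · exact iff_of_true (it _ _).symm trivial
  · exact iff_of_true (CoherentU.refl _) trivial

theorem toU_injective : Function.Injective toU := by
  intro x y h
  have hc : ∀ w, coh x w ↔ coh y w := fun w => by
    rw [← coherentU_toU, ← coherentU_toU, h]
  rw [toU, toU, pt_eq_pt (isLag_rep _) (isLag_rep _)] at h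
  rcases x with ⟨a, b, d⟩ | ⟨z, s⟩ | _ <;> rcases y with ⟨a', b', d'⟩ | ⟨z', s'⟩ | _
  · have h00 := congrFun (congrFun h 0) 0
    have h01 := congrFun (congrFun h 0) 1
    have h11 := congrFun (congrFun h 1) 1
    simp [pairing, repS, repT, hmat, sub_eq_zero] at h00 h01 h11
    subst h00 h01 h11; rfl
  · exact absurd ((hc .top).2 trivial) (by simp [coh])
  · exact absurd ((hc .top).2 trivial) (by simp [coh])
  · exact absurd ((hc .top).1 trivial) (by simp [coh])
  · have hz : z = z' := (hc (.inf z' 0)).2 rfl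
    subst hz
    have hs : ∀ w : ℝ, ∃ K : ℝ × ℝ, lf z K.1 0 K.2 = w := by
      intro w
      rcases z with _ | z
      · exact ⟨(0, w), rfl⟩
      · exact ⟨(w, 0), by simp [lf]⟩
    obtain ⟨K, hK⟩ := hs s
    have : lf z K.1 0 K.2 = s' := (hc (.fin K.1 0 K.2)).1 hK
    rw [← this, hK]
  · have := (hc (.inf (if z = none then some 0 else none) 0)).2 trivial
    rcases z with _ | z <;> simp [coh] at this
  · exact absurd ((hc .top).1 trivial) (by simp [coh])
  · have := (hc (.inf (if z' = none then some 0 else none) 0)).1 trivial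
    rcases z' with _ | z <;> simp [coh] at this
  · rfl

theorem exists_eq_smul_of_orthogonal {t0 t1 c0 c1 r0 r1 : ℂ} (ht : t0 ≠ 0 ∨ t1 ≠ 0)
    (hc : c0 ≠ 0 ∨ c1 ≠ 0) (h1 : c0 * t0 + c1 * t1 = 0) (h2 : r0 * t0 + r1 * t1 = 0) :
    ∃ s : ℂ, r0 = s * c0 ∧ r1 = s * c1 := by
  have hd : r0 * c1 = r1 * c0 := by
    rcases ht with ht | ht
    · apply mul_right_cancel₀ ht
      linear_combination c1 * h2 - r1 * h1
    · apply mul_right_cancel₀ ht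
      linear_combination r0 * h1 - c0 * h2
  rcases hc with hc | hc
  · exact ⟨r0 / c0, by field_simp, by field_simp; linear_combination -hd⟩
  · exact ⟨r1 / c1, by field_simp; linear_combination hd, by field_simp⟩

theorem isHermitian_eq_hmat {K : Mat2} (h : K.IsHermitian) :
    K = hmat (K 0 0).re (K 0 1) (K 1 1).re := by
  have h00 : (starRingEnd ℂ) (K 0 0) = K 0 0 := congrFun (congrFun h 0) 0
  have h10 : (starRingEnd ℂ) (K 0 1) = K 1 0 := congrFun (congrFun h 1) 0
  have h11 : (starRingEnd ℂ) (K 1 1) = K 1 1 := congrFun (congrFun h 1) 1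
  ext i j
  fin_cases i <;> fin_cases j
  · exact (Complex.conj_eq_iff_re.1 h00).symm
  · rfl
  · exact h10.symm
  · exact (Complex.conj_eq_iff_re.1 h11).symm

theorem real_of_conj_mul_real {s c : ℂ} (hc : c ≠ 0)
    (h : (starRingEnd ℂ) ((starRingEnd ℂ) (s * c) * c) = (starRingEnd ℂ) (s * c) * c) :
    ((s.re : ℝ) : ℂ) = s := by
  apply Complex.conj_eq_iff_re.1
  have h2 : (starRingEnd ℂ) s * (c * (starRingEnd ℂ) c) = s * (c * (starRingEnd ℂ) c) := by
    simp only [map_mul, Complex.conj_conj] at h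
    linear_combination -h
  exact mul_right_cancel₀ (by simp [hc]) h2

theorem toU_surjective : Function.Surjective toU := by
  intro U
  obtain ⟨S, T, hL, rfl⟩ := exists_rep U
  suffices h : ∃ x, pairing (repS x) (repT x) S T = 0 by
    obtain ⟨x, hx⟩ := h
    exact ⟨x, (pt_eq_pt (isLag_rep x) hL).2 hx⟩
  have hST : Sᴴ * T = Tᴴ * S := sub_eq_zero.1 hL.1
  by_cases hT : T.det = 0
  swap
  · have hu : IsUnit T.det := isUnit_iff_ne_zero.2 hT
    have hK : (S * T⁻¹).IsHermitian := by
      have e : (S * T⁻¹)ᴴ * T = S := by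
        have h1 : Tᴴ * ((S * T⁻¹)ᴴ * T) = Tᴴ * S := by
          rw [← hST, ← Matrix.mul_assoc, ← conjTranspose_mul, Matrix.mul_assoc,
            Matrix.nonsing_inv_mul _ hu, Matrix.mul_one]
        have h2 := congrArg (fun Z => (T⁻¹)ᴴ * Z) h1
        simp only [← Matrix.mul_assoc] at h2
        rw [← conjTranspose_mul, Matrix.mul_nonsing_inv _ hu] at h2
        simpa using h2
      calc (S * T⁻¹)ᴴ = (S * T⁻¹)ᴴ * T * T⁻¹ := by
            rw [Matrix.mul_assoc, Matrix.mul_nonsing_inv _ hu, Matrix.mul_one]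
        _ = S * T⁻¹ := by rw [e]
    refine ⟨.fin ((S * T⁻¹) 0 0).re ((S * T⁻¹) 0 1) ((S * T⁻¹) 1 1).re, ?_⟩
    simp only [repS, repT, ← isHermitian_eq_hmat hK, pairing, hK.eq]
    rw [Matrix.mul_assoc, Matrix.nonsing_inv_mul _ hu]
    simp
  by_cases hT0 : T = 0
  · exact ⟨.top, by simp [pairing, repT, hT0]⟩
  obtain ⟨t, ht, hTt⟩ := (Matrix.exists_mulVec_eq_zero_iff).2 hT
  have hw : S *ᵥ t ≠ 0 := fun h => ht (hL.2 t h hTt)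
  have hTw : Tᴴ *ᵥ (S *ᵥ t) = 0 := by
    rw [Matrix.mulVec_mulVec, ← hST, ← Matrix.mulVec_mulVec, hTt]; simp
  have ht' : t 0 ≠ 0 ∨ t 1 ≠ 0 := by
    by_contra hcon
    push Not at hcon
    exact ht (by ext i; fin_cases i <;> simp [hcon])
  have hT0t : T 0 0 * t 0 + T 0 1 * t 1 = 0 := by
    simpa [Matrix.mulVec, dotProduct, Fin.sum_univ_two] using congrFun hTt 0
  have hT1t : T 1 0 * t 0 + T 1 1 * t 1 = 0 := by
    simpa [Matrix.mulVec, dotProduct, Fin.sum_univ_two] using congrFun hTt 1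
  have hdiag : ∀ j, (starRingEnd ℂ) ((starRingEnd ℂ) (S 0 j) * T 0 j + (starRingEnd ℂ) (S 1 j) * T 1 j)
      = (starRingEnd ℂ) (S 0 j) * T 0 j + (starRingEnd ℂ) (S 1 j) * T 1 j := by
    intro j
    have := congrFun (congrFun hST j) j
    simp [Matrix.mul_apply, Fin.sum_univ_two] at this
    rw [this]
    simp only [map_add, map_mul, Complex.conj_conj]
    linear_combination this
  have hTw' : ∀ j, (starRingEnd ℂ) (T 0 j) * (S *ᵥ t) 0 + (starRingEnd ℂ) (T 1 j) * (S *ᵥ t) 1 = 0 := by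
    intro j
    have := congrFun hTw j
    simp only [Matrix.mulVec, dotProduct, Fin.sum_univ_two, conjTranspose_apply, Pi.zero_apply]
      at this ⊢
    exact this
  have hS0 : (S *ᵥ t) 0 = S 0 0 * t 0 + S 0 1 * t 1 := by
    simp [Matrix.mulVec, dotProduct, Fin.sum_univ_two]
  have hS1 : (S *ᵥ t) 1 = S 1 0 * t 0 + S 1 1 * t 1 := by
    simp [Matrix.mulVec, dotProduct, Fin.sum_univ_two]
  by_cases hw1 : (S *ᵥ t) 1 = 0
  · have hw0 : (S *ᵥ t) 0 ≠ 0 := fun h => hw (by ext i; fin_cases i <;> simp [h, hw1])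
    have hT0j : ∀ j, T 0 j = 0 := by
      intro j
      have := hTw' j
      rw [hw1, mul_zero, add_zero, mul_eq_zero, or_iff_left hw0] at this
      simpa using this
    have hc : T 1 0 ≠ 0 ∨ T 1 1 ≠ 0 := by
      by_contra hcon
      push Not at hcon
      exact hT0 (by ext i j; fin_cases i <;> fin_cases j <;> simp [hcon, hT0j])
    obtain ⟨s, e0, e1⟩ := exists_eq_smul_of_orthogonal ht' hc hT1t (hS1 ▸ hw1)
    have hs : ((s.re : ℝ) : ℂ) = s := by
      rcases hc with hc | hc
      · have := hdiag 0
        rw [hT0j, e0] at this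
        simp only [mul_zero, zero_add] at this
        exact real_of_conj_mul_real hc this
      · have := hdiag 1
        rw [hT0j, e1] at this
        simp only [mul_zero, zero_add] at this
        exact real_of_conj_mul_real hc this
    have hs' : (starRingEnd ℂ) s = s := Complex.conj_eq_iff_re.2 hs
    refine ⟨.inf none s.re, ?_⟩
    ext i j
    fin_cases i <;> fin_cases j <;>
      simp [pairing, repS, repT, Matrix.mul_apply, Fin.sum_univ_two, hT0j, hs, hs', e0, e1]
  · obtain ⟨ζ, hζ⟩ : ∃ ζ, (S *ᵥ t) 0 = ζ * (S *ᵥ t) 1 := ⟨_ / _, (div_mul_cancel₀ _ hw1).symm⟩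
    have hT1j : ∀ j, T 1 j = -((starRingEnd ℂ) ζ * T 0 j) := by
      intro j
      have h1 := hTw' j
      have h2 : (starRingEnd ℂ) (T 0 j) * ζ + (starRingEnd ℂ) (T 1 j) = 0 := by
        apply mul_right_cancel₀ hw1
        rw [hζ] at h1
        linear_combination h1
      have h3 := congrArg (starRingEnd ℂ) h2
      simp at h3
      linear_combination h3
    have hc : T 0 0 ≠ 0 ∨ T 0 1 ≠ 0 := by
      by_contra hcon
      push Not at hcon
      exact hT0 (by ext i j; fin_cases i <;> fin_cases j <;> simp [hcon, hT1j])
    obtain ⟨s, e0, e1⟩ := exists_eq_smul_of_orthogonal (r0 := S 0 0 - ζ * S 1 0)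
      (r1 := S 0 1 - ζ * S 1 1) ht' hc hT0t (by rw [hS0, hS1] at hζ; linear_combination hζ)
    have hdiag' : ∀ j, (starRingEnd ℂ) (S 0 j) * T 0 j + (starRingEnd ℂ) (S 1 j) * T 1 j
        = (starRingEnd ℂ) (S 0 j - ζ * S 1 j) * T 0 j := by
      intro j
      rw [hT1j j]; simp; ring
    have hs : ((s.re : ℝ) : ℂ) = s := by
      rcases hc with hc | hc
      · have := hdiag 0
        rw [hdiag', e0] at this
        exact real_of_conj_mul_real hc this
      · have := hdiag 1
        rw [hdiag', e1] at this
        exact real_of_conj_mul_real hc this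
    have hs' : (starRingEnd ℂ) s = s := Complex.conj_eq_iff_re.2 hs
    refine ⟨.inf (some ζ) s.re, ?_⟩
    ext i j
    fin_cases i <;> fin_cases j <;>
      simp [pairing, repS, repT, Matrix.mul_apply, Fin.sum_univ_two, hs, hs', hT1j]
    · linear_combination -e0
    · linear_combination -e1

/-! ### The coherency geometry of `U₂` -/

theorem toU_top : toU .top = 1 := by
  have h := coe_pt (isLag_rep .top)
  apply Subtype.ext
  change (pt (repS .top) (repT .top) : Mat2) = 1
  rw [h]
  simp [repS, repT]

/-- Two points coherent to two distinct coherent points are coherent. -/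
theorem CoherentU.of_common {x y z w : U2} (hne : x ≠ y) (hxy : CoherentU x y)
    (hzx : CoherentU z x) (hzy : CoherentU z y) (hwx : CoherentU w x) (hwy : CoherentU w y) :
    CoherentU z w := by
  have hA := isAut_mul_left x⁻¹
  have hx : x⁻¹ * x = toU .top := by rw [toU_top]; simp
  obtain ⟨y', hy'⟩ := toU_surjective (x⁻¹ * y)
  obtain ⟨z', hz'⟩ := toU_surjective (x⁻¹ * z)
  obtain ⟨w', hw'⟩ := toU_surjective (x⁻¹ * w)
  rw [hA.2] at hxy hzx hzy hwx hwy ⊢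
  simp only at hxy hzx hzy hwx hwy ⊢
  rw [hx] at hxy hzx hwx
  rw [← hy'] at hxy hzy hwy
  rw [← hz'] at hzx hzy ⊢
  rw [← hw'] at hwx hwy ⊢
  rw [coherentU_toU] at *
  have hy : y' ≠ .top := by
    rintro rfl
    rw [← hx] at hy'
    exact hne (hA.1.1 hy')
  rcases y' with ⟨a, b, d⟩ | ⟨ζ, s⟩ | _
  · exact absurd hxy (by simp [coh])
  · rcases z' with ⟨a, b, d⟩ | ⟨ζ', s'⟩ | _
    · exact absurd hzx (by simp [coh])
    · rcases w' with ⟨a, b, d⟩ | ⟨ζ'', s''⟩ | _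
      · exact absurd hwx (by simp [coh])
      · simp only [coh] at *
        exact hzy.trans hwy.symm
      · trivial
    · exact coh_symm hwx
  · exact absurd rfl hy

/-- Two coherent points that are both coherent to two incoherent points are equal. -/
theorem CoherentU.eq_of_not {p q c c' : U2} (hpq : ¬ CoherentU p q) (hcp : CoherentU c p)
    (hcq : CoherentU c q) (hcp' : CoherentU c' p) (hcq' : CoherentU c' q)
    (h : CoherentU c c') : c = c' := by
  by_contra hne
  exact hpq (CoherentU.of_common hne h hcp.symm hcp'.symm hcq.symm hcq'.symm)

theorem CoherentU.eq_of_three {k k' u v w : U2} (huv : CoherentU u v) (hne : u ≠ v)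
    (huw : ¬ CoherentU u w) (h1 : CoherentU k u) (h2 : CoherentU k v) (h3 : CoherentU k w)
    (h1' : CoherentU k' u) (h2' : CoherentU k' v) (h3' : CoherentU k' w) : k = k' :=
  CoherentU.eq_of_not huw h1 h3 h1' h3' (CoherentU.of_common hne huv h1 h2 h1' h2')

theorem isLine_of_common {u v : U2} (hne : u ≠ v) (h : CoherentU u v) :
    IsLine {W | CoherentU W u ∧ CoherentU W v} := by
  refine ⟨fun U hU V hV => CoherentU.of_common hne h hU.1 hU.2 hV.1 hV.2, fun m hm hc => ?_⟩
  apply Set.Subset.antisymm _ hm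
  intro W hW
  exact ⟨hc W hW u (hm ⟨CoherentU.refl _, h⟩), hc W hW v (hm ⟨h.symm, CoherentU.refl _⟩)⟩

/-! ### Coherency preservers in coordinates -/

/-- The hermitian matrix `[[a, b], [conj b, d]]` is positive semidefinite. -/
def psd (a : ℝ) (b : ℂ) (d : ℝ) : Prop := 0 ≤ a ∧ 0 ≤ d ∧ b.re ^ 2 + b.im ^ 2 ≤ a * d

/-- The coordinate domain `{x : -(α, β, δ) ≤ x ≤ top}`. -/
def dom (α : ℝ) (β : ℂ) (δ : ℝ) : MP → Prop
  | .fin a b d => psd (a + α) (b + β) (d + δ)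
  | .inf z s => -lf z α β δ ≤ s
  | .top => True

theorem psd.add {a d a' d' : ℝ} {b b' : ℂ} (h : psd a b d) (h' : psd a' b' d') :
    psd (a + a') (b + b') (d + d') := by
  obtain ⟨ha, hd, hb⟩ := h
  obtain ⟨ha', hd', hb'⟩ := h'
  refine ⟨by linarith, by linarith, ?_⟩
  simp only [Complex.add_re, Complex.add_im]
  have key : 2 * (b.re * b'.re + b.im * b'.im) ≤ a * d' + a' * d := by
    apply le_of_sq_le_sq _ (by positivity)
    have e1 : (b.re * b'.re + b.im * b'.im) ^ 2
        ≤ (b.re ^ 2 + b.im ^ 2) * (b'.re ^ 2 + b'.im ^ 2) := by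
      nlinarith [sq_nonneg (b.re * b'.im - b.im * b'.re)]
    have e2 : (b.re ^ 2 + b.im ^ 2) * (b'.re ^ 2 + b'.im ^ 2) ≤ (a * d) * (a' * d') :=
      mul_le_mul hb hb' (by positivity) (by positivity)
    nlinarith [sq_nonneg (a * d' - a' * d)]
  nlinarith

theorem psd.lf_nonneg {a d : ℝ} {b : ℂ} (h : psd a b d) (z : Option ℂ) : 0 ≤ lf z a b d := by
  obtain ⟨ha, hd, hb⟩ := h
  rcases z with _ | z
  · exact hd
  · simp only [lf]
    rcases hd.eq_or_lt with h0 | h0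
    · subst h0
      have h1 : b.re = 0 := by nlinarith [sq_nonneg b.re, sq_nonneg b.im]
      have h2 : b.im = 0 := by nlinarith [sq_nonneg b.re, sq_nonneg b.im]
      rw [h1, h2]; simpa using ha
    · have : 0 ≤ d * (a - 2 * (z.re * b.re + z.im * b.im) + (z.re ^ 2 + z.im ^ 2) * d) := by
        nlinarith [sq_nonneg (d * z.re - b.re), sq_nonneg (d * z.im - b.im)]
      exact nonneg_of_mul_nonneg_right this h0

/-- The upper left entry of the rank one matrix `w` annihilated by the form `lf z`. -/
def wa : Option ℂ → ℝ
  | none => 1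
  | some z => z.re ^ 2 + z.im ^ 2

/-- The upper right entry of the rank one matrix `w`. -/
def wb : Option ℂ → ℂ
  | none => 0
  | some z => z

/-- The lower right entry of the rank one matrix `w`. -/
def wd : Option ℂ → ℝ
  | none => 0
  | some _ => 1

theorem wb_sq (z : Option ℂ) : (wb z).re ^ 2 + (wb z).im ^ 2 = wa z * wd z := by
  rcases z with _ | z <;> simp [wa, wb, wd]

theorem psd_w (z : Option ℂ) {s : ℝ} (hs : 0 ≤ s) : psd (s * wa z) (s * wb z) (s * wd z) := by
  refine ⟨?_, ?_, ?_⟩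
  · rcases z with _ | z <;> simp only [wa] <;> positivity
  · rcases z with _ | z <;> simp only [wd] <;> positivity
  · have := wb_sq z
    simp only [Complex.re_ofReal_mul, Complex.im_ofReal_mul]
    apply le_of_eq
    linear_combination s ^ 2 * this

theorem lf_add (z : Option ℂ) (a a' : ℝ) (b b' : ℂ) (d d' : ℝ) :
    lf z (a + a') (b + b') (d + d') = lf z a b d + lf z a' b' d' := by
  rcases z with _ | z <;> simp [lf]; ring

theorem lf_mul (z : Option ℂ) (s a : ℝ) (b : ℂ) (d : ℝ) :
    lf z (s * a) (s * b) (s * d) = s * lf z a b d := by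
  rcases z with _ | z <;> simp [lf]; ring

theorem lf_zero (z : Option ℂ) : lf z 0 0 0 = 0 := by
  rcases z with _ | z <;> simp [lf]

theorem lf_w_self (z : Option ℂ) : lf z (wa z) (wb z) (wd z) = 0 := by
  rcases z with _ | z <;> simp [lf, wa, wb, wd]; ring

/-- Adding a multiple of the direction `z` to a hermitian matrix. -/
theorem coh_add_w (z : Option ℂ) (s a : ℝ) (b : ℂ) (d : ℝ) :
    coh (.fin (a + s * wa z) (b + s * wb z) (d + s * wd z)) (.fin a b d) := by
  have := wb_sq z
  simp only [coh, Complex.add_re, Complex.add_im, Complex.re_ofReal_mul, Complex.im_ofReal_mul]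
  linear_combination -s ^ 2 * this

theorem coh_add_w_add_w (z : Option ℂ) (s s' a : ℝ) (b : ℂ) (d : ℝ) :
    coh (.fin (a + s * wa z) (b + s * wb z) (d + s * wd z))
      (.fin (a + s' * wa z) (b + s' * wb z) (d + s' * wd z)) := by
  have := wb_sq z
  simp only [coh, Complex.add_re, Complex.add_im, Complex.re_ofReal_mul, Complex.im_ofReal_mul]
  linear_combination -(s - s') ^ 2 * this

theorem lf_add_w_self (z : Option ℂ) (s a : ℝ) (b : ℂ) (d : ℝ) :
    lf z (a + s * wa z) (b + s * wb z) (d + s * wd z) = lf z a b d := by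
  rw [lf_add, lf_mul, lf_w_self]; ring

/-- A coherency preserver on the coordinate domain, for which the origin and `top` have
incoherent images. -/
structure ModelMap (α : ℝ) (β : ℂ) (δ : ℝ) (ψ : MP → U2) : Prop where
  hpsd : psd α β δ
  map_coh : ∀ x y, dom α β δ x → dom α β δ y → coh x y → CoherentU (ψ x) (ψ y)
  hpq : ¬ CoherentU (ψ (.fin 0 0 0)) (ψ .top)

/-- All points but one are mapped into the cone of a point of the image. -/
def ConcC (α : ℝ) (β : ℂ) (δ : ℝ) (ψ : MP → U2) : Prop :=
  ∃ x₀ b, dom α β δ x₀ ∧ dom α β δ b ∧ ∀ x, dom α β δ x → x ≠ x₀ → CoherentU (ψ x) (ψ b)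

/-- All points off a line are mapped into a line. -/
def ConcL (α : ℝ) (β : ℂ) (δ : ℝ) (ψ : MP → U2) : Prop :=
  ∃ x₁ x₂ y₁ y₂, dom α β δ x₁ ∧ dom α β δ x₂ ∧ coh x₁ x₂ ∧ x₁ ≠ x₂ ∧ y₁ ≠ y₂ ∧
    CoherentU y₁ y₂ ∧ ∀ x, dom α β δ x → ¬ (coh x x₁ ∧ coh x x₂) →
      CoherentU (ψ x) y₁ ∧ CoherentU (ψ x) y₂

/-- The map extends to an automorphism. -/
def ConcStd (α : ℝ) (β : ℂ) (δ : ℝ) (ψ : MP → U2) : Prop :=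
  ∃ Φ : U2 → U2, IsAut Φ ∧ ∀ x, dom α β δ x → ψ x = Φ (toU x)

theorem dom_fin_of_psd {α δ : ℝ} {β : ℂ} (h0 : psd α β δ) {a d : ℝ} {b : ℂ} (h : psd a b d) :
    dom α β δ (.fin a b d) := h.add h0

theorem dom_fin_add {α δ : ℝ} {β : ℂ} {a d a' d' : ℝ} {b b' : ℂ} (h : dom α β δ (.fin a b d))
    (h' : psd a' b' d') : dom α β δ (.fin (a + a') (b + b') (d + d')) := by
  have := psd.add h h'
  simp only [dom]
  convert this using 1 <;> ring

theorem dom_fin_add_w {α δ : ℝ} {β : ℂ} {a d : ℝ} {b : ℂ} (h : dom α β δ (.fin a b d))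
    (z : Option ℂ) {s : ℝ} (hs : 0 ≤ s) :
    dom α β δ (.fin (a + s * wa z) (b + s * wb z) (d + s * wd z)) :=
  dom_fin_add h (psd_w z hs)

theorem dom_inf_of_nonneg {α δ : ℝ} {β : ℂ} (h0 : psd α β δ) (z : Option ℂ) {s : ℝ} (hs : 0 ≤ s) :
    dom α β δ (.inf z s) := by
  have := h0.lf_nonneg z
  simp only [dom]
  linarith

theorem dom_inf_of_fin {α δ : ℝ} {β : ℂ} {a d : ℝ} {b : ℂ} (h : dom α β δ (.fin a b d))
    (z : Option ℂ) : dom α β δ (.inf z (lf z a b d)) := by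
  have := psd.lf_nonneg h z
  rw [lf_add] at this
  simp only [dom]
  linarith

theorem psd_zero : psd 0 0 0 := ⟨le_rfl, le_rfl, by simp⟩

theorem dom_origin {α δ : ℝ} {β : ℂ} (h0 : psd α β δ) : dom α β δ (.fin 0 0 0) :=
  dom_fin_of_psd h0 psd_zero

theorem dom_top {α δ : ℝ} {β : ℂ} : dom α β δ .top := trivial

/-- A hermitian matrix that is not definite vanishes on some direction. -/
theorem exists_lf_eq_zero {a d : ℝ} {b : ℂ} (hd : d ≠ 0) (hdet : a * d ≤ b.re ^ 2 + b.im ^ 2) :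
    ∃ z : ℂ, lf (some z) a b d = 0 := by
  refine ⟨⟨b.re / d + √(b.re ^ 2 + b.im ^ 2 - a * d) / d, b.im / d⟩, ?_⟩
  have hs := Real.sq_sqrt (sub_nonneg.2 hdet)
  simp only [lf]
  set e := √(b.re ^ 2 + b.im ^ 2 - a * d)
  have : a = (b.re ^ 2 + b.im ^ 2 - e ^ 2) / d := by
    rw [hs]; field_simp; ring
  rw [this]
  field_simp
  ring

theorem exists_lf_eq_zero' {a : ℝ} {b : ℂ} (hb : b ≠ 0) : ∃ z : ℂ, lf (some z) a b 0 = 0 := by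
  have h : b.re ^ 2 + b.im ^ 2 ≠ 0 := by
    have := Complex.normSq_pos.2 hb
    rw [Complex.normSq_apply] at this
    nlinarith
  refine ⟨⟨a * b.re / (2 * (b.re ^ 2 + b.im ^ 2)), a * b.im / (2 * (b.re ^ 2 + b.im ^ 2))⟩, ?_⟩
  simp only [lf]
  field_simp
  ring

namespace ModelMap

variable {α : ℝ} {β : ℂ} {δ : ℝ} {ψ : MP → U2}

theorem inf_zero_coh_origin (hm : ModelMap α β δ ψ) (z : Option ℂ) :
    CoherentU (ψ (.inf z 0)) (ψ (.fin 0 0 0)) :=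
  hm.map_coh _ _ (dom_inf_of_nonneg hm.hpsd z le_rfl) (dom_origin hm.hpsd) (lf_zero z)

theorem inf_coh_top (hm : ModelMap α β δ ψ) (z : Option ℂ) {s : ℝ} (h : dom α β δ (.inf z s)) :
    CoherentU (ψ (.inf z s)) (ψ .top) :=
  hm.map_coh _ _ h dom_top trivial

theorem fin_coh_inf (hm : ModelMap α β δ ψ) {a d : ℝ} {b : ℂ} (h : dom α β δ (.fin a b d))
    (z : Option ℂ) : CoherentU (ψ (.fin a b d)) (ψ (.inf z (lf z a b d))) :=
  hm.map_coh _ _ h (dom_inf_of_fin h z) rfl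

theorem fin_coh_inf_of_eq (hm : ModelMap α β δ ψ) {a d : ℝ} {b : ℂ} (h : dom α β δ (.fin a b d))
    {z : Option ℂ} {s : ℝ} (hs : lf z a b d = s) :
    CoherentU (ψ (.fin a b d)) (ψ (.inf z s)) :=
  hs ▸ hm.fin_coh_inf h z

theorem eq_of_coh_pq (hm : ModelMap α β δ ψ) {c c' : U2}
    (h1 : CoherentU c (ψ (.fin 0 0 0))) (h2 : CoherentU c (ψ .top))
    (h1' : CoherentU c' (ψ (.fin 0 0 0))) (h2' : CoherentU c' (ψ .top))
    (h : CoherentU c c') : c = c' :=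
  CoherentU.eq_of_not hm.hpq h1 h2 h1' h2' h

/-! #### The degenerate case: one value on all directions but one -/

theorem coh_const_of_ne (hm : ModelMap α β δ ψ) {c : U2} (hc : ∀ z : ℂ, ψ (.inf (some z) 0) = c)
    {a d : ℝ} {b : ℂ} (hK : dom α β δ (.fin a b d)) (h : b ≠ 0 ∨ d ≠ 0) :
    CoherentU (ψ (.fin a b d)) c := by
  have hcp : CoherentU c (ψ (.fin 0 0 0)) := hc 0 ▸ hm.inf_zero_coh_origin (some 0)
  have hcq : CoherentU c (ψ .top) :=
    hc 0 ▸ hm.inf_coh_top (some 0) (dom_inf_of_nonneg hm.hpsd _ le_rfl)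
  by_cases hd : d = 0
  · subst hd
    obtain ⟨z, hz⟩ := exists_lf_eq_zero' (a := a) (h.resolve_right (by simp))
    rw [← hc z]
    exact hm.fin_coh_inf_of_eq hK hz
  rcases le_or_gt (a * d) (b.re ^ 2 + b.im ^ 2) with hdet | hdet
  · obtain ⟨z, hz⟩ := exists_lf_eq_zero hd hdet
    rw [← hc z]
    exact hm.fin_coh_inf_of_eq hK hz
  by_contra hcon
  set D := a * d - (b.re ^ 2 + b.im ^ 2) with hD
  have hDpos : 0 < D := by linarith
  have hd2 : 0 < d ^ 2 := by positivity
  set z : ℂ := ⟨b.re / d + 1, b.im / d⟩ with hz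
  set s : ℝ := -(D * d) / (D + d ^ 2) with hs
  have hden : D + d ^ 2 ≠ 0 := by positivity
  have ha : a = (D + (b.re ^ 2 + b.im ^ 2)) / d := by rw [hD]; field_simp; ring
  have hHd : d + s * wd (some z) = d ^ 3 / (D + d ^ 2) := by
    simp only [wd, hs]; field_simp; ring
  have hHd0 : d + s * wd (some z) ≠ 0 := by rw [hHd]; positivity
  have hHdet : (a + s * wa (some z)) * (d + s * wd (some z))
      = (b + s * wb (some z)).re ^ 2 + (b + s * wb (some z)).im ^ 2 := by
    simp only [Complex.add_re, Complex.add_im, Complex.re_ofReal_mul, Complex.im_ofReal_mul]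
    simp only [wa, wb, wd, hz, hs]
    rw [ha]
    field_simp
    ring
  have hH : dom α β δ (.fin (a + s * wa (some z)) (b + s * wb (some z)) (d + s * wd (some z))) := by
    rcases lt_or_gt_of_ne hd with hneg | hpos
    · apply dom_fin_add_w hK
      apply div_nonneg _ (by positivity)
      nlinarith
    · apply dom_fin_of_psd hm.hpsd
      have h1 : 0 < d + s * wd (some z) := by rw [hHd]; positivity
      refine ⟨?_, h1.le, hHdet.ge⟩
      by_contra hlt
      push Not at hlt
      have := mul_neg_of_neg_of_pos hlt h1
      rw [hHdet] at this
      nlinarith [sq_nonneg (b + s * wb (some z)).re, sq_nonneg (b + s * wb (some z)).im]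
  obtain ⟨z', hz'⟩ := exists_lf_eq_zero hHd0 hHdet.le
  have x1 := hm.fin_coh_inf_of_eq hH hz'
  rw [hc] at x1
  have x2 := hm.map_coh _ _ hH (dom_origin hm.hpsd) (by
    simp only [coh, Complex.zero_re, Complex.zero_im, sub_zero]; exact hHdet)
  have x3 := hm.map_coh _ _ hH hK (coh_add_w (some z) s a b d)
  have y1 := hm.fin_coh_inf hK (some z)
  have y2 := hm.inf_coh_top (some z) (dom_inf_of_fin hK (some z))
  have y3 := hm.map_coh (.inf (some z) (lf (some z) a b d)) (.inf (some z) 0)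
    (dom_inf_of_fin hK (some z)) (dom_inf_of_nonneg hm.hpsd _ le_rfl) rfl
  rw [hc] at y3
  have xy := hm.fin_coh_inf_of_eq hH (lf_add_w_self (some z) s a b d)
  have e := CoherentU.eq_of_not hcon x3 x1 y1.symm y3 xy
  have e2 := hm.eq_of_coh_pq x2 (e ▸ y2) hcp hcq x1
  exact hcon (e2 ▸ x3.symm)

end ModelMap

theorem psd.exists_eq_mul {a d : ℝ} {b : ℂ} (h : psd a b d) : ∃ ζ : ℂ, b = d * ζ := by
  obtain ⟨_, _, hb⟩ := h
  by_cases hd : d = 0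
  · subst hd
    refine ⟨0, ?_⟩
    apply Complex.ext <;> simp <;> nlinarith [sq_nonneg b.re, sq_nonneg b.im]
  · have : (d : ℂ) ≠ 0 := by exact_mod_cast hd
    exact ⟨b / d, by field_simp⟩

theorem psd_mul_iff {a d : ℝ} {ζ : ℂ} :
    psd a (d * ζ) d ↔ 0 ≤ d ∧ 0 ≤ a - d * (ζ.re ^ 2 + ζ.im ^ 2) := by
  simp only [psd, Complex.re_ofReal_mul, Complex.im_ofReal_mul]
  constructor
  · rintro ⟨ha, hd, h⟩
    refine ⟨hd, ?_⟩
    rcases hd.eq_or_lt with h0 | h0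
    · subst h0; simpa using ha
    · have : 0 ≤ d * (a - d * (ζ.re ^ 2 + ζ.im ^ 2)) := by nlinarith
      exact nonneg_of_mul_nonneg_right this h0
  · rintro ⟨hd, h⟩
    refine ⟨?_, hd, ?_⟩
    · have : 0 ≤ d * (ζ.re ^ 2 + ζ.im ^ 2) := by positivity
      linarith
    · nlinarith

namespace ModelMap

variable {α : ℝ} {β : ℂ} {δ : ℝ} {ψ : MP → U2}

/-- Under constancy on the finite directions, there cannot be both a point `(r, 0, 0)` and a
point `inf none s` whose images are incoherent to the constant. -/
theorem not_both_bad (hm : ModelMap α β δ ψ) {c : U2} (hc : ∀ z : ℂ, ψ (.inf (some z) 0) = c)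
    {r s : ℝ} (hs : s ≠ 0) (hr : dom α β δ (.fin r 0 0)) (hs' : dom α β δ (.inf none s))
    (hrc : ¬ CoherentU (ψ (.fin r 0 0)) c) (hsc : ¬ CoherentU (ψ (.inf none s)) c) : False := by
  have hcp : CoherentU c (ψ (.fin 0 0 0)) := hc 0 ▸ hm.inf_zero_coh_origin (some 0)
  have hcq : CoherentU c (ψ .top) :=
    hc 0 ▸ hm.inf_coh_top (some 0) (dom_inf_of_nonneg hm.hpsd _ le_rfl)
  obtain ⟨ζ, hζ⟩ := hm.hpsd.exists_eq_mul
  have hsδ : 0 ≤ s + δ := by simp only [dom, lf] at hs'; linarith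
  have h1 : psd α (δ * ζ) δ := hζ ▸ hm.hpsd
  have h2 : psd (r + α) (δ * ζ) δ := by
    have : psd (r + α) (0 + β) (0 + δ) := hr
    rw [hζ] at this; simpa using this
  rw [psd_mul_iff] at h1 h2
  have hdom : ∀ t : ℝ, 0 ≤ t + α - δ * (ζ.re ^ 2 + ζ.im ^ 2) →
      dom α β δ (.fin (t + s * wa (some ζ)) (0 + s * wb (some ζ)) (0 + s * wd (some ζ))) := by
    intro t ht
    simp only [dom, wa, wb, wd]
    have : psd (t + s * (ζ.re ^ 2 + ζ.im ^ 2) + α) (((s + δ : ℝ) : ℂ) * ζ) (s + δ) := by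
      rw [psd_mul_iff]
      exact ⟨hsδ, by linarith⟩
    rw [hζ]
    convert this using 1 <;> push_cast <;> ring
  have hG := hdom r h2.2
  have hU := hdom 0 (by simpa using h1.2)
  have hd0 : (0 : ℝ) + s * wd (some ζ) ≠ 0 := by simpa [wd] using hs
  have vc := hm.coh_const_of_ne hc hG (Or.inr hd0)
  have uc := hm.coh_const_of_ne hc hU (Or.inr hd0)
  have vp' := hm.map_coh _ _ hG hr (coh_add_w (some ζ) s r 0 0)
  have vb := hm.fin_coh_inf_of_eq hG (z := none) (s := s) (by simp [lf, wd])
  have ub := hm.fin_coh_inf_of_eq hU (z := none) (s := s) (by simp [lf, wd])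
  have uv := hm.map_coh _ _ hU hG (by simp [coh])
  have up := hm.map_coh _ _ hU (dom_origin hm.hpsd) (coh_add_w (some ζ) s 0 0 0)
  have hl : lf (some ζ) r 0 0 = r := by simp [lf]
  have hdm : dom α β δ (.inf (some ζ) r) := by
    have := dom_inf_of_fin hr (some ζ); rwa [hl] at this
  have vm := hm.fin_coh_inf_of_eq hG (z := some ζ) (s := r) (by rw [lf_add_w_self, hl])
  have mp' := (hm.fin_coh_inf_of_eq hr hl).symm
  have mc := hm.map_coh _ (.inf (some ζ) 0) hdm (dom_inf_of_nonneg hm.hpsd _ le_rfl) rfl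
  rw [hc] at mc
  have e1 := CoherentU.eq_of_not hrc vp' vc mp' mc vm
  have e2 := CoherentU.eq_of_not hsc ub uc vb vc uv
  have vq : CoherentU (ψ (.fin (r + s * wa (some ζ)) (0 + s * wb (some ζ)) (0 + s * wd (some ζ))))
      (ψ .top) := e1 ▸ hm.inf_coh_top _ hdm
  have e3 := hm.eq_of_coh_pq (e2 ▸ up) vq hcp hcq vc
  exact hrc (e3 ▸ vp'.symm)

theorem concC_or_concL_of_const (hm : ModelMap α β δ ψ) {c : U2}
    (hc : ∀ z : ℂ, ψ (.inf (some z) 0) = c) : ConcC α β δ ψ ∨ ConcL α β δ ψ := by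
  have d00 : ∀ z, dom α β δ (.inf z 0) := fun z => dom_inf_of_nonneg hm.hpsd z le_rfl
  have hcp : CoherentU c (ψ (.fin 0 0 0)) := hc 0 ▸ hm.inf_zero_coh_origin (some 0)
  have hcq : CoherentU c (ψ .top) := hc 0 ▸ hm.inf_coh_top (some 0) (d00 _)
  have hinf : ∀ z s, dom α β δ (.inf (some z) s) → CoherentU (ψ (.inf (some z) s)) c := by
    intro z s h
    rw [← hc z]
    exact hm.map_coh _ _ h (d00 _) rfl
  have hfin0 : ∀ r, dom α β δ (.fin r 0 0) → CoherentU (ψ (.fin r 0 0)) (ψ (.inf none 0)) :=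
    fun r h => hm.fin_coh_inf h none
  have hnone : ∀ s, dom α β δ (.inf none s) → CoherentU (ψ (.inf none s)) (ψ (.inf none 0)) :=
    fun s h => hm.map_coh _ _ h (d00 _) rfl
  by_cases hcc : CoherentU (ψ (.inf none 0)) c
  · have e := hm.eq_of_coh_pq (hm.inf_zero_coh_origin none) (hm.inf_coh_top none (d00 _))
      hcp hcq hcc
    left
    refine ⟨.top, .inf (some 0) 0, dom_top, d00 _, ?_⟩
    rw [hc]
    rintro (⟨a, b, d⟩ | ⟨_ | z, s⟩ | _) hx _
    · by_cases h : b ≠ 0 ∨ d ≠ 0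
      · exact hm.coh_const_of_ne hc hx h
      · push Not at h
        obtain ⟨rfl, rfl⟩ := h
        exact e ▸ hfin0 a hx
    · exact e ▸ hnone s hx
    · exact hinf z s hx
    · exact hcq.symm
  by_cases hbs : ∃ s, s ≠ 0 ∧ dom α β δ (.inf none s) ∧ ¬ CoherentU (ψ (.inf none s)) c
  · obtain ⟨s, hs, hsd, hsc⟩ := hbs
    have hp : ∀ r, dom α β δ (.fin r 0 0) → ψ (.fin r 0 0) = ψ (.fin 0 0 0) := by
      intro r hr
      have h1 : CoherentU (ψ (.fin r 0 0)) c := by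
        by_contra h
        exact hm.not_both_bad hc hs hr hsd h hsc
      exact CoherentU.eq_of_not hcc (hfin0 r hr) h1 (hm.inf_zero_coh_origin none).symm hcp.symm
        (hm.map_coh _ _ hr (dom_origin hm.hpsd) (by simp [coh]))
    have key : ∀ a b, dom α β δ (.fin a b s) →
        CoherentU (ψ (.fin a b s)) (ψ (.fin 0 0 0)) ∧ ψ (.fin a b s) ≠ c := by
      intro a b hK
      set t := |a| + (b.re ^ 2 + b.im ^ 2) / |s| with ht
      have ht0 : 0 ≤ t := by positivity
      have hK2 := dom_fin_add_w hK none ht0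
      have hs1 := abs_pos.2 hs
      have hr0 : 0 ≤ a + t - (b.re ^ 2 + b.im ^ 2) / s := by
        have e1 := neg_abs_le a
        have e2 : (b.re ^ 2 + b.im ^ 2) / s ≤ (b.re ^ 2 + b.im ^ 2) / |s| := by
          rw [div_eq_mul_inv, div_eq_mul_inv]
          apply mul_le_mul_of_nonneg_left _ (by positivity)
          rw [← abs_inv]; exact le_abs_self _
        linarith
      have hdr : dom α β δ (.fin (a + t - (b.re ^ 2 + b.im ^ 2) / s) 0 0) :=
        dom_fin_of_psd hm.hpsd ⟨hr0, le_rfl, by simp⟩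
      have h1 := hm.map_coh _ _ hK2 hdr (by
        simp [coh, wa, wb, wd]
        field_simp)
      rw [hp _ hdr] at h1
      have h2 := hm.map_coh _ _ hK2 hK (coh_add_w none t a b s)
      have h3 := hm.coh_const_of_ne hc hK (Or.inr hs)
      have h4 := hm.coh_const_of_ne hc hK2 (Or.inr (by simpa [wd] using hs))
      have h5 := hm.fin_coh_inf hK none
      have h6 := hm.fin_coh_inf_of_eq hK2 (z := none) (s := s) (by simp [lf, wd])
      have e := CoherentU.eq_of_not hsc h6 h4 h5 h3 h2
      refine ⟨e ▸ h1, fun h => hsc (h ▸ h5.symm)⟩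
    have main : ∀ x, dom α β δ x → CoherentU (ψ x) c → (∃ a b, dom α β δ (.fin a b s) ∧
        coh x (.fin a b s)) → CoherentU (ψ x) (ψ (.fin 0 0 0)) := by
      rintro x hx hxc ⟨a, b, hK, hco⟩
      obtain ⟨h1, h2⟩ := key a b hK
      exact CoherentU.of_common h2.symm (hm.coh_const_of_ne hc hK (Or.inr hs)).symm hxc
        (hm.map_coh _ _ hx hK hco) hcp.symm h1.symm
    right
    refine ⟨.inf none 0, .top, ψ (.fin 0 0 0), c, d00 _, dom_top, trivial, by simp, ?_, hcp.symm,
      ?_⟩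
    · intro h
      rw [← h] at hcq
      exact hm.hpq hcq
    rintro (⟨a, b, d⟩ | ⟨_ | z, u⟩ | _) hx hxl
    · by_cases h : b ≠ 0 ∨ d ≠ 0
      · have hxc := hm.coh_const_of_ne hc hx h
        refine ⟨main _ hx hxc ?_, hxc⟩
        rcases le_or_gt d s with hds | hds
        · have h1 := dom_fin_add_w hx (some 0) (sub_nonneg.2 hds)
          have h2 := coh_add_w (some 0) (s - d) a b d
          have e : d + (s - d) * wd (some 0) = s := by simp [wd]
          rw [e] at h1 h2
          exact ⟨_, _, h1, coh_symm h2⟩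
        · have hsd' : 0 ≤ s + δ := by simp only [dom, lf] at hsd; linarith
          obtain ⟨ζ, hζ⟩ := psd.exists_eq_mul hx
          have hx' : psd (a + α) (((d + δ : ℝ) : ℂ) * ζ) (d + δ) := hζ ▸ hx
          rw [psd_mul_iff] at hx'
          have h1 : dom α β δ (.fin (a + (s - d : ℝ) * wa (some ζ)) (b + (s - d : ℝ) * wb (some ζ))
              s) := by
            have : psd (a + (s - d) * wa (some ζ) + α) (((s + δ : ℝ) : ℂ) * ζ) (s + δ) := by
              rw [psd_mul_iff]
              refine ⟨hsd', ?_⟩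
              simp only [wa]
              linarith [hx'.2]
            simp only [dom]
            convert this using 1
            simp only [wb]
            push_cast at hζ ⊢
            linear_combination hζ
          have h2 := coh_add_w (some ζ) (s - d) a b d
          have e : d + (s - d) * wd (some ζ) = s := by simp [wd]
          rw [e] at h2
          exact ⟨_, _, h1, coh_symm h2⟩
      · push Not at h
        obtain ⟨rfl, rfl⟩ := h
        rw [hp a hx]
        exact ⟨CoherentU.refl _, hcp.symm⟩
    · exact absurd ⟨rfl, trivial⟩ hxl
    · have hxc := hinf z u hx
      refine ⟨main _ hx hxc ?_, hxc⟩
      have hsd' : 0 ≤ s + δ := by simp only [dom, lf] at hsd; linarith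
      have hν : 0 ≤ u + lf (some z) α β δ := by simp only [dom] at hx; linarith
      refine ⟨-α + (s + δ) * (z.re ^ 2 + z.im ^ 2) + (u + lf (some z) α β δ),
        -β + ((s + δ : ℝ) : ℂ) * z, ?_, ?_⟩
      · have : psd ((s + δ) * (z.re ^ 2 + z.im ^ 2) + (u + lf (some z) α β δ))
            (((s + δ : ℝ) : ℂ) * z) (s + δ) := by
          rw [psd_mul_iff]
          exact ⟨hsd', by linarith⟩
        simp only [dom]
        convert this using 1 <;> ring
      · simp only [coh, lf, Complex.add_re, Complex.add_im, Complex.neg_re, Complex.neg_im,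
          Complex.re_ofReal_mul, Complex.im_ofReal_mul]
        ring
    · exact absurd ⟨trivial, trivial⟩ hxl
  push Not at hbs
  by_cases hbr : ∃ r, dom α β δ (.fin r 0 0) ∧ ¬ CoherentU (ψ (.fin r 0 0)) c
  · obtain ⟨r, hr, hrc⟩ := hbr
    have hq : ∀ s, s ≠ 0 → dom α β δ (.inf none s) → ψ (.inf none s) = ψ .top := by
      intro s hs hsd
      exact CoherentU.eq_of_not hcc (hnone s hsd) (hbs s hs hsd)
        (hm.inf_coh_top none (d00 _)).symm hcq.symm (hm.inf_coh_top none hsd)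
    right
    refine ⟨.fin 0 0 0, .inf none 0, ψ .top, c, dom_origin hm.hpsd, d00 _, lf_zero _, by simp, ?_,
      hcq.symm, ?_⟩
    · intro h
      rw [← h] at hcp
      exact hm.hpq hcp.symm
    rintro (⟨a, b, d⟩ | ⟨_ | z, u⟩ | _) hx hxl
    · by_cases hd : d = 0
      · subst hd
        by_cases hb : b = 0
        · subst hb
          exact absurd ⟨by simp [coh], by simp [coh, lf]⟩ hxl
        · have hxc := hm.coh_const_of_ne hc hx (Or.inl hb)
          refine ⟨?_, hxc⟩
          have hN : b.re ^ 2 + b.im ^ 2 ≠ 0 := by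
            have := Complex.normSq_pos.2 hb
            rw [Complex.normSq_apply] at this
            nlinarith
          set t := (1 - (r - a) / (b.re ^ 2 + b.im ^ 2)) / 2 with ht
          have hK := dom_fin_add_w hr (some (t * b)) zero_le_one
          have k1 := hm.coh_const_of_ne hc hK (Or.inr (by simp [wd]))
          have k2 := hm.map_coh _ _ hK hr (coh_add_w _ _ _ _ _)
          have k3 := hm.fin_coh_inf_of_eq hK (z := none) (s := 1) (by simp [lf, wd])
          rw [hq 1 one_ne_zero (dom_inf_of_nonneg hm.hpsd _ zero_le_one)] at k3
          have k4 := hm.map_coh _ _ hx hK (by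
            simp [coh, wa, wb, wd]
            rw [ht]
            field_simp
            ring)
          refine CoherentU.of_common (fun h => hrc ?_) k1.symm hxc k4 hcq.symm k3.symm
          rw [← h] at k2
          exact k2.symm
      · have := hm.fin_coh_inf hx none
        rw [show lf none a b d = d from rfl, hq d hd (dom_inf_of_fin hx none)] at this
        exact ⟨this, hm.coh_const_of_ne hc hx (Or.inr hd)⟩
    · by_cases hu : u = 0
      · subst hu
        exact absurd ⟨lf_zero _, rfl⟩ hxl
      · rw [hq u hu hx]
        exact ⟨CoherentU.refl _, hcq.symm⟩
    · exact ⟨hm.inf_coh_top _ hx, hinf z u hx⟩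
    · exact ⟨CoherentU.refl _, hcq.symm⟩
  push Not at hbr
  left
  refine ⟨.inf none 0, .inf (some 0) 0, d00 _, d00 _, ?_⟩
  rw [hc]
  rintro (⟨a, b, d⟩ | ⟨_ | z, s⟩ | _) hx hne
  · by_cases h : b ≠ 0 ∨ d ≠ 0
    · exact hm.coh_const_of_ne hc hx h
    · push Not at h
      obtain ⟨rfl, rfl⟩ := h
      exact hbr a hx
  · exact hbs s (fun h => hne (by rw [h])) hx
  · exact hinf z s hx
  · exact hcq.symm

end ModelMap

/-- The value of the form `lf z` on the direction `w`. -/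
def kap (z w : Option ℂ) : ℝ := lf z (wa w) (wb w) (wd w)

theorem kap_some_some (z w : ℂ) :
    kap (some z) (some w) = (z.re - w.re) ^ 2 + (z.im - w.im) ^ 2 := by
  simp only [kap, lf, wa, wb, wd]; ring

theorem kap_none_some (w : ℂ) : kap none (some w) = 1 := rfl

theorem kap_some_none (z : ℂ) : kap (some z) none = 1 := by simp [kap, lf, wa, wb, wd]

theorem kap_comm (z w : Option ℂ) : kap z w = kap w z := by
  rcases z with _ | z <;> rcases w with _ | w
  · rfl
  · rw [kap_some_none, kap_none_some]
  · rw [kap_some_none, kap_none_some]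
  · rw [kap_some_some, kap_some_some]; ring

theorem kap_pos {z w : Option ℂ} (h : z ≠ w) : 0 < kap z w := by
  rcases z with _ | z <;> rcases w with _ | w
  · exact absurd rfl h
  · rw [kap_none_some]; exact one_pos
  · rw [kap_some_none]; exact one_pos
  · have : z - w ≠ 0 := sub_ne_zero.2 fun e => h (by rw [e])
    have := Complex.normSq_pos.2 this
    rw [Complex.normSq_apply] at this
    rw [kap_some_some]
    simpa [pow_two] using this

/-- A multiplicatively closed set of positive reals containing a nondegenerate interval is
everything. -/
theorem mem_of_interval_subset {G : Set ℝ} (hmul : ∀ s ∈ G, ∀ t ∈ G, s * t ∈ G)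
    (hinv : ∀ t ∈ G, t⁻¹ ∈ G) {k l : ℝ} (hk : 0 < k) (hkl : k < l)
    (h : ∀ t, k ≤ t → t ≤ l → t ∈ G) {t : ℝ} (ht : 0 < t) : t ∈ G := by
  have hkG : k ∈ G := h k le_rfl hkl.le
  have h1 : ∀ t, 1 ≤ t → t ≤ l / k → t ∈ G := by
    intro t h1 h2
    have := hmul _ (h (t * k) (by nlinarith) ((le_div_iff₀ hk).1 h2)) _ (hinv _ hkG)
    rwa [mul_assoc, mul_inv_cancel₀ hk.ne', mul_one] at this
  have h1G : (1 : ℝ) ∈ G := h1 1 le_rfl ((one_le_div hk).2 hkl.le)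
  have hpow : ∀ n : ℕ, ∀ s ∈ G, s ^ n ∈ G := by
    intro n s hs
    induction n with
    | zero => simpa using h1G
    | succ n ih => rw [pow_succ]; exact hmul _ ih _ hs
  have hbig : ∀ t, 1 ≤ t → t ∈ G := by
    intro t ht
    have hε : 0 < Real.log (l / k) := Real.log_pos ((one_lt_div hk).2 hkl)
    obtain ⟨n, hn⟩ := exists_nat_gt (Real.log t / Real.log (l / k))
    have hlog : 0 ≤ Real.log t := Real.log_nonneg ht
    have hn0 : (0 : ℝ) < n := lt_of_le_of_lt (div_nonneg hlog hε.le) hn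
    have hs : Real.exp (Real.log t / n) ∈ G := by
      apply h1
      · exact Real.one_le_exp (div_nonneg hlog hn0.le)
      · rw [← Real.le_log_iff_exp_le (div_pos (hk.trans hkl) hk)]
        rw [div_lt_iff₀ hε] at hn
        rw [div_le_iff₀ hn0]
        linarith
    have := hpow n _ hs
    rwa [← Real.exp_nat_mul, mul_div_cancel₀ _ hn0.ne', Real.exp_log (by linarith)] at this
  rcases le_total 1 t with h2 | h2
  · exact hbig t h2
  · have := hinv _ (hbig t⁻¹ ((one_le_inv₀ ht).2 h2))
    rwa [inv_inv] at this

/-- If the ratio of the squared distances to `a` and `b` is constant on a circle around `w`,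
then `a - w` is a real multiple of `b - w` and the radius is determined. -/
theorem apollonius {a b w : ℂ} {R k : ℝ} (hR : 0 < R) (hab : a ≠ b)
    (h : ∀ θ : ℝ, ((w.re + R * Real.cos θ) - a.re) ^ 2 + ((w.im + R * Real.sin θ) - a.im) ^ 2
      = k * (((w.re + R * Real.cos θ) - b.re) ^ 2 + ((w.im + R * Real.sin θ) - b.im) ^ 2)) :
    a.re - w.re = k * (b.re - w.re) ∧ a.im - w.im = k * (b.im - w.im) ∧
      R ^ 2 = k * ((b.re - w.re) ^ 2 + (b.im - w.im) ^ 2) := by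
  have h0 := h 0
  have h1 := h Real.pi
  have h2 := h (Real.pi / 2)
  have h3 := h (-(Real.pi / 2))
  simp only [Real.cos_zero, Real.sin_zero, Real.cos_pi, Real.sin_pi, Real.cos_pi_div_two,
    Real.sin_pi_div_two, Real.cos_neg, Real.sin_neg] at h0 h1 h2 h3
  have e1 : a.re - w.re = k * (b.re - w.re) := by
    have : R * (a.re - w.re) = R * (k * (b.re - w.re)) := by linear_combination (h1 - h0) / 4
    exact mul_left_cancel₀ hR.ne' this
  have e2 : a.im - w.im = k * (b.im - w.im) := by
    have : R * (a.im - w.im) = R * (k * (b.im - w.im)) := by linear_combination (h3 - h2) / 4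
    exact mul_left_cancel₀ hR.ne' this
  refine ⟨e1, e2, ?_⟩
  have hk : 1 - k ≠ 0 := by
    intro hk
    have hk1 : k = 1 := by linarith
    rw [hk1] at e1 e2
    exact hab (Complex.ext (by linarith) (by linarith))
  apply mul_left_cancel₀ hk
  have ea : a.re = w.re + k * (b.re - w.re) := by linarith
  have eb : a.im = w.im + k * (b.im - w.im) := by linarith
  rw [ea, eb] at h0
  rw [ea, eb] at h1
  linear_combination (h0 + h1) / 2

theorem propagation {P : Option ℂ → ℝ → Prop} {F : Set (Option ℂ)}
    (hR : ∀ w r u z, 0 < r → P w r → (u ∈ F ↔ z ∉ F) → z ≠ w → P u (r * kap z w / kap z u))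
    (hnone : none ∉ F) {w₀ a b : ℂ} (hw₀ : some w₀ ∉ F) (ha : some a ∈ F) (hb : some b ∈ F)
    (hab : a ≠ b) {w₁ : Option ℂ} {r₁ : ℝ} (hr₁ : 0 < r₁) (h₁ : P w₁ r₁) :
    ∀ u r, 0 < r → P u r := by
  have hmem : ∀ {u}, u ∈ F → ∀ {z}, z ∉ F → z ≠ u := fun hu _ hz e => hz (e ▸ hu)
  have hstep : ∀ u₁ ∈ F, ∀ u₂ ∈ F, ∀ z ∉ F, ∀ r > 0, P u₁ r →
      P u₂ (r * kap z u₁ / kap z u₂) := fun u₁ h1 u₂ h2 z hz r hr hP =>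
    hR u₁ r u₂ z hr hP (iff_of_true h2 hz) (hmem h1 hz)
  have hfree : ∀ u₁ ∈ F, ∀ u₂ ∈ F, ∀ r > 0, P u₁ r → P u₂ r := by
    intro u₁ h1 u₂ h2 r hr hP
    have := hstep u₁ h1 u₂ h2 none hnone r hr hP
    rcases u₁ with _ | u₁
    · exact absurd h1 hnone
    rcases u₂ with _ | u₂
    · exact absurd h2 hnone
    simpa [kap_none_some] using this
  set G : Set ℝ := {t | 0 < t ∧ ∀ r > 0, (P (some a) r ↔ P (some a) (t * r))} with hG
  have hGmul : ∀ s ∈ G, ∀ t ∈ G, s * t ∈ G := by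
    rintro s ⟨hs, hs'⟩ t ⟨ht, ht'⟩
    refine ⟨by positivity, fun r hr => ?_⟩
    rw [ht' r hr, hs' (t * r) (by positivity), mul_assoc]
  have hGinv : ∀ t ∈ G, t⁻¹ ∈ G := by
    rintro t ⟨ht, ht'⟩
    refine ⟨by positivity, fun r hr => ?_⟩
    rw [ht' (t⁻¹ * r) (by positivity), ← mul_assoc, mul_inv_cancel₀ ht.ne', one_mul]
  have hGmem : ∀ u₁ ∈ F, ∀ u₂ ∈ F, ∀ z ∉ F, kap z u₁ / kap z u₂ ∈ G := by
    intro u₁ h1 u₂ h2 z hz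
    have k1 := kap_pos (hmem h1 hz)
    have k2 := kap_pos (hmem h2 hz)
    refine ⟨by positivity, fun r hr => ⟨fun h => ?_, fun h => ?_⟩⟩
    · have := hfree _ h2 _ ha _ (by positivity)
        (hstep u₁ h1 u₂ h2 z hz r hr (hfree _ ha _ h1 r hr h))
      convert this using 1; ring
    · have := hfree _ h1 _ ha _ (by positivity)
        (hstep u₂ h2 u₁ h1 z hz _ (by positivity) (hfree _ ha _ h2 _ (by positivity) h))
      convert this using 1; field_simp
  have hGall : ∀ t, 0 < t → t ∈ G := by
    by_contra hcon
    push Not at hcon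
    obtain ⟨τ, hτ, hτG⟩ := hcon
    have hA := kap_pos (hmem ha hw₀)
    have circle : ∀ τ : ℝ, 0 < τ → τ ∉ G → ∃ k : ℝ, a.re - w₀.re = k * (b.re - w₀.re) ∧
        a.im - w₀.im = k * (b.im - w₀.im) ∧
        τ * kap (some w₀) (some a) = k * ((b.re - w₀.re) ^ 2 + (b.im - w₀.im) ^ 2) := by
      intro τ hτ hτG
      set R := √(τ * kap (some w₀) (some a)) with hRdef
      have hR2 : R ^ 2 = τ * kap (some w₀) (some a) := Real.sq_sqrt (by positivity)
      have hR0 : 0 < R := Real.sqrt_pos.2 (by positivity)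
      have hout : ∀ θ : ℝ, some (⟨w₀.re + R * Real.cos θ, w₀.im + R * Real.sin θ⟩ : ℂ) ∉ F := by
        intro θ hθ
        apply hτG
        have := hGmem _ hθ _ ha _ hw₀
        rwa [kap_some_some w₀ ⟨_, _⟩, show (w₀.re - (w₀.re + R * Real.cos θ)) ^ 2
          + (w₀.im - (w₀.im + R * Real.sin θ)) ^ 2 = R ^ 2 by
            linear_combination R ^ 2 * Real.sin_sq_add_cos_sq θ, hR2,
          mul_div_assoc, div_self hA.ne', mul_one] at this
      set g : ℝ → ℝ := fun θ =>
        kap (some ⟨w₀.re + R * Real.cos θ, w₀.im + R * Real.sin θ⟩) (some a) /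
        kap (some ⟨w₀.re + R * Real.cos θ, w₀.im + R * Real.sin θ⟩) (some b) with hg
      have hgG : ∀ θ, g θ ∈ G := fun θ => hGmem _ ha _ hb _ (hout θ)
      have hgc : Continuous g := by
        simp only [hg, kap_some_some]
        apply Continuous.div (by fun_prop) (by fun_prop)
        intro θ
        have := kap_pos (hmem hb (hout θ))
        rw [kap_some_some] at this
        exact this.ne'
      have hconst : ∀ θ, g θ = g 0 := by
        by_contra hne
        push Not at hne
        obtain ⟨θ, hθ⟩ := hne
        have : ∃ θ₁ θ₂, g θ₁ < g θ₂ := by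
          rcases lt_or_gt_of_ne hθ with h | h
          · exact ⟨_, _, h⟩
          · exact ⟨_, _, h⟩
        obtain ⟨θ₁, θ₂, hlt⟩ := this
        apply hτG
        refine mem_of_interval_subset hGmul hGinv (hgG θ₁).1 hlt (fun t h1 h2 => ?_) hτ
        obtain ⟨θ', rfl⟩ := mem_range_of_exists_le_of_exists_ge hgc ⟨θ₁, h1⟩ ⟨θ₂, h2⟩
        exact hgG θ'
      refine ⟨g 0, ?_⟩
      rw [← hR2]
      apply apollonius hR0 hab
      intro θ
      have hb' := kap_pos (hmem hb (hout θ))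
      have h := (div_eq_iff hb'.ne').1 (hconst θ)
      rwa [kap_some_some _ a, kap_some_some _ b] at h
    obtain ⟨k, e1, e2, e3⟩ := circle τ hτ hτG
    obtain ⟨k', e1', e2', e3'⟩ := circle τ⁻¹ (inv_pos.2 hτ) (fun h => hτG (by
      have := hGinv _ h; rwa [inv_inv] at this))
    have hB := kap_pos (hmem hb hw₀)
    rw [kap_some_some] at hB
    have hkk : k = k' := by
      have hB' : (b.re - w₀.re) ^ 2 + (b.im - w₀.im) ^ 2 ≠ 0 := by
        intro h; nlinarith
      apply mul_right_cancel₀ hB'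
      have e4 : (k - k') * (b.re - w₀.re) = 0 := by linear_combination e1' - e1
      have e5 : (k - k') * (b.im - w₀.im) = 0 := by linear_combination e2' - e2
      linear_combination (b.re - w₀.re) * e4 + (b.im - w₀.im) * e5
    rw [hkk, ← e3'] at e3
    have hττ : τ = τ⁻¹ := mul_right_cancel₀ hA.ne' e3
    have hτ1 : τ = 1 := by
      have : τ * τ = 1 := by nth_rewrite 2 [hττ]; exact mul_inv_cancel₀ hτ.ne'
      nlinarith
    exact hτG (hτ1 ▸ ⟨one_pos, fun r _ => by rw [one_mul]⟩)
  obtain ⟨r₂, hr₂, h₂⟩ : ∃ r > 0, P (some a) r := by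
    by_cases hw : w₁ ∈ F
    · exact ⟨r₁, hr₁, hfree _ hw _ ha _ hr₁ h₁⟩
    · obtain ⟨z, hz, hzw⟩ : ∃ z, z ∉ F ∧ z ≠ w₁ := by
        rcases w₁ with _ | w₁
        · exact ⟨some w₀, hw₀, by simp⟩
        · exact ⟨none, hnone, by simp⟩
      have k1 := kap_pos hzw
      have k2 := kap_pos (hmem ha hz)
      exact ⟨_, by positivity, hR w₁ r₁ (some a) z hr₁ h₁ (iff_of_true ha hz) hzw⟩
  have hQ : ∀ r > 0, P (some a) r := by
    intro r hr
    have := ((hGall (r / r₂) (by positivity)).2 r₂ hr₂).1 h₂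
    rwa [div_mul_cancel₀ _ hr₂.ne'] at this
  intro u r hr
  by_cases hu : u ∈ F
  · exact hfree _ ha _ hu _ hr (hQ r hr)
  · have hab' : some a ≠ some b := fun h => hab (Option.some_inj.1 h)
    have k1 := kap_pos hab'
    have k2 := kap_pos (hmem ha hu).symm
    have := hR (some b) (r * kap (some a) u / kap (some a) (some b)) u (some a) (by positivity)
      (hfree _ ha _ hb _ (by positivity) (hQ _ (by positivity)))
      (iff_of_false hu (by simpa using ha)) hab'
    convert this using 1
    field_simp

/-- If one point on one of the segments issued from the vertex `p` is collapsed to `p`, then all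
of them are. -/
theorem collapse {x y : Option ℂ → ℝ → U2} {f : Option ℂ → U2} {p q : U2}
    (hpq : ¬ CoherentU p q) (hfp : ∀ z, CoherentU (f z) p) (hfq : ∀ z, CoherentU (f z) q)
    (hxp : ∀ z r, 0 < r → CoherentU (x z r) p) (hxf : ∀ z r, 0 < r → CoherentU (x z r) (f z))
    (hyq : ∀ z r, 0 < r → CoherentU (y z r) q) (hyf : ∀ z r, 0 < r → CoherentU (y z r) (f z))
    (hxy : ∀ w z r, 0 < r → z ≠ w → CoherentU (x w r) (y z (r * kap z w)))
    {S : Set U2} (hnone : f none ∉ S) {w₀ a b : ℂ} (hw₀ : f (some w₀) ∉ S)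
    (ha : f (some a) ∈ S) (hb : f (some b) ∈ S) (hab : a ≠ b)
    {w₁ : Option ℂ} {r₁ : ℝ} (hr₁ : 0 < r₁) (h₁ : x w₁ r₁ = p) :
    ∀ u r, 0 < r → x u r = p := by
  apply propagation (P := fun u r => x u r = p) (F := {z | f z ∈ S}) _ hnone hw₀ ha hb hab hr₁ h₁
  intro w r u z hr hP huz hzw
  have hf : f u ≠ f z := by
    intro e
    simp only [Set.mem_ofPred_eq, e] at huz
    tauto
  have hzu : z ≠ u := fun e => hf (by rw [e])
  have k1 := kap_pos hzw
  have k2 := kap_pos hzu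
  have h1 := hxy w z r hr hzw
  rw [hP] at h1
  have e1 : y z (r * kap z w) = f z :=
    CoherentU.eq_of_not hpq h1.symm (hyq _ _ (by positivity)) (hfp z) (hfq z)
      (hyf _ _ (by positivity))
  have h2 := hxy u z (r * kap z w / kap z u) (by positivity) hzu
  rw [div_mul_cancel₀ _ k2.ne', e1] at h2
  have hfc : ¬ CoherentU (f u) (f z) := fun h =>
    hf (CoherentU.eq_of_not hpq (hfp u) (hfq u) (hfp z) (hfq z) h)
  exact CoherentU.eq_of_not hfc (hxf _ _ (by positivity)) h2 (hfp u).symm (hfp z).symm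
    (hxp _ _ (by positivity))

/-- The hermitian matrix of rank at most one in the direction `w`. -/
def xp (w : Option ℂ) (r : ℝ) : MP := .fin (r * wa w) (r * wb w) (r * wd w)

theorem dom_xp {α δ : ℝ} {β : ℂ} (h0 : psd α β δ) (w : Option ℂ) {r : ℝ} (hr : 0 ≤ r) :
    dom α β δ (xp w r) := dom_fin_of_psd h0 (psd_w w hr)

theorem lf_xp (z w : Option ℂ) (r : ℝ) : lf z (r * wa w) (r * wb w) (r * wd w) = r * kap z w := by
  rw [lf_mul, kap]

theorem coh_fin_xp (a : ℝ) (b : ℂ) (d : ℝ) (w : Option ℂ) (r : ℝ) :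
    coh (.fin a b d) (xp w r) ↔ a * d - (b.re ^ 2 + b.im ^ 2) = r * lf w a b d := by
  have h := wb_sq w
  simp only [xp, coh, Complex.re_ofReal_mul, Complex.im_ofReal_mul]
  have h2 : lf w a b d
      = a * wd w - 2 * ((wb w).re * b.re + (wb w).im * b.im) + wa w * d := by
    rcases w with _ | w <;> simp [lf, wa, wb, wd]
  rw [h2]
  constructor <;> intro h1
  · linear_combination h1 + r ^ 2 * h
  · linear_combination h1 - r ^ 2 * h

theorem coh_xp_inf (w z : Option ℂ) (r : ℝ) : coh (xp w r) (.inf z (r * kap z w)) := lf_xp z w r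

theorem coh_xp_origin (w : Option ℂ) (r : ℝ) : coh (xp w r) (.fin 0 0 0) := by
  have := coh_add_w w r 0 0 0
  simp only [zero_add] at this
  exact this

theorem coh_xp_inf_zero (w : Option ℂ) (r : ℝ) : coh (xp w r) (.inf w 0) := by
  have := coh_xp_inf w w r
  rwa [kap, lf_w_self, mul_zero] at this

theorem det_add_w (z : Option ℂ) (s a : ℝ) (b : ℂ) (d : ℝ) :
    (a + s * wa z) * (d + s * wd z) - ((b + s * wb z).re ^ 2 + (b + s * wb z).im ^ 2)
      = a * d - (b.re ^ 2 + b.im ^ 2) + s * lf z a b d := by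
  rcases z with _ | z
  · simp [wa, wb, wd, lf]; ring
  · simp [wa, wb, wd, lf]; ring

theorem exists_lf_eq {a : ℝ} {b : ℂ} (hb : b ≠ 0) (t : ℝ) : ∃ z : ℂ, lf (some z) a b 0 = t := by
  obtain ⟨z, hz⟩ := exists_lf_eq_zero' (a := a - t) hb
  refine ⟨z, ?_⟩
  simp only [lf] at hz ⊢
  linarith

theorem ne_zero_of_det_neg {a : ℝ} {b : ℂ} (h : a * 0 < b.re ^ 2 + b.im ^ 2) : b ≠ 0 := by
  rintro rfl; simp at h

theorem lf_div {a d : ℝ} {b : ℂ} (hd : d ≠ 0) :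
    lf (some (b / d)) a b d = (a * d - (b.re ^ 2 + b.im ^ 2)) / d := by
  simp only [lf, Complex.div_ofReal_re, Complex.div_ofReal_im]
  field_simp
  ring

theorem exists_lf_neg {a d : ℝ} {b : ℂ} (h : a * d < b.re ^ 2 + b.im ^ 2) :
    ∃ z, lf z a b d < 0 := by
  rcases lt_trichotomy d 0 with hd | hd | hd
  · exact ⟨none, hd⟩
  · subst hd
    obtain ⟨z, hz⟩ := exists_lf_eq (a := a) (ne_zero_of_det_neg h) (-1)
    exact ⟨_, hz.trans_lt (by norm_num)⟩
  · exact ⟨some (b / d), by rw [lf_div hd.ne']; exact div_neg_of_neg_of_pos (by linarith) hd⟩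

theorem exists_lf_pos {a d : ℝ} {b : ℂ} (h : a * d < b.re ^ 2 + b.im ^ 2) :
    ∃ z, 0 < lf z a b d := by
  rcases lt_trichotomy d 0 with hd | hd | hd
  · exact ⟨some (b / d), by rw [lf_div hd.ne]; exact div_pos_of_neg_of_neg (by linarith) hd⟩
  · subst hd
    obtain ⟨z, hz⟩ := exists_lf_eq (a := a) (ne_zero_of_det_neg h) 1
    exact ⟨_, hz.symm ▸ one_pos⟩
  · exact ⟨none, hd⟩

theorem exists_dom_fin {α δ σ : ℝ} {β : ℂ} {z : Option ℂ} (h : dom α β δ (.inf z σ)) :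
    ∃ a b d, dom α β δ (.fin a b d) ∧ lf z a b d = σ := by
  obtain ⟨u, hu⟩ : ∃ u, kap z u = 1 := by
    rcases z with _ | z
    · exact ⟨some 0, kap_none_some 0⟩
    · exact ⟨none, kap_some_none z⟩
  set ν := σ + lf z α β δ with hν
  have hν0 : 0 ≤ ν := by simp only [dom] at h; linarith
  refine ⟨-α + ν * wa u, -β + ν * wb u, -δ + ν * wd u, ?_, ?_⟩
  · have := psd_w u hν0
    simp only [dom]
    convert this using 1 <;> ring
  · have e : lf z (-α) (-β) (-δ) = -lf z α β δ := by
      have := lf_mul z (-1) α β δ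
      simpa using this
    rw [lf_add, lf_xp, hu, e, hν]; ring

namespace ModelMap

variable {α : ℝ} {β : ℂ} {δ : ℝ} {ψ : MP → U2}

theorem inf_zero_coh_top (hm : ModelMap α β δ ψ) (z : Option ℂ) :
    CoherentU (ψ (.inf z 0)) (ψ .top) :=
  hm.inf_coh_top z (dom_inf_of_nonneg hm.hpsd z le_rfl)

theorem not_coh_inf_zero (hm : ModelMap α β δ ψ) {z w : Option ℂ}
    (h : ψ (.inf z 0) ≠ ψ (.inf w 0)) : ¬ CoherentU (ψ (.inf z 0)) (ψ (.inf w 0)) := fun hc =>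
  h (hm.eq_of_coh_pq (hm.inf_zero_coh_origin z) (hm.inf_zero_coh_top z)
    (hm.inf_zero_coh_origin w) (hm.inf_zero_coh_top w) hc)

theorem fin_coh_xp (hm : ModelMap α β δ ψ) {a d : ℝ} {b : ℂ} (h : dom α β δ (.fin a b d))
    {z : Option ℂ} {r : ℝ} (hr : 0 ≤ r) (hd : a * d - (b.re ^ 2 + b.im ^ 2) = r * lf z a b d) :
    CoherentU (ψ (.fin a b d)) (ψ (xp z r)) :=
  hm.map_coh _ _ h (dom_xp hm.hpsd z hr) ((coh_fin_xp a b d z r).2 hd)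

theorem xp_coh_origin (hm : ModelMap α β δ ψ) (w : Option ℂ) {r : ℝ} (hr : 0 ≤ r) :
    CoherentU (ψ (xp w r)) (ψ (.fin 0 0 0)) :=
  hm.map_coh _ _ (dom_xp hm.hpsd w hr) (dom_origin hm.hpsd) (coh_xp_origin w r)

theorem xp_coh_inf_zero (hm : ModelMap α β δ ψ) (w : Option ℂ) {r : ℝ} (hr : 0 ≤ r) :
    CoherentU (ψ (xp w r)) (ψ (.inf w 0)) :=
  hm.map_coh _ _ (dom_xp hm.hpsd w hr) (dom_inf_of_nonneg hm.hpsd w le_rfl) (coh_xp_inf_zero w r)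

theorem inf_coh_inf_zero (hm : ModelMap α β δ ψ) (z : Option ℂ) {s : ℝ}
    (hs : dom α β δ (.inf z s)) : CoherentU (ψ (.inf z s)) (ψ (.inf z 0)) :=
  hm.map_coh _ _ hs (dom_inf_of_nonneg hm.hpsd z le_rfl) rfl

theorem xp_coh_inf (hm : ModelMap α β δ ψ) (w z : Option ℂ) {r s : ℝ} (hr : 0 ≤ r) (hs : 0 ≤ s)
    (h : r * kap z w = s) : CoherentU (ψ (xp w r)) (ψ (.inf z s)) :=
  hm.map_coh _ _ (dom_xp hm.hpsd w hr) (dom_inf_of_nonneg hm.hpsd z hs) (h ▸ coh_xp_inf w z r)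

/-- The case where all points of rank one are collapsed to the image of the origin. -/
theorem concC_of_xp_eq (hm : ModelMap α β δ ψ)
    (hX : ∀ w r, 0 < r → ψ (xp w r) = ψ (.fin 0 0 0)) {w₀ a b : ℂ} (hab : a ≠ b)
    (h1 : ψ (.inf (some a) 0) ≠ ψ (.inf none 0))
    (h2 : ψ (.inf (some a) 0) ≠ ψ (.inf (some w₀) 0))
    (h3 : ψ (.inf (some b) 0) ≠ ψ (.inf none 0)) : ConcC α β δ ψ := by
  have hN : ∀ z s, 0 < s → ψ (.inf z s) = ψ (.inf z 0) := by
    intro z s hs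
    obtain ⟨u, hu⟩ : ∃ u, kap z u = 1 := by
      rcases z with _ | z
      · exact ⟨some 0, kap_none_some 0⟩
      · exact ⟨none, kap_some_none z⟩
    have hd := dom_inf_of_nonneg hm.hpsd z hs.le
    have := hm.xp_coh_inf u z hs.le hs.le (by rw [hu, mul_one])
    rw [hX u s hs] at this
    exact hm.eq_of_coh_pq this.symm (hm.inf_coh_top z hd) (hm.inf_zero_coh_origin z)
      (hm.inf_zero_coh_top z) (hm.inf_coh_inf_zero z hd)
  have hpick : ∀ z : Option ℂ, ∃ u v, u ≠ z ∧ v ≠ z ∧ ψ (.inf u 0) ≠ ψ (.inf v 0) := by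
    intro z
    by_cases hz : z = none
    · subst hz
      exact ⟨some a, some w₀, by simp, by simp, h2⟩
    · by_cases hza : some a = z
      · subst hza
        exact ⟨some b, none, fun e => hab (Option.some_inj.1 e).symm, by simp, h3⟩
      · exact ⟨some a, none, hza, fun e => hz e.symm, h1⟩
  have key : ∀ (a' : ℝ) (b' : ℂ) (d' : ℝ) (z : Option ℂ), dom α β δ (.fin a' b' d') →
      lf z a' b' d' < 0 → ∃ s ≥ 0,
        ψ (.fin (a' + s * wa z) (b' + s * wb z) (d' + s * wd z)) = ψ (.fin 0 0 0) := by
    intro a' b' d' z hK hneg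
    obtain ⟨u, v, hu, hv, huv⟩ := hpick z
    have ku := kap_pos hu
    have kv := kap_pos hv
    obtain ⟨s, hs⟩ : ∃ s : ℝ, 0 ≤ s ∧ 0 < lf u a' b' d' + s * kap u z ∧
        0 < lf v a' b' d' + s * kap v z ∧
        a' * d' - (b'.re ^ 2 + b'.im ^ 2) + s * lf z a' b' d' < 0 := by
      have t1 := Filter.tendsto_atTop_add_const_left Filter.atTop (lf u a' b' d')
        (Filter.tendsto_id.atTop_mul_const ku)
      have t2 := Filter.tendsto_atTop_add_const_left Filter.atTop (lf v a' b' d')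
        (Filter.tendsto_id.atTop_mul_const kv)
      have t3 := Filter.tendsto_atBot_add_const_left Filter.atTop
        (a' * d' - (b'.re ^ 2 + b'.im ^ 2)) (Filter.tendsto_id.atTop_mul_const_of_neg hneg)
      exact ((Filter.eventually_ge_atTop (0 : ℝ)).and ((t1.eventually_gt_atTop 0).and
        ((t2.eventually_gt_atTop 0).and (t3.eventually_lt_atBot 0)))).exists
    obtain ⟨hs0, hs1, hs2, hs3⟩ := hs
    have hKs := dom_fin_add_w hK z hs0
    refine ⟨s, hs0, ?_⟩
    have c1 := hm.fin_coh_inf_of_eq hKs (z := u) (by rw [lf_add, lf_xp])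
    have c2 := hm.fin_coh_inf_of_eq hKs (z := v) (by rw [lf_add, lf_xp])
    rw [hN _ _ hs1] at c1
    rw [hN _ _ hs2] at c2
    have hr := div_pos_of_neg_of_neg hs3 hneg
    have c3 := hm.fin_coh_xp hKs (z := z) hr.le (by
      rw [det_add_w, lf_add_w_self, div_mul_cancel₀ _ hneg.ne])
    rw [hX _ _ hr] at c3
    exact CoherentU.eq_of_not (hm.not_coh_inf_zero huv) c1 c2 (hm.inf_zero_coh_origin u).symm
      (hm.inf_zero_coh_origin v).symm c3
  refine ⟨.top, .fin 0 0 0, dom_top, dom_origin hm.hpsd, ?_⟩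
  rintro (⟨a', b', d'⟩ | ⟨z, σ⟩ | _) hx hne
  · have hneg : ∀ z, lf z a' b' d' < 0 → CoherentU (ψ (.fin a' b' d')) (ψ (.fin 0 0 0)) := by
      intro z hz
      obtain ⟨s, hs, e⟩ := key a' b' d' z hx hz
      rw [← e]
      exact (hm.map_coh _ _ (dom_fin_add_w hx z hs) hx (coh_add_w z s a' b' d')).symm
    rcases lt_trichotomy (a' * d') (b'.re ^ 2 + b'.im ^ 2) with h | h | h
    · obtain ⟨z, hz⟩ := exists_lf_neg h
      exact hneg z hz
    · exact hm.map_coh _ _ hx (dom_origin hm.hpsd) (by simpa [coh] using h)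
    · rcases lt_trichotomy d' 0 with hd | hd | hd
      · exact hneg none hd
      · subst hd; nlinarith [sq_nonneg b'.re, sq_nonneg b'.im]
      · have hr : 0 < (a' * d' - (b'.re ^ 2 + b'.im ^ 2)) / d' := div_pos (by linarith) hd
        have := hm.fin_coh_xp hx (z := none) hr.le (by
          simp only [lf]; rw [div_mul_cancel₀ _ hd.ne'])
        rwa [hX _ _ hr] at this
  · rcases lt_trichotomy σ 0 with hσ | hσ | hσ
    · obtain ⟨a', b', d', hK, e⟩ := exists_dom_fin hx
      obtain ⟨s, hs, e'⟩ := key a' b' d' z hK (e ▸ hσ)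
      rw [← e']
      exact (hm.fin_coh_inf_of_eq (dom_fin_add_w hK z hs)
        (by rw [lf_add_w_self, e])).symm
    · subst hσ; exact hm.inf_zero_coh_origin z
    · rw [hN _ _ hσ]; exact hm.inf_zero_coh_origin z
  · exact absurd rfl hne

/-- The case where all points `inf z s` with `0 < s` are collapsed to the image of `top`. -/
theorem concC_of_inf_eq (hm : ModelMap α β δ ψ)
    (hN : ∀ z s, 0 < s → ψ (.inf z s) = ψ .top) {w₀ a b : ℂ} (hab : a ≠ b)
    (h1 : ψ (.inf (some a) 0) ≠ ψ (.inf none 0))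
    (h2 : ψ (.inf (some a) 0) ≠ ψ (.inf (some w₀) 0))
    (h3 : ψ (.inf (some b) 0) ≠ ψ (.inf none 0)) : ConcC α β δ ψ := by
  have hX : ∀ w r, 0 < r → ψ (xp w r) = ψ (.inf w 0) := by
    intro w r hr
    obtain ⟨u, hu⟩ : ∃ u, kap u w = 1 := by
      rcases w with _ | w
      · exact ⟨some 0, kap_some_none 0⟩
      · exact ⟨none, kap_none_some w⟩
    have := hm.xp_coh_inf w u hr.le hr.le (by rw [hu, mul_one])
    rw [hN u r hr] at this
    exact hm.eq_of_coh_pq (hm.xp_coh_origin w hr.le) this (hm.inf_zero_coh_origin w)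
      (hm.inf_zero_coh_top w) (hm.xp_coh_inf_zero w hr.le)
  refine ⟨.fin 0 0 0, .top, dom_origin hm.hpsd, dom_top, ?_⟩
  rintro (⟨a', b', d'⟩ | ⟨z, σ⟩ | _) hx hne
  · by_cases hpos : ∃ z, 0 < lf z a' b' d'
    · obtain ⟨z, hz⟩ := hpos
      have := hm.fin_coh_inf hx z
      rwa [hN _ _ hz] at this
    have hdet : b'.re ^ 2 + b'.im ^ 2 ≤ a' * d' := by
      by_contra! h
      exact hpos (exists_lf_pos h)
    have key : ∀ z w, ψ (.inf z 0) ≠ ψ (.inf w 0) → lf z a' b' d' < 0 → lf w a' b' d' < 0 →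
        (a' * d' - (b'.re ^ 2 + b'.im ^ 2)) * kap w z < lf z a' b' d' * lf w a' b' d' →
        CoherentU (ψ (.fin a' b' d')) (ψ .top) := by
      intro z w hzw hz hw hlt
      have hk := kap_pos (z := w) (w := z) (fun e => hzw (by rw [e]))
      set D := a' * d' - (b'.re ^ 2 + b'.im ^ 2) with hD
      have hD0 : 0 ≤ D := by linarith
      obtain ⟨s, hs1, hs2⟩ : ∃ s, D / (-lf z a' b' d') < s ∧ s < (-lf w a' b' d') / kap w z := by
        apply exists_between
        rw [div_lt_div_iff₀ (by linarith) hk]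
        linarith
      have hs0 : 0 ≤ s := le_trans (div_nonneg hD0 (by linarith)) hs1.le
      rw [div_lt_iff₀ (by linarith)] at hs1
      rw [lt_div_iff₀ hk] at hs2
      have hKs := dom_fin_add_w hx z hs0
      have hdets := det_add_w z s a' b' d'
      have hlfw : lf w (a' + s * wa z) (b' + s * wb z) (d' + s * wd z)
        = lf w a' b' d' + s * kap w z := by rw [lf_add, lf_xp]
      have hlfz := lf_add_w_self z s a' b' d'
      have hneg : D + s * lf z a' b' d' < 0 := by linarith
      have c1 := hm.fin_coh_xp hKs (z := z) (div_pos_of_neg_of_neg hneg hz).le (by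
        rw [hdets, hlfz, div_mul_cancel₀ _ hz.ne])
      rw [hX _ _ (div_pos_of_neg_of_neg hneg hz)] at c1
      have hw' : lf w a' b' d' + s * kap w z < 0 := by linarith
      have c2 := hm.fin_coh_xp hKs (z := w) (div_pos_of_neg_of_neg hneg hw').le (by
        rw [hdets, hlfw, div_mul_cancel₀ _ hw'.ne])
      rw [hX _ _ (div_pos_of_neg_of_neg hneg hw')] at c2
      obtain ⟨u, hu⟩ := exists_lf_pos (a := a' + s * wa z) (b := b' + s * wb z)
        (d := d' + s * wd z) (by linarith)
      have c3 := hm.fin_coh_inf hKs u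
      rw [hN _ _ hu] at c3
      have e := CoherentU.eq_of_not (hm.not_coh_inf_zero hzw) c1 c2
        (hm.inf_zero_coh_top z).symm (hm.inf_zero_coh_top w).symm c3
      rw [← e]
      exact (hm.map_coh _ _ hKs hx (coh_add_w z s a' b' d')).symm
    have hd : d' ≤ 0 := not_lt.1 fun h => hpos ⟨none, h⟩
    rcases hd.lt_or_eq with hd | hd
    · have hstep : ∀ z : ℂ, ψ (.inf (some z) 0) ≠ ψ (.inf none 0) → b' ≠ d' * z →
          CoherentU (ψ (.fin a' b' d')) (ψ .top) := by
        intro z hz hbz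
        have hsq : 0 < (b'.re - d' * z.re) ^ 2 + (b'.im - d' * z.im) ^ 2 := by
          have := Complex.normSq_pos.2 (sub_ne_zero.2 hbz)
          rw [Complex.normSq_apply] at this
          simp only [Complex.sub_re, Complex.sub_im, Complex.re_ofReal_mul,
            Complex.im_ofReal_mul] at this
          nlinarith
        have hid : lf (some z) a' b' d' * d' = a' * d' - (b'.re ^ 2 + b'.im ^ 2)
            + ((b'.re - d' * z.re) ^ 2 + (b'.im - d' * z.im) ^ 2) := by
          simp only [lf]; ring
        refine key (some z) none hz ?_ hd ?_
        · by_contra! h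
          nlinarith
        · rw [kap_none_some, show lf none a' b' d' = d' from rfl, hid]
          linarith
      by_cases hb : b' = d' * a
      · refine hstep b h3 fun hb' => hab ?_
        have : (d' : ℂ) ≠ 0 := by exact_mod_cast hd.ne
        exact mul_left_cancel₀ this (hb ▸ hb')
      · exact hstep a h1 hb
    · subst hd
      have hb0 : b' = 0 := by
        apply Complex.ext <;> simp <;> nlinarith [sq_nonneg b'.re, sq_nonneg b'.im]
      subst hb0
      have hl : ∀ z : ℂ, lf (some z) a' 0 0 = a' := fun z => by simp [lf]
      have ha' : a' < 0 := by
        apply lt_of_le_of_ne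
        · exact not_lt.1 fun h => hpos ⟨some 0, by rwa [hl]⟩
        · rintro rfl; exact hne rfl
      refine key (some a) (some w₀) h2 (by rwa [hl]) (by rwa [hl]) ?_
      rw [hl, hl]
      simp only [Complex.zero_re, Complex.zero_im]
      nlinarith
  · exact hm.inf_coh_top z hx
  · exact CoherentU.refl _

end ModelMap

/-- A multiplicative function on the positive reals that fixes `4` and is bounded on `(0, 4]` is
the identity. -/
theorem eq_self_of_mul_of_bounded {g : ℝ → ℝ} (hpos : ∀ t, 0 < t → 0 < g t)
    (hmul : ∀ s t, 0 < s → 0 < t → g (s * t) = g s * g t) (h4 : g 4 = 4)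
    (hb : ∀ t, 0 < t → t ≤ 4 → g t ≤ 4) {t : ℝ} (ht : 0 < t) : g t = t := by
  have h1 : g 1 = 1 := by
    have := hmul 1 1 one_pos one_pos
    rw [mul_one] at this
    exact mul_left_cancel₀ (hpos 1 one_pos).ne' (by rw [← this, mul_one])
  have hinv : ∀ t, 0 < t → g t⁻¹ = (g t)⁻¹ := by
    intro t ht
    apply eq_inv_of_mul_eq_one_right
    rw [← hmul _ _ ht (inv_pos.2 ht), mul_inv_cancel₀ ht.ne', h1]
  have hpow : ∀ (n : ℕ) t, 0 < t → g (t ^ n) = g t ^ n := by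
    intro n t ht
    induction n with
    | zero => simpa using h1
    | succ n ih => rw [pow_succ, hmul _ _ (by positivity) ht, ih, pow_succ]
  have hzpow : ∀ m : ℤ, g ((4 : ℝ) ^ m) = 4 ^ m := by
    intro m
    obtain ⟨n, rfl | rfl⟩ := m.eq_nat_or_neg
    · rw [zpow_natCast, hpow n 4 (by norm_num), h4]
    · rw [_root_.zpow_neg, zpow_natCast, hinv _ (by positivity), hpow n 4 (by norm_num), h4]
  have hlin : ∀ t, 0 < t → g t ≤ 4 * t := by
    intro t ht
    obtain ⟨m, hm1, hm2⟩ := exists_mem_Ioc_zpow ht (by norm_num : (1 : ℝ) < 4)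
    have hp : (0 : ℝ) < 4 ^ m := by positivity
    have hs : 0 < t / 4 ^ m := by positivity
    have hs4 : t / 4 ^ m ≤ 4 := by
      rw [div_le_iff₀ hp, mul_comm]
      rwa [zpow_add_one₀ (by norm_num)] at hm2
    have e : t = t / 4 ^ m * 4 ^ m := by field_simp
    rw [e, hmul _ _ hs hp, hzpow]
    have := hb _ hs hs4
    nlinarith
  have hle : ∀ t, 0 < t → g t ≤ t := by
    intro t ht
    by_contra! hlt
    obtain ⟨n, hn⟩ := pow_unbounded_of_one_lt 4 ((one_lt_div ht).2 hlt)
    have := hlin (t ^ n) (by positivity)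
    rw [hpow n t ht] at this
    rw [div_pow, lt_div_iff₀ (by positivity)] at hn
    linarith
  apply le_antisymm (hle t ht)
  have := hle t⁻¹ (inv_pos.2 ht)
  rw [hinv t ht] at this
  exact (inv_le_inv₀ (hpos t ht) ht).1 this

theorem sq_sub_mul_add_sq {a b : ℂ} (ha : Complex.normSq a = 1) (hb : Complex.normSq b = 1)
    (hab : Complex.normSq (a - b) = 1) : a ^ 2 - a * b + b ^ 2 = 0 := by
  have ha' : (starRingEnd ℂ) a * a = 1 := by rw [← Complex.normSq_eq_conj_mul_self, ha]; simp
  have hb' : (starRingEnd ℂ) b * b = 1 := by rw [← Complex.normSq_eq_conj_mul_self, hb]; simp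
  have hab' : (starRingEnd ℂ) (a - b) * (a - b) = 1 := by
    rw [← Complex.normSq_eq_conj_mul_self, hab]; simp
  rw [map_sub] at hab'
  linear_combination (-a * b) * hab' + (a * b - b ^ 2) * ha' + (a * b - a ^ 2) * hb'

/-- Rigidity: a map of the plane multiplying squared distances through a function of the
squared distance, fixing `0` and `1`, is the identity or the conjugation. -/
theorem eq_id_or_conj {F : ℂ → ℂ} {g : ℝ → ℝ} (hF0 : F 0 = 0) (hF1 : F 1 = 1) (hg1 : g 1 = 1)
    (h : ∀ r z w, 0 < r → z ≠ w →
      g (r * Complex.normSq (z - w)) = g r * Complex.normSq (F z - F w))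
    (hinj : ∀ z w, F z = F w → z = w) :
    (∀ r, 0 < r → g r = r) ∧ ((∀ z, F z = z) ∨ ∀ z, F z = (starRingEnd ℂ) z) := by
  have hd : ∀ z w, z ≠ w → g (Complex.normSq (z - w)) = Complex.normSq (F z - F w) := by
    intro z w hzw
    have := h 1 z w one_pos hzw
    rwa [one_mul, hg1, one_mul] at this
  have hd1 : ∀ z w, Complex.normSq (z - w) = 1 → Complex.normSq (F z - F w) = 1 := by
    intro z w hzw
    rw [← hd z w, hzw, hg1]
    rintro rfl
    simp at hzw
  have hex : ∀ t : ℝ, 0 < t → Complex.normSq (((√t : ℝ) : ℂ) - 0) = t ∧ ((√t : ℝ) : ℂ) ≠ 0 := by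
    intro t ht
    refine ⟨by rw [sub_zero, Complex.normSq_ofReal, Real.mul_self_sqrt ht.le], ?_⟩
    exact_mod_cast (Real.sqrt_pos.2 ht).ne'
  have hpos : ∀ t, 0 < t → 0 < g t := by
    intro t ht
    obtain ⟨e1, e2⟩ := hex t ht
    rw [← e1, hd _ _ e2, Complex.normSq_pos]
    exact sub_ne_zero.2 fun e => e2 (hinj _ _ e)
  have hmul : ∀ s t, 0 < s → 0 < t → g (s * t) = g s * g t := by
    intro s t hs ht
    obtain ⟨e1, e2⟩ := hex t ht
    have := h s _ _ hs e2
    rwa [← hd _ _ e2, e1] at this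
  have hunit : ∀ z, Complex.normSq z = 1 → Complex.normSq (F z) = 1 := by
    intro z hz
    have := hd1 z 0 (by rwa [sub_zero])
    rwa [hF0, sub_zero] at this
  have h4 : g 4 = 4 := by
    have h3 : √3 ^ 2 = (3 : ℝ) := Real.sq_sqrt (by norm_num)
    set ω : ℂ := ⟨1 / 2, √3 / 2⟩ with hω
    set ω' : ℂ := ⟨-(1 / 2), √3 / 2⟩ with hω'
    have u1 := hunit ω (by simp [Complex.normSq_apply, hω]; nlinarith)
    have u2 := hunit ω' (by simp [Complex.normSq_apply, hω']; nlinarith)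
    have u3 := hunit (-1) (by simp)
    have v1 := hd1 1 ω (by simp [Complex.normSq_apply, hω]; nlinarith)
    have v2 := hd1 ω ω' (by simp [Complex.normSq_apply, hω, hω']; nlinarith)
    have v3 := hd1 ω' (-1) (by simp [Complex.normSq_apply, hω']; nlinarith)
    have n1 : F ω' ≠ F 1 := by
      intro e
      have := congrArg Complex.re (hinj _ _ e)
      simp [hω'] at this
      norm_num at this
    have n2 : F (-1) ≠ F ω := by
      intro e
      have := congrArg Complex.re (hinj _ _ e)
      simp [hω] at this
      norm_num at this
    rw [hF1] at v1 n1
    have q1 := sq_sub_mul_add_sq (by simp) u1 v1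
    have q2 := sq_sub_mul_add_sq u1 u2 v2
    have q3 := sq_sub_mul_add_sq u2 u3 v3
    have e1 : F ω' = F ω - 1 := by
      have : (F ω' - 1) * (F ω' - (F ω - 1)) = 0 := by linear_combination q2 - q1
      rcases mul_eq_zero.1 this with h | h
      · exact absurd (sub_eq_zero.1 h) n1
      · exact sub_eq_zero.1 h
    have e2 : F (-1) = -1 := by
      have : (F (-1) - F ω) * (F (-1) - (F ω' - F ω)) = 0 := by linear_combination q3 - q2
      rcases mul_eq_zero.1 this with h | h
      · exact absurd (sub_eq_zero.1 h) n2
      · rw [sub_eq_zero.1 h, e1]; ring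
    have := hd 1 (-1) (by norm_num)
    rw [hF1, e2] at this
    norm_num [Complex.normSq_apply] at this
    exact this
  have hb : ∀ t, 0 < t → t ≤ 4 → g t ≤ 4 := by
    intro t ht ht4
    have hs := Real.sq_sqrt (show 0 ≤ 1 - (1 - t / 2) ^ 2 by nlinarith)
    set z : ℂ := ⟨1 - t / 2, √(1 - (1 - t / 2) ^ 2)⟩ with hz
    have hz1 : Complex.normSq z = 1 := by rw [Complex.normSq_apply, hz]; simp only; nlinarith
    have hzt : Complex.normSq (z - 1) = t := by
      rw [Complex.normSq_apply, hz]; simp; nlinarith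
    have := hd z 1 (by rintro e; rw [e] at hzt; simp at hzt; linarith)
    rw [hzt, hF1] at this
    have hu := hunit z hz1
    rw [this]
    simp only [Complex.normSq_apply, Complex.sub_re, Complex.sub_im, Complex.one_re,
      Complex.one_im] at hu ⊢
    nlinarith [sq_nonneg (F z).im, sq_nonneg ((F z).re + 1)]
  have hg : ∀ r, 0 < r → g r = r := fun r hr => eq_self_of_mul_of_bounded hpos hmul h4 hb hr
  refine ⟨hg, ?_⟩
  have hiso : ∀ z w, Complex.normSq (F z - F w) = Complex.normSq (z - w) := by
    intro z w
    by_cases hzw : z = w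
    · subst hzw; simp
    · rw [← hd z w hzw, hg _ (Complex.normSq_pos.2 (sub_ne_zero.2 hzw))]
  have hn : ∀ z, (F z).re = z.re ∧ (F z).im ^ 2 = z.im ^ 2 := by
    intro z
    have i0 := hiso z 0
    have i1 := hiso z 1
    rw [hF0] at i0
    rw [hF1] at i1
    simp only [Complex.normSq_apply, Complex.sub_re, Complex.sub_im, Complex.one_re,
      Complex.one_im, Complex.zero_re, Complex.zero_im] at i0 i1
    have : (F z).re = z.re := by linarith
    refine ⟨this, ?_⟩
    rw [this] at i0
    linarith
  have hI := hn Complex.I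
  have hz : ∀ z, (F z).im * (F Complex.I).im = z.im := by
    intro z
    have i := hiso z Complex.I
    obtain ⟨a1, a2⟩ := hn z
    obtain ⟨b1, b2⟩ := hI
    simp only [Complex.normSq_apply, Complex.sub_re, Complex.sub_im, Complex.I_re, Complex.I_im,
      a1, b1] at i b2
    nlinarith
  have hIm : (F Complex.I).im = 1 ∨ (F Complex.I).im = -1 := by
    have := hI.2
    rw [Complex.I_im] at this
    exact sq_eq_sq_iff_eq_or_eq_neg.1 this
  rcases hIm with hI1 | hI1
  · left
    intro z
    have := hz z
    rw [hI1, mul_one] at this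
    exact Complex.ext (hn z).1 this
  · right
    intro z
    have := hz z
    rw [hI1] at this
    exact Complex.ext (by simpa using (hn z).1) (by simp; linarith)

/-! ### Normalization of the target -/

theorem repS_origin : repS (.fin 0 0 0) = 0 := by
  ext i j; fin_cases i <;> fin_cases j <;> simp [repS, hmat]

theorem IsLag.congruence {S T : Mat2} (h : IsLag S T) {g k : Mat2} (hk : k * g = 1) {r : ℝ}
    (hr : r ≠ 0) : IsLag ((r : ℂ) • (g * S)) (kᴴ * T) := by
  have hk' : gᴴ * kᴴ = 1 := by rw [← conjTranspose_mul, hk, conjTranspose_one]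
  refine ⟨?_, fun v h1 h2 => h.2 v ?_ ?_⟩
  · have : pairing ((r : ℂ) • (g * S)) (kᴴ * T) ((r : ℂ) • (g * S)) (kᴴ * T)
        = (r : ℂ) • (Sᴴ * (gᴴ * kᴴ) * T - Tᴴ * (k * g) * S) := by
      simp [pairing, smul_sub, Matrix.mul_assoc]
    rw [this, hk, hk', Matrix.mul_one, Matrix.mul_one]
    have h1 := h.1
    simp only [pairing] at h1
    rw [h1, smul_zero]
  · have hr' : (r : ℂ) ≠ 0 := by exact_mod_cast hr
    rw [Matrix.smul_mulVec, smul_eq_zero] at h1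
    have h3 := h1.resolve_left hr'
    have : k *ᵥ ((g * S) *ᵥ v) = 0 := by rw [h3, mulVec_zero]
    rwa [mulVec_mulVec, ← Matrix.mul_assoc, hk, Matrix.one_mul] at this
  · have : gᴴ *ᵥ ((kᴴ * T) *ᵥ v) = 0 := by rw [h2, mulVec_zero]
    rwa [mulVec_mulVec, ← Matrix.mul_assoc, hk', Matrix.one_mul] at this

/-- The congruence automorphism and its action on the points of the standard cycle. -/
theorem exists_isAut_congruence_inf (g k : Mat2) (hk : k * g = 1) (r : ℝ) (hr : r ≠ 0) :
    ∃ Φ : U2 → U2, IsAut Φ ∧ Φ (toU (.fin 0 0 0)) = toU (.fin 0 0 0) ∧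
      Φ (toU .top) = toU .top ∧
      (∀ z z' : Option ℂ, ∀ c : ℂ, c ≠ 0 → k * repS (.inf z' 0) = c • repS (.inf z 0) →
        Φ (toU (.inf z 0)) = toU (.inf z' 0)) ∧
      ∀ S T, IsLag S T → Φ (pt S T) = pt ((r : ℂ) • (g * S)) (kᴴ * T) := by
  obtain ⟨Φ, hΦ, h⟩ := exists_isAut_congruence g k hk r hr
  refine ⟨Φ, hΦ, ?_, ?_, ?_, h⟩
  · rw [toU, h _ _ (isLag_rep _), pt_eq_pt ((isLag_rep _).congruence hk hr) (isLag_rep _)]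
    simp [pairing, repS_origin]
  · rw [toU, h _ _ (isLag_rep _), pt_eq_pt ((isLag_rep _).congruence hk hr) (isLag_rep _)]
    simp [pairing, repT]
  · intro z z' c hc hz
    have h0 : ∀ z, (repT (.inf z 0))ᴴ * repS (.inf z 0) = 0 := by
      intro z
      rcases z with _ | z <;> ext i j <;> fin_cases i <;> fin_cases j <;>
        simp [repS, repT, Matrix.mul_apply, Fin.sum_univ_two]
    have hg : g * repS (.inf z 0) = c⁻¹ • repS (.inf z' 0) := by
      have : g * (k * repS (.inf z' 0)) = c • (g * repS (.inf z 0)) := by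
        rw [hz, Matrix.mul_smul]
      rw [← Matrix.mul_assoc, mul_eq_one_comm.1 hk, Matrix.one_mul] at this
      rw [this, smul_smul, inv_mul_cancel₀ hc, one_smul]
    rw [toU, h _ _ (isLag_rep _), toU, pt_eq_pt ((isLag_rep _).congruence hk hr) (isLag_rep _)]
    have h1 : (repS (.inf z' 0))ᴴ * repT (.inf z' 0) = 0 := by
      have := congrArg conjTranspose (h0 z')
      rwa [conjTranspose_mul, conjTranspose_conjTranspose, conjTranspose_zero] at this
    rw [pairing, hg, conjTranspose_mul, conjTranspose_conjTranspose, Matrix.mul_assoc, hz]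
    simp [h0, h1]

theorem exists_isAut_origin_top {p q : U2} (hpq : ¬ CoherentU p q) :
    ∃ Φ : U2 → U2, IsAut Φ ∧ Φ p = toU (.fin 0 0 0) ∧ Φ q = toU .top := by
  have h1 := isAut_mul_left q⁻¹
  obtain ⟨x, hx⟩ := toU_surjective (q⁻¹ * p)
  have hq : q⁻¹ * q = toU .top := by rw [toU_top]; simp
  rw [h1.2] at hpq
  simp only at hpq
  rw [← hx, hq, coherentU_toU] at hpq
  rcases x with ⟨a, b, d⟩ | _ | _
  · have hH : (-hmat a b d).IsHermitian := by
      ext i j; fin_cases i <;> fin_cases j <;> simp [hmat]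
    obtain ⟨Φ, hΦ, h⟩ := exists_isAut_translation _ hH
    refine ⟨Φ ∘ fun U => q⁻¹ * U, hΦ.comp h1, ?_, ?_⟩
    · simp only [Function.comp]
      rw [← hx, toU, h _ _ (isLag_rep _), toU, repS_origin]
      simp [repS, repT]
    · simp only [Function.comp]
      rw [hq, toU, h _ _ (isLag_rep _)]
      simp [repT]
  · exact absurd trivial hpq
  · exact absurd trivial hpq

theorem exists_isAut_three {z₁ z₂ z₃ : Option ℂ} (h₁₂ : z₁ ≠ z₂) (h₁₃ : z₁ ≠ z₃) (h₂₃ : z₂ ≠ z₃) :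
    ∃ Φ : U2 → U2, IsAut Φ ∧ Φ (toU (.fin 0 0 0)) = toU (.fin 0 0 0) ∧
      Φ (toU .top) = toU .top ∧ Φ (toU (.inf z₁ 0)) = toU (.inf none 0) ∧
      Φ (toU (.inf z₂ 0)) = toU (.inf (some 0) 0) ∧
      Φ (toU (.inf z₃ 0)) = toU (.inf (some 1) 0) := by
  obtain ⟨n, m, hnm, hD⟩ : ∃ n m : Option ℂ → ℂ,
      (∀ z, repS (.inf z 0) = !![0, n z; 0, m z]) ∧ ∀ z w, z ≠ w → n z * m w - m z * n w ≠ 0 := by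
    refine ⟨fun z => z.elim 1 id, fun z => z.elim 0 fun _ => 1, ?_, ?_⟩
    · intro z
      rcases z with _ | z <;> simp [repS]
    · intro z w hzw
      rcases z with _ | z <;> rcases w with _ | w
      · exact absurd rfl hzw
      · simp
      · simp
      · simp only [Option.elim_some, id, mul_one, one_mul]
        exact sub_ne_zero.2 fun e => hzw (by rw [e])
  have h2 := hD _ _ h₁₂
  have h3 := hD _ _ h₁₃
  have h1 := hD _ _ h₂₃.symm
  set x := n z₃ * m z₂ - m z₃ * n z₂
  set y := n z₁ * m z₃ - m z₁ * n z₃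
  set k : Mat2 := !![x * n z₁, y * n z₂; x * m z₁, y * m z₂] with hk
  have hdet : k.det = x * y * (n z₁ * m z₂ - m z₁ * n z₂) := by
    rw [hk, Matrix.det_fin_two]; simp; ring
  have hdu : IsUnit k.det := by
    rw [hdet]; exact (mul_ne_zero (mul_ne_zero h1 h3) h2).isUnit
  obtain ⟨Φ, hΦ, f1, f2, f3, -⟩ :=
    exists_isAut_congruence_inf k⁻¹ k (Matrix.mul_nonsing_inv k hdu) 1 one_ne_zero
  refine ⟨Φ, hΦ, f1, f2, f3 _ _ x h1 ?_, f3 _ _ y h3 ?_, f3 _ _ _ h2 ?_⟩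
  · rw [hnm z₁]
    ext i j
    fin_cases i <;> fin_cases j <;> simp [hk, repS, Matrix.mul_apply, Fin.sum_univ_two]
  · rw [hnm z₂]
    ext i j
    fin_cases i <;> fin_cases j <;> simp [hk, repS, Matrix.mul_apply, Fin.sum_univ_two]
  · rw [hnm z₃]
    ext i j
    fin_cases i <;> fin_cases j <;> simp [hk, repS, Matrix.mul_apply, Fin.sum_univ_two, x, y] <;>
      ring

theorem exists_isAut_scale {γ : ℝ} (hγ : γ ≠ 0) :
    ∃ Φ : U2 → U2, IsAut Φ ∧ Φ (toU (.fin 0 0 0)) = toU (.fin 0 0 0) ∧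
      Φ (toU .top) = toU .top ∧ (∀ z, Φ (toU (.inf z 0)) = toU (.inf z 0)) ∧
      Φ (toU (xp (some 0) γ)) = toU (xp (some 0) 1) := by
  obtain ⟨Φ, hΦ, f1, f2, f3, f4⟩ :=
    exists_isAut_congruence_inf 1 1 (Matrix.one_mul 1) γ⁻¹ (inv_ne_zero hγ)
  refine ⟨Φ, hΦ, f1, f2, fun z => f3 z z 1 one_ne_zero (by simp), ?_⟩
  rw [toU, f4 _ _ (isLag_rep _), toU]
  have hγ' : (γ : ℂ) ≠ 0 := by exact_mod_cast hγ
  congr 1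
  · ext i j
    fin_cases i <;> fin_cases j <;> simp [xp, repS, hmat, wa, wb, wd, hγ']
  · simp [xp, repT]

theorem exists_eq_inf_zero {U : U2} (h1 : CoherentU U (toU (.fin 0 0 0)))
    (h2 : CoherentU U (toU .top)) : ∃ z, U = toU (.inf z 0) := by
  obtain ⟨x, rfl⟩ := toU_surjective U
  rw [coherentU_toU] at h1 h2
  rcases x with _ | ⟨z, s⟩ | _
  · exact absurd h2 id
  · simp only [coh, lf_zero] at h1
    exact ⟨z, by rw [h1]⟩
  · exact absurd h1 id

theorem exists_eq_inf {U : U2} {w : Option ℂ} (h1 : CoherentU U (toU .top))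
    (h2 : CoherentU U (toU (.inf w 0))) (h3 : U ≠ toU .top) : ∃ s, U = toU (.inf w s) := by
  obtain ⟨x, rfl⟩ := toU_surjective U
  rw [coherentU_toU] at h1 h2
  rcases x with _ | ⟨z, s⟩ | _
  · exact absurd h1 id
  · simp only [coh] at h2
    exact ⟨s, by rw [h2]⟩
  · exact absurd rfl h3

theorem exists_eq_xp_of_lf_eq_zero {a d : ℝ} {b : ℂ} {w : Option ℂ}
    (h1 : a * d = b.re ^ 2 + b.im ^ 2) (h2 : lf w a b d = 0) : ∃ r, .fin a b d = xp w r := by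
  rcases w with _ | w
  · refine ⟨a, ?_⟩
    simp only [lf] at h2
    subst h2
    have hb0 : b = 0 := by
      apply Complex.ext <;> simp <;> nlinarith [sq_nonneg b.re, sq_nonneg b.im]
    simp [xp, wa, wb, wd, hb0]
  · refine ⟨d, ?_⟩
    simp only [lf] at h2
    have hsq : (b.re - d * w.re) ^ 2 + (b.im - d * w.im) ^ 2 = 0 := by
      linear_combination d * h2 - h1
    have e1 : b.re = d * w.re := by nlinarith [sq_nonneg (b.re - d * w.re), sq_nonneg (b.im - d * w.im)]
    have e2 : b.im = d * w.im := by nlinarith [sq_nonneg (b.re - d * w.re), sq_nonneg (b.im - d * w.im)]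
    have hb : b = d * w := by apply Complex.ext <;> simp [e1, e2]
    simp only [xp, wa, wb, wd, hb, mul_one, MP.fin.injEq, and_true]
    rw [e1, e2] at h2
    linarith

theorem exists_eq_xp {U : U2} {w : Option ℂ} (h1 : CoherentU U (toU (.fin 0 0 0)))
    (h2 : CoherentU U (toU (.inf w 0))) (h3 : U ≠ toU (.inf w 0)) :
    ∃ r, U = toU (xp w r) := by
  obtain ⟨x, rfl⟩ := toU_surjective U
  rw [coherentU_toU] at h1 h2
  rcases x with ⟨a, b, d⟩ | ⟨z, s⟩ | _
  · obtain ⟨r, hr⟩ := exists_eq_xp_of_lf_eq_zero (by simpa [coh] using h1) h2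
    exact ⟨r, by rw [hr]⟩
  · simp only [coh, lf_zero] at h1 h2
    exact absurd (by rw [h1, h2]) h3
  · exact absurd h1 id

theorem xp_zero (w : Option ℂ) : xp w 0 = .fin 0 0 0 := by simp [xp]

theorem exists_isAut_normalization {p q f₁ f₂ f₃ x : U2} (hpq : ¬ CoherentU p q)
    (h₁p : CoherentU f₁ p) (h₁q : CoherentU f₁ q) (h₂p : CoherentU f₂ p) (h₂q : CoherentU f₂ q)
    (h₃p : CoherentU f₃ p) (h₃q : CoherentU f₃ q) (h₁₂ : f₁ ≠ f₂) (h₁₃ : f₁ ≠ f₃) (h₂₃ : f₂ ≠ f₃)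
    (hxp : CoherentU x p) (hxf : CoherentU x f₂) (hxp' : x ≠ p) (hxf' : x ≠ f₂) :
    ∃ Φ : U2 → U2, IsAut Φ ∧ Φ p = toU (.fin 0 0 0) ∧ Φ q = toU .top ∧
      Φ f₁ = toU (.inf none 0) ∧ Φ f₂ = toU (.inf (some 0) 0) ∧ Φ f₃ = toU (.inf (some 1) 0) ∧
      Φ x = toU (xp (some 0) 1) := by
  obtain ⟨Φ₁, A₁, hp, hq⟩ := exists_isAut_origin_top hpq
  have hf : ∀ f, CoherentU f p → CoherentU f q → ∃ z, Φ₁ f = toU (.inf z 0) := by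
    intro f hfp hfq
    rw [A₁.2, hp] at hfp
    rw [A₁.2, hq] at hfq
    exact exists_eq_inf_zero hfp hfq
  obtain ⟨z₁, e₁⟩ := hf f₁ h₁p h₁q
  obtain ⟨z₂, e₂⟩ := hf f₂ h₂p h₂q
  obtain ⟨z₃, e₃⟩ := hf f₃ h₃p h₃q
  have hne : ∀ {f f' z z'}, Φ₁ f = toU (.inf z 0) → Φ₁ f' = toU (.inf z' 0) → f ≠ f' → z ≠ z' := by
    intro f f' z z' e e' h hz
    exact h (A₁.1.1 (by rw [e, e', hz]))
  obtain ⟨Φ₂, A₂, g1, g2, g3, g4, g5⟩ := exists_isAut_three (hne e₁ e₂ h₁₂) (hne e₁ e₃ h₁₃)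
    (hne e₂ e₃ h₂₃)
  have A := A₂.comp A₁
  rw [A.2, Function.comp, Function.comp, hp, g1] at hxp
  rw [A.2, Function.comp, Function.comp, e₂, g4] at hxf
  have hxf'' : Φ₂ (Φ₁ x) ≠ toU (.inf (some 0) 0) := by
    rw [← g4, ← e₂]
    exact fun h => hxf' (A.1.1 h)
  obtain ⟨γ, hγ⟩ := exists_eq_xp hxp hxf hxf''
  have hγ0 : γ ≠ 0 := by
    rintro rfl
    rw [xp_zero, ← g1, ← hp] at hγ
    exact hxp' (A.1.1 hγ)
  obtain ⟨Φ₃, A₃, k1, k2, k3, k4⟩ := exists_isAut_scale hγ0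
  refine ⟨Φ₃ ∘ (Φ₂ ∘ Φ₁), A₃.comp A, ?_, ?_, ?_, ?_, ?_, ?_⟩ <;> simp only [Function.comp]
  · rw [hp, g1, k1]
  · rw [hq, g2, k2]
  · rw [e₁, g3, k3]
  · rw [e₂, g4, k3]
  · rw [e₃, g5, k3]
  · rw [hγ, k4]

/-- The automorphism induced by complex conjugation. -/
theorem exists_isAut_conj_toU : ∃ Φ : U2 → U2, IsAut Φ ∧
    (∀ a b d, Φ (toU (.fin a b d)) = toU (.fin a ((starRingEnd ℂ) b) d)) ∧
    (∀ z s, Φ (toU (.inf (some z) s)) = toU (.inf (some ((starRingEnd ℂ) z)) s)) ∧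
    (∀ s, Φ (toU (.inf none s)) = toU (.inf none s)) ∧ Φ (toU .top) = toU .top := by
  obtain ⟨Φ, hΦ, h⟩ := exists_isAut_conj
  refine ⟨Φ, hΦ, fun a b d => ?_, fun z s => ?_, fun s => ?_, ?_⟩ <;>
    simp only [toU] <;> rw [h _ _ (isLag_rep _)] <;> congr 1 <;> ext i j <;> fin_cases i <;>
    fin_cases j <;> simp [repS, repT, hmat]

theorem exists_kap_eq_one (z : Option ℂ) : ∃ u, u ≠ z ∧ kap z u = 1 := by
  rcases z with _ | z
  · exact ⟨some 0, by simp, kap_none_some 0⟩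
  · exact ⟨none, by simp, kap_some_none z⟩

/-- A hermitian matrix positive on one direction is positive on another one. -/
theorem exists_ne_lf_pos {a d : ℝ} {b : ℂ} {z : Option ℂ} (hz : 0 < lf z a b d) :
    ∃ z', z' ≠ z ∧ 0 < lf z' a b d := by
  have two : ∀ (z e : ℂ), 0 < a - 2 * (z.re * b.re + z.im * b.im)
      + (z.re ^ 2 + z.im ^ 2) * d + (e.re ^ 2 + e.im ^ 2) * d →
      0 < lf (some (z + e)) a b d ∨ 0 < lf (some (z - e)) a b d := by
    intro z e h
    by_contra! hcon
    simp only [lf, Complex.add_re, Complex.add_im, Complex.sub_re, Complex.sub_im] at hcon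
    nlinarith
  rcases z with _ | z
  · simp only [lf] at hz
    set t : ℝ := (|a| + 1) / d + 1 with ht
    have hq : 0 < (|a| + 1) / d := by positivity
    have h1 : (|a| + 1) / d * d = |a| + 1 := by field_simp
    rcases two 0 (t : ℂ) (by
      simp only [Complex.zero_re, Complex.zero_im, Complex.ofReal_re, Complex.ofReal_im]
      have : |a| + 1 ≤ t ^ 2 * d := by
        rw [← h1]
        apply mul_le_mul_of_nonneg_right _ hz.le
        rw [ht]; nlinarith
      nlinarith [neg_abs_le a]) with h | h
    · exact ⟨_, by simp, h⟩
    · exact ⟨_, by simp, h⟩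
  · rcases lt_or_ge 0 d with hd | hd
    · exact ⟨none, by simp, hd⟩
    · set ε := lf (some z) a b d with hε
      have hd1 : 0 < 1 - d := by linarith
      have he : 0 < ε / (1 - d) := by positivity
      have hsq := Real.sq_sqrt he.le
      have hs0 := Real.sqrt_pos.2 he
      set e := √(ε / (1 - d))
      have hec : (e : ℂ) ≠ 0 := by exact_mod_cast hs0.ne'
      rcases two z (e : ℂ) (by
        simp only [Complex.ofReal_re, Complex.ofReal_im, hsq]
        have : ε + ε / (1 - d) * d = ε / (1 - d) := by field_simp; ring
        simp only [lf] at hε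
        linarith) with h | h
      · exact ⟨_, by simpa using hec, h⟩
      · exact ⟨_, by simpa using hec, h⟩

theorem psd_of_det_eq_zero {a d : ℝ} {b : ℂ} {z : Option ℂ} (hdet : a * d = b.re ^ 2 + b.im ^ 2)
    (hz : 0 < lf z a b d) : psd a b d := by
  have hd : 0 ≤ d := by
    rcases z with _ | z
    · exact hz.le
    · by_contra! hd
      have := mul_neg_of_neg_of_pos hd hz
      simp only [lf] at this
      nlinarith [sq_nonneg (b.re - d * z.re), sq_nonneg (b.im - d * z.im)]
  refine ⟨?_, hd, hdet.ge⟩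
  rcases hd.eq_or_lt with h0 | h0
  · subst h0
    have h1 : b.re = 0 := by nlinarith [sq_nonneg b.re, sq_nonneg b.im]
    have h2 : b.im = 0 := by nlinarith [sq_nonneg b.re, sq_nonneg b.im]
    rcases z with _ | z
    · exact absurd hz (lt_irrefl 0)
    · simp only [lf, h1, h2] at hz
      linarith
  · by_contra! ha
    nlinarith [sq_nonneg b.re, sq_nonneg b.im]

theorem psd.eq_xp {a d : ℝ} {b : ℂ} (h : psd a b d) (hdet : a * d = b.re ^ 2 + b.im ^ 2) :
    ∃ w r, 0 ≤ r ∧ .fin a b d = xp w r := by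
  obtain ⟨ha, hd, -⟩ := h
  rcases hd.eq_or_lt with h0 | h0
  · subst h0
    obtain ⟨r, hr⟩ := exists_eq_xp_of_lf_eq_zero (w := none) hdet rfl
    refine ⟨none, r, ?_, hr⟩
    simp only [xp, wa, mul_one, MP.fin.injEq] at hr
    exact hr.1 ▸ ha
  · obtain ⟨r, hr⟩ := exists_eq_xp_of_lf_eq_zero (w := some (b / d)) hdet
      (by rw [lf_div h0.ne', hdet]; simp)
    refine ⟨_, r, ?_, hr⟩
    simp only [xp, wd, mul_one, MP.fin.injEq] at hr
    exact hr.2.2 ▸ hd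

namespace ModelMap

variable {α : ℝ} {β : ℂ} {δ : ℝ} {ψ : MP → U2}

/-- A coherency preserver which is the identity on the points of rank at most one and on the
nonnegative points at infinity is the identity. -/
theorem eq_toU (hm : ModelMap α β δ ψ) (htop : ψ .top = toU .top)
    (hX : ∀ w r, 0 ≤ r → ψ (xp w r) = toU (xp w r))
    (hN : ∀ z s, 0 ≤ s → ψ (.inf z s) = toU (.inf z s)) {x : MP} (hx : dom α β δ x) :
    ψ x = toU x := by
  have three : ∀ {x u v w : MP}, dom α β δ x → dom α β δ u → dom α β δ v → dom α β δ w →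
      ψ u = toU u → ψ v = toU v → ψ w = toU w → coh u v → u ≠ v → ¬ coh u w →
      coh x u → coh x v → coh x w → ψ x = toU x := by
    intro x u v w hx hu hv hw eu ev ew huv hne huw h1 h2 h3
    refine CoherentU.eq_of_three (u := toU u) (v := toU v) (w := toU w)
      ((coherentU_toU _ _).2 huv) (fun e => hne (toU_injective e))
      (fun h => huw ((coherentU_toU _ _).1 h)) ?_ ?_ ?_
      ((coherentU_toU _ _).2 h1) ((coherentU_toU _ _).2 h2) ((coherentU_toU _ _).2 h3)
    · rw [← eu]; exact hm.map_coh _ _ hx hu h1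
    · rw [← ev]; exact hm.map_coh _ _ hx hv h2
    · rw [← ew]; exact hm.map_coh _ _ hx hw h3
  have pos : ∀ (a : ℝ) (b : ℂ) (d : ℝ) (z : Option ℂ), dom α β δ (.fin a b d) →
      0 < lf z a b d → ψ (.fin a b d) = toU (.fin a b d) := by
    intro a b d z hK hz
    obtain ⟨z', hz'ne, hz'⟩ := exists_ne_lf_pos hz
    set s := -((a * d - (b.re ^ 2 + b.im ^ 2)) / lf z a b d) with hs
    have hdet : (a + s * wa z) * (d + s * wd z)
        = (b + s * wb z).re ^ 2 + (b + s * wb z).im ^ 2 := by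
      have := det_add_w z s a b d
      have e : s * lf z a b d = -(a * d - (b.re ^ 2 + b.im ^ 2)) := by
        rw [hs, neg_mul, div_mul_cancel₀ _ hz.ne']
      linarith
    have hlf := lf_add_w_self z s a b d
    obtain ⟨w, r, hr, e⟩ := (psd_of_det_eq_zero hdet (hlf ▸ hz)).eq_xp hdet
    refine three (u := .inf z (lf z a b d)) (v := xp w r) (w := .inf z' (lf z' a b d)) hK
      (dom_inf_of_fin hK z) (dom_xp hm.hpsd w hr) (dom_inf_of_fin hK z') (hN _ _ hz.le)
      (hX _ _ hr) (hN _ _ hz'.le) ?_ ?_ ?_ rfl ?_ rfl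
    · rw [← e]; exact hlf
    · simp [xp]
    · exact fun h => hz'ne h.symm
    · rw [← e]; exact coh_symm (coh_add_w z s a b d)
  rcases x with ⟨a, b, d⟩ | ⟨z, σ⟩ | _
  · obtain ⟨s, hs0, hs1, hs2⟩ : ∃ s : ℝ, 0 < s ∧ 0 < a + s ∧ 0 < d + s :=
      ⟨|a| + |d| + 1, by positivity, by nlinarith [neg_abs_le a, abs_nonneg d],
        by nlinarith [neg_abs_le d, abs_nonneg a]⟩
    have du := dom_fin_add_w hx none hs0.le
    have dv := dom_fin_add_w hx none (s := s + 1) (by linarith)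
    have dw := dom_fin_add_w hx (some 0) hs0.le
    refine three hx du dv dw (pos _ _ _ (some 0) du ?_) (pos _ _ _ (some 0) dv ?_)
      (pos _ _ _ none dw ?_) (coh_add_w_add_w _ _ _ _ _ _) ?_ ?_
      (coh_symm (coh_add_w _ _ _ _ _)) (coh_symm (coh_add_w _ _ _ _ _))
      (coh_symm (coh_add_w _ _ _ _ _))
    · simp [lf, wa, wb, wd, hs1]
    · simp [lf, wa, wb, wd]; linarith
    · simp [lf, wd, hs2]
    · simp [wa]
    · simp [coh, wa, wb, wd, hs0.ne']
  · rcases le_or_gt 0 σ with hσ | hσ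
    · exact hN z σ hσ
    obtain ⟨a, b, d, hK, e⟩ := exists_dom_fin hx
    obtain ⟨u, hu, hk⟩ := exists_kap_eq_one z
    set s := |lf u a b d| + 1
    have hs : 0 ≤ s := by positivity
    have hKs := dom_fin_add_w hK z hs
    refine three (u := .top) (v := .inf z 0) hx dom_top (dom_inf_of_nonneg hm.hpsd z le_rfl) hKs
      htop (hN z 0 le_rfl) (pos _ _ _ u hKs ?_) trivial (by simp) id trivial rfl ?_
    · rw [lf_add, lf_xp, kap_comm, hk]
      have := neg_abs_le (lf u a b d)
      simp only [s]
      linarith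
    · exact (lf_add_w_self z s a b d).trans e
  · exact htop

theorem comp (hm : ModelMap α β δ ψ) {Φ : U2 → U2} (hΦ : IsAut Φ) :
    ModelMap α β δ (Φ ∘ ψ) :=
  ⟨hm.hpsd, fun x y hx hy h => (hΦ.2 _ _).1 (hm.map_coh x y hx hy h),
    fun h => hm.hpq ((hΦ.2 _ _).2 h)⟩

end ModelMap

theorem ConcStd.of_comp {α δ : ℝ} {β : ℂ} {ψ : MP → U2} {Φ : U2 → U2} (hΦ : IsAut Φ)
    (h : ConcStd α β δ (Φ ∘ ψ)) : ConcStd α β δ ψ := by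
  obtain ⟨Ψ, hΨ, e1, -⟩ := hΦ.exists_inverse
  obtain ⟨Θ, hΘ, e⟩ := h
  refine ⟨Ψ ∘ Θ, hΨ.comp hΘ, fun x hx => ?_⟩
  rw [Function.comp, ← e x hx, Function.comp, e1]

namespace ModelMap

variable {α : ℝ} {β : ℂ} {δ : ℝ} {ψ : MP → U2}

/-- The nondegenerate case after normalization. -/
theorem concStd_of_normalized (hm : ModelMap α β δ ψ)
    (hinj : ∀ z w, ψ (.inf z 0) = ψ (.inf w 0) → z = w)
    (hX : ∀ w r, 0 < r → ψ (xp w r) ≠ ψ (.inf w 0))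
    (hN : ∀ z s, 0 < s → ψ (.inf z s) ≠ ψ .top)
    (hp : ψ (.fin 0 0 0) = toU (.fin 0 0 0)) (hq : ψ .top = toU .top)
    (h₁ : ψ (.inf none 0) = toU (.inf none 0)) (h₂ : ψ (.inf (some 0) 0) = toU (.inf (some 0) 0))
    (h₃ : ψ (.inf (some 1) 0) = toU (.inf (some 1) 0))
    (hx : ψ (xp (some 0) 1) = toU (xp (some 0) 1)) : ConcStd α β δ ψ := by
  have hF : ∀ z, ∃ w, ψ (.inf z 0) = toU (.inf w 0) := fun z =>
    exists_eq_inf_zero (hp ▸ hm.inf_zero_coh_origin z) (hq ▸ hm.inf_zero_coh_top z)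
  choose F hF using hF
  have hFinj : ∀ z w, F z = F w → z = w := fun z w h => hinj z w (by rw [hF, hF, h])
  have hFof : ∀ {z w}, ψ (.inf z 0) = toU (.inf w 0) → F z = w := by
    intro z w h
    rw [hF] at h
    have := toU_injective h
    simpa using this
  have hGe : ∀ w r, ∃ t, 0 < r → ψ (xp w r) = toU (xp (F w) t) := by
    intro w r
    by_cases hr : 0 < r
    · have h1 := hm.xp_coh_origin w hr.le
      have h2 := hm.xp_coh_inf_zero w hr.le
      have h3 := hX w r hr
      rw [hp] at h1
      rw [hF] at h2 h3
      obtain ⟨t, ht⟩ := exists_eq_xp h1 h2 h3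
      exact ⟨t, fun _ => ht⟩
    · exact ⟨0, fun h => absurd h hr⟩
  choose G hG using hGe
  have hHe : ∀ z s, ∃ t, 0 < s → ψ (.inf z s) = toU (.inf (F z) t) := by
    intro z s
    by_cases hs : 0 < s
    · have hd := dom_inf_of_nonneg hm.hpsd z hs.le
      have h1 := hm.inf_coh_top z hd
      have h2 := hm.inf_coh_inf_zero z hd
      have h3 := hN z s hs
      rw [hq] at h1 h3
      rw [hF] at h2
      obtain ⟨t, ht⟩ := exists_eq_inf h1 h2 h3
      exact ⟨t, fun _ => ht⟩
    · exact ⟨0, fun h => absurd h hs⟩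
  choose H hH using hHe
  have rel : ∀ w z r, 0 < r → z ≠ w → G w r * kap (F z) (F w) = H z (r * kap z w) := by
    intro w z r hr hzw
    have hs : 0 < r * kap z w := mul_pos hr (kap_pos hzw)
    have := hm.xp_coh_inf w z hr.le hs.le rfl
    rw [hG w r hr, hH z _ hs, coherentU_toU] at this
    exact (lf_xp _ _ _).symm.trans this
  have hFn : F none = none := hFof h₁
  have hF' : ∀ z : ℂ, ∃ w : ℂ, F (some z) = some w := by
    intro z
    rcases h : F (some z) with _ | w
    · exact absurd (hFinj _ _ (h.trans hFn.symm)) (by simp)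
    · exact ⟨w, rfl⟩
  choose f hf using hF'
  have hf0 : f 0 = 0 := by
    have := hFof h₂; rw [hf] at this; exact Option.some_inj.1 this
  have hf1 : f 1 = 1 := by
    have := hFof h₃; rw [hf] at this; exact Option.some_inj.1 this
  set g : ℝ → ℝ := H none with hg
  have r1 : ∀ (w : ℂ) r, 0 < r → G (some w) r = g r := by
    intro w r hr
    have := rel (some w) none r hr (by simp)
    rwa [hFn, hf, kap_none_some, kap_none_some, mul_one, mul_one] at this
  have r2 : ∀ (z : ℂ) r, 0 < r → H (some z) r = G none r := by
    intro z r hr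
    have := rel none (some z) r hr (by simp)
    rw [hFn, hf, kap_some_none, kap_some_none, mul_one, mul_one] at this
    exact this.symm
  have kapn : ∀ z w : ℂ, kap (some z) (some w) = Complex.normSq (z - w) := by
    intro z w
    rw [kap_some_some, Complex.normSq_apply]
    simp only [Complex.sub_re, Complex.sub_im]
    ring
  have r3 : ∀ (z w : ℂ) r, 0 < r → z ≠ w →
      G none (r * Complex.normSq (z - w)) = g r * Complex.normSq (f z - f w) := by
    intro z w r hr hzw
    have hzw' : some z ≠ some w := fun h => hzw (Option.some_inj.1 h)
    have := rel (some w) (some z) r hr hzw'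
    rw [hf, hf, kapn, kapn, r1 w r hr, r2] at this
    · exact this.symm
    · rw [← kapn]; exact mul_pos hr (kap_pos hzw')
  have r4 : ∀ r, 0 < r → G none r = g r := by
    intro r hr
    have := r3 1 0 r hr one_ne_zero
    simpa [hf0, hf1] using this
  have hg1 : g 1 = 1 := by
    rw [← r1 0 1 one_pos]
    have := hG (some 0) 1 one_pos
    rw [hx, hf, hf0] at this
    have := toU_injective this
    simp only [xp, wd, mul_one, MP.fin.injEq] at this
    exact this.2.2.symm
  obtain ⟨hgid, hcases⟩ := eq_id_or_conj hf0 hf1 hg1 (fun r z w hr hzw => by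
      rw [← r3 z w r hr hzw, r4 _ (mul_pos hr (Complex.normSq_pos.2 (sub_ne_zero.2 hzw)))])
    (fun z w h => Option.some_inj.1 (hFinj (some z) (some w) (by rw [hf, hf, h])))
  have sX : ∀ (w : ℂ) r, 0 ≤ r → ψ (xp (some w) r) = toU (xp (some (f w)) r) := by
    intro w r hr
    rcases hr.eq_or_lt with rfl | hr
    · rw [xp_zero, xp_zero, hp]
    · rw [hG _ _ hr, hf, r1 _ _ hr, hgid _ hr]
  have nX : ∀ r, 0 ≤ r → ψ (xp none r) = toU (xp none r) := by
    intro r hr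
    rcases hr.eq_or_lt with rfl | hr
    · rw [xp_zero, hp]
    · rw [hG _ _ hr, hFn, r4 _ hr, hgid _ hr]
  have sN : ∀ (z : ℂ) s, 0 ≤ s → ψ (.inf (some z) s) = toU (.inf (some (f z)) s) := by
    intro z s hs
    rcases hs.eq_or_lt with rfl | hs
    · rw [hF, hf]
    · rw [hH _ _ hs, hf, r2 _ _ hs, r4 _ hs, hgid _ hs]
  have nN : ∀ s, 0 ≤ s → ψ (.inf none s) = toU (.inf none s) := by
    intro s hs
    rcases hs.eq_or_lt with rfl | hs
    · exact h₁
    · rw [hH _ _ hs, hFn, ← hg, hgid _ hs]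
  rcases hcases with hid | hconj
  · refine ⟨id, ⟨Function.bijective_id, fun _ _ => Iff.rfl⟩, fun x hx => ?_⟩
    refine hm.eq_toU hq ?_ ?_ hx
    · rintro (_ | w) r hr
      · exact nX r hr
      · rw [sX w r hr, hid]
    · rintro (_ | w) r hr
      · exact nN r hr
      · rw [sN w r hr, hid]
  · obtain ⟨Φ, hΦ, c1, c2, c3, c4⟩ := exists_isAut_conj_toU
    apply ConcStd.of_comp hΦ
    refine ⟨id, ⟨Function.bijective_id, fun _ _ => Iff.rfl⟩, fun x hx => ?_⟩
    refine (hm.comp hΦ).eq_toU ?_ ?_ ?_ hx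
    · rw [Function.comp, hq, c4]
    · rintro (_ | w) r hr
      · rw [Function.comp, nX r hr, xp, c1]
        simp [wb]
      · rw [Function.comp, sX w r hr, hconj, xp, c1]
        simp [wb, xp, wa, wd]
    · rintro (_ | w) r hr
      · rw [Function.comp, nN r hr, c3]
      · rw [Function.comp, sN w r hr, hconj, c2]
        simp

/-- A coherency preserver separating the directions in a sufficiently rich way is standard, or
maps all points but one into a cone. -/
theorem concC_or_concStd (hm : ModelMap α β δ ψ) {S : Set U2} (hnone : ψ (.inf none 0) ∉ S)
    {w₀ a b : ℂ} (hw₀ : ψ (.inf (some w₀) 0) ∉ S) (ha : ψ (.inf (some a) 0) ∈ S)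
    (hb : ψ (.inf (some b) 0) ∈ S) (hab : a ≠ b) : ConcC α β δ ψ ∨ ConcStd α β δ ψ := by
  have h1 : ψ (.inf (some a) 0) ≠ ψ (.inf none 0) := fun e => hnone (e ▸ ha)
  have h2 : ψ (.inf (some a) 0) ≠ ψ (.inf (some w₀) 0) := fun e => hw₀ (e ▸ ha)
  have h3 : ψ (.inf (some b) 0) ≠ ψ (.inf none 0) := fun e => hnone (e ▸ hb)
  have dN : ∀ z s, 0 < s → dom α β δ (.inf z s) := fun z s hs => dom_inf_of_nonneg hm.hpsd z hs.le
  by_cases hcX : ∃ w r, 0 < r ∧ ψ (xp w r) = ψ (.fin 0 0 0)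
  · left
    obtain ⟨w, r, hr, e⟩ := hcX
    refine hm.concC_of_xp_eq ?_ hab h1 h2 h3
    exact collapse (x := fun w r => ψ (xp w r)) (y := fun z s => ψ (.inf z s))
      (f := fun z => ψ (.inf z 0)) hm.hpq hm.inf_zero_coh_origin hm.inf_zero_coh_top
      (fun z r hr => hm.xp_coh_origin z hr.le) (fun z r hr => hm.xp_coh_inf_zero z hr.le)
      (fun z s hs => hm.inf_coh_top z (dN z s hs)) (fun z s hs => hm.inf_coh_inf_zero z (dN z s hs))
      (fun w z r hr hzw => hm.xp_coh_inf w z hr.le (mul_pos hr (kap_pos hzw)).le rfl)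
      hnone hw₀ ha hb hab hr e
  by_cases hcN : ∃ z s, 0 < s ∧ ψ (.inf z s) = ψ .top
  · left
    obtain ⟨z, s, hs, e⟩ := hcN
    refine hm.concC_of_inf_eq ?_ hab h1 h2 h3
    have := collapse (x := fun z s => ψ (.inf z s⁻¹)) (y := fun w r => ψ (xp w r⁻¹))
      (f := fun z => ψ (.inf z 0)) (fun h => hm.hpq h.symm) hm.inf_zero_coh_top
      hm.inf_zero_coh_origin
      (fun z s hs => hm.inf_coh_top z (dN z _ (inv_pos.2 hs)))
      (fun z s hs => hm.inf_coh_inf_zero z (dN z _ (inv_pos.2 hs)))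
      (fun z r hr => hm.xp_coh_origin z (inv_pos.2 hr).le)
      (fun z r hr => hm.xp_coh_inf_zero z (inv_pos.2 hr).le)
      (fun w z r hr hzw => by
        have hk := kap_pos hzw
        refine (hm.xp_coh_inf z w (by positivity) (by positivity) ?_).symm
        rw [kap_comm w z]
        field_simp)
      hnone hw₀ ha hb hab (inv_pos.2 hs) (by rw [inv_inv]; exact e)
    intro z s hs
    have := this z s⁻¹ (inv_pos.2 hs)
    rwa [inv_inv] at this
  right
  push Not at hcX hcN
  have hpick : ∀ z, ∃ w, ψ (.inf w 0) ≠ ψ (.inf z 0) := by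
    intro z
    by_cases hz : ψ (.inf z 0) = ψ (.inf none 0)
    · exact ⟨some a, fun e => h1 (e.trans hz)⟩
    · exact ⟨none, fun e => hz e.symm⟩
  have n1 : ∀ w r, 0 < r → ψ (xp w r) ≠ ψ (.inf w 0) := by
    intro w r hr e
    obtain ⟨z, hz⟩ := hpick w
    have hzw : z ≠ w := fun e => hz (by rw [e])
    have hs := mul_pos hr (kap_pos hzw)
    have c := hm.xp_coh_inf w z hr.le hs.le rfl
    rw [e] at c
    exact hcN z _ hs (CoherentU.eq_of_not (hm.not_coh_inf_zero hz)
      (hm.inf_coh_inf_zero z (dN z _ hs)) c.symm (hm.inf_zero_coh_top z).symm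
      (hm.inf_zero_coh_top w).symm (hm.inf_coh_top z (dN z _ hs)))
  have n2 : ∀ z s, 0 < s → ψ (.inf z s) ≠ ψ (.inf z 0) := by
    intro z s hs e
    obtain ⟨w, hw⟩ := hpick z
    have hk := kap_pos (z := z) (w := w) (fun e => hw (by rw [e]))
    have hr : 0 < s / kap z w := by positivity
    have c := hm.xp_coh_inf w z hr.le hs.le (div_mul_cancel₀ _ hk.ne')
    rw [e] at c
    exact hcX w _ hr (CoherentU.eq_of_not (hm.not_coh_inf_zero hw)
      (hm.xp_coh_inf_zero w hr.le) c (hm.inf_zero_coh_origin w).symm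
      (hm.inf_zero_coh_origin z).symm (hm.xp_coh_origin w hr.le))
  have n3 : ∀ z w, ψ (.inf z 0) = ψ (.inf w 0) → z = w := by
    intro z w e
    by_contra hzw
    have hs := kap_pos hzw
    have c := hm.xp_coh_inf w z zero_le_one hs.le (one_mul _)
    have c' := hm.inf_coh_inf_zero z (dN z _ hs)
    have hNp : CoherentU (ψ (.inf z (kap z w))) (ψ (.fin 0 0 0)) :=
      CoherentU.of_common (n1 w 1 one_pos) (hm.xp_coh_inf_zero w zero_le_one) c.symm (e ▸ c')
        (hm.xp_coh_origin w zero_le_one).symm (hm.inf_zero_coh_origin w).symm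
    exact n2 z _ hs (hm.eq_of_coh_pq hNp (hm.inf_coh_top z (dN z _ hs))
      (hm.inf_zero_coh_origin z) (hm.inf_zero_coh_top z) c')
  obtain ⟨Φ, hΦ, e1, e2, e3, e4, e5, e6⟩ := exists_isAut_normalization hm.hpq
    (hm.inf_zero_coh_origin none) (hm.inf_zero_coh_top none)
    (hm.inf_zero_coh_origin (some 0)) (hm.inf_zero_coh_top (some 0))
    (hm.inf_zero_coh_origin (some 1)) (hm.inf_zero_coh_top (some 1))
    (fun e => by simpa using n3 _ _ e) (fun e => by simpa using n3 _ _ e)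
    (fun e => by simpa using n3 _ _ e)
    (hm.xp_coh_origin (some 0) zero_le_one) (hm.xp_coh_inf_zero (some 0) zero_le_one)
    (hcX (some 0) 1 one_pos) (n1 (some 0) 1 one_pos)
  exact ConcStd.of_comp hΦ ((hm.comp hΦ).concStd_of_normalized
    (fun z w e => n3 z w (hΦ.1.1 e)) (fun w r hr e => n1 w r hr (hΦ.1.1 e))
    (fun z s hs e => hcN z s hs (hΦ.1.1 e)) e1 e2 e3 e4 e5 e6)

end ModelMap

/-! ### Coordinates on a matrix interval -/

theorem exists_right_factor {S T S' T' : Mat2} (h : IsLag S T) (h' : IsLag S' T')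
    (e : pt S T = pt S' T') : ∃ g : Mat2, S' = S * g ∧ T' = T * g := by
  have hu := isUnit_iff_ne_zero.2 h.det_ne_zero
  have hu' := isUnit_iff_ne_zero.2 h'.det_ne_zero
  set g := (S + Complex.I • T)⁻¹ * (S' + Complex.I • T') with hg
  have e1 : (S + Complex.I • T) * g = S' + Complex.I • T' := by
    rw [hg, ← Matrix.mul_assoc, Matrix.mul_nonsing_inv _ hu, Matrix.one_mul]
  have e2 : (S - Complex.I • T) * g = S' - Complex.I • T' := by
    have := congrArg (fun U : U2 => (U : Mat2)) e
    simp only [coe_pt h, coe_pt h'] at this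
    rw [hg, ← Matrix.mul_assoc, this, Matrix.mul_assoc, Matrix.nonsing_inv_mul _ hu',
      Matrix.mul_one]
  refine ⟨g, ?_, ?_⟩
  · have : (2 : ℂ) • S' = (2 : ℂ) • (S * g) := by
      calc (2 : ℂ) • S' = (S' + Complex.I • T') + (S' - Complex.I • T') := by module
        _ = (2 : ℂ) • (S * g) := by
          rw [← e1, ← e2, Matrix.add_mul, Matrix.sub_mul]; module
    exact smul_right_injective _ two_ne_zero this
  · have : (2 * Complex.I) • T' = (2 * Complex.I) • (T * g) := by
      calc (2 * Complex.I) • T' = (S' + Complex.I • T') - (S' - Complex.I • T') := by module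
        _ = (2 * Complex.I) • (T * g) := by
          rw [← e1, ← e2, Matrix.add_mul, Matrix.sub_mul, Matrix.smul_mul]; module
    exact smul_right_injective _ (mul_ne_zero two_ne_zero Complex.I_ne_zero) this

theorem isLag_of_isHermitian {X : Mat2} (hX : X.IsHermitian) : IsLag X 1 :=
  ⟨by simp [pairing, hX.eq], fun v _ h => by simpa using h⟩

theorem cayley_injOn {X Y : Mat2} (hX : X.IsHermitian) (hY : Y.IsHermitian)
    (h : cayley X = cayley Y) : X = Y := by
  rw [cayley_eq_pt, cayley_eq_pt,
    pt_eq_pt (isLag_of_isHermitian hX) (isLag_of_isHermitian hY)] at h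
  simpa [pairing, hX.eq, sub_eq_zero] using h

theorem coherentU_cayley {X Y : Mat2} (hX : X.IsHermitian) (hY : Y.IsHermitian) :
    CoherentU (cayley X) (cayley Y) ↔ Coherent X Y := by
  rw [cayley_eq_pt, cayley_eq_pt, coherentU_pt (isLag_of_isHermitian hX) (isLag_of_isHermitian hY),
    coherent_iff_det]
  simp [pairing, hX.eq]


theorem posSemidef_hmat_iff (a : ℝ) (b : ℂ) (d : ℝ) : (hmat a b d).PosSemidef ↔ psd a b d := by
  constructor
  · intro h
    have h0 := h.diag_nonneg (i := 0)
    have h1 := h.diag_nonneg (i := 1)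
    have h2 := h.det_nonneg
    rw [Matrix.det_fin_two] at h2
    simp only [hmat, Matrix.of_apply, Matrix.cons_val', Matrix.cons_val_zero,
      Matrix.cons_val_one, Matrix.cons_val_fin_one, Complex.zero_le_real] at h0 h1 h2
    refine ⟨h0, h1, ?_⟩
    have e : (a : ℂ) * d - b * (starRingEnd ℂ) b
        = ((a * d - (b.re ^ 2 + b.im ^ 2) : ℝ) : ℂ) := by
      apply Complex.ext <;> simp [pow_two] <;> ring
    rw [e, Complex.zero_le_real] at h2
    linarith
  · intro h
    refine Matrix.PosSemidef.of_dotProduct_mulVec_nonneg ?_ fun v => ?_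
    · ext i j
      fin_cases i <;> fin_cases j <;> simp [hmat]
    · obtain ⟨ha, hd, hb⟩ := h
      have e : star v ⬝ᵥ (hmat a b d *ᵥ v) = ((a * ((v 0).re ^ 2 + (v 0).im ^ 2)
          + d * ((v 1).re ^ 2 + (v 1).im ^ 2) + 2 * (b.re * ((v 0).re * (v 1).re
          + (v 0).im * (v 1).im) + b.im * ((v 0).im * (v 1).re - (v 0).re * (v 1).im)) : ℝ) : ℂ) := by
        apply Complex.ext <;>
          simp [hmat, dotProduct, Matrix.mulVec, Fin.sum_univ_two, pow_two] <;> ring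
      rw [e, Complex.zero_le_real]
      rcases hd.eq_or_lt with h0 | h0
      · subst h0
        have h1 : b.re = 0 := by nlinarith [sq_nonneg b.re, sq_nonneg b.im]
        have h2 : b.im = 0 := by nlinarith [sq_nonneg b.re, sq_nonneg b.im]
        rw [h1, h2]
        have : 0 ≤ a * ((v 0).re ^ 2 + (v 0).im ^ 2) := by positivity
        linarith
      · refine nonneg_of_mul_nonneg_right (a := d) ?_ h0
        have h1 : 0 ≤ (a * d - (b.re ^ 2 + b.im ^ 2)) * ((v 0).re ^ 2 + (v 0).im ^ 2) :=
          mul_nonneg (by linarith) (by positivity)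
        nlinarith [sq_nonneg (d * (v 1).re + b.re * (v 0).re + b.im * (v 0).im),
          sq_nonneg (d * (v 1).im + b.re * (v 0).im - b.im * (v 0).re)]

theorem dom_iff_posSemidef (α : ℝ) (β : ℂ) (δ : ℝ) (x : MP) :
    dom α β δ x ↔ ((repS x + hmat α β δ * repT x)ᴴ * repT x).PosSemidef := by
  rcases x with ⟨a, b, d⟩ | ⟨z, s⟩ | _
  · have e : (repS (.fin a b d) + hmat α β δ * repT (.fin a b d))ᴴ * repT (.fin a b d)
        = hmat (a + α) (b + β) (d + δ) := by
      ext i j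
      fin_cases i <;> fin_cases j <;> simp [repS, repT, hmat]
    rw [e, posSemidef_hmat_iff]
    rfl
  · have e : (repS (.inf z s) + hmat α β δ * repT (.inf z s))ᴴ * repT (.inf z s)
        = hmat (s + lf z α β δ) 0 0 := by
      ext i j
      rcases z with _ | z <;> fin_cases i <;> fin_cases j <;> apply Complex.ext <;>
        simp [repS, repT, hmat, lf, Matrix.mul_apply, Fin.sum_univ_two, pow_two] <;> ring
    rw [e, posSemidef_hmat_iff]
    simp only [dom, psd]
    constructor
    · intro h; refine ⟨by linarith, le_rfl, by simp⟩
    · intro h; linarith [h.1]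
  · simp [dom, repS, repT, Matrix.PosSemidef.zero]

theorem mem_matIcc_iff {A B X : Mat2} (hB : B.IsHermitian)
    (hAB : (B - A).PosDef) (hX : X.IsHermitian) :
    X ∈ matIcc A B ↔ ((X - A)ᴴ * (B - A)⁻¹ * (B - X)).PosSemidef := by
  set P := B - A with hP
  set R := B - X with hR
  have hu : IsUnit P.det := isUnit_iff_ne_zero.2 hAB.det_pos.ne'
  have hPH : Pᴴ = P := hAB.isHermitian.eq
  have hRH : Rᴴ = R := (hB.sub hX).eq
  have hQ : P⁻¹.PosSemidef := hAB.inv.posSemidef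
  have hQH : (P⁻¹)ᴴ = P⁻¹ := hQ.isHermitian.eq
  have h1 : P * P⁻¹ = 1 := Matrix.mul_nonsing_inv _ hu
  have h2 : P⁻¹ * P = 1 := Matrix.nonsing_inv_mul _ hu
  have hXA : X - A = P - R := by rw [hP, hR]; abel
  have hq : (X - A)ᴴ * P⁻¹ * R = R - R * P⁻¹ * R := by
    rw [hXA, conjTranspose_sub, hPH, hRH, Matrix.sub_mul, h1, Matrix.sub_mul, Matrix.one_mul]
  have key : (1 - P⁻¹ * R)ᴴ * R * (1 - P⁻¹ * R) + (P⁻¹ * R)ᴴ * (P - R) * (P⁻¹ * R)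
      = R - R * P⁻¹ * R := by
    have h3 : R * P⁻¹ * P = R := by rw [Matrix.mul_assoc, h2, Matrix.mul_one]
    simp only [conjTranspose_sub, conjTranspose_mul, hRH, hQH, conjTranspose_one, Matrix.sub_mul,
      Matrix.mul_sub, Matrix.one_mul, Matrix.mul_one, ← Matrix.mul_assoc, h3]
    abel
  have key' : (1 - P⁻¹ * R)ᴴ * P * (1 - P⁻¹ * R) + (R - R * P⁻¹ * R) = P - R := by
    have h3 : R * P⁻¹ * P = R := by rw [Matrix.mul_assoc, h2, Matrix.mul_one]
    simp only [conjTranspose_sub, conjTranspose_mul, hRH, hQH, conjTranspose_one, Matrix.sub_mul,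
      Matrix.mul_sub, Matrix.one_mul, Matrix.mul_one, ← Matrix.mul_assoc, h3, h1]
    abel
  rw [hq]
  change (X - A).PosSemidef ∧ R.PosSemidef ↔ _
  rw [hXA]
  constructor
  · rintro ⟨ha, hb⟩
    rw [← key]
    exact (hb.conjTranspose_mul_mul_same _).add (ha.conjTranspose_mul_mul_same _)
  · intro h
    refine ⟨?_, ?_⟩
    · rw [← key']
      exact (hAB.posSemidef.conjTranspose_mul_mul_same _).add h
    · have := h.add (hQ.conjTranspose_mul_mul_same R)
      rw [hRH] at this
      simpa using this

/-- The chart of `U₂` sending `B` to `top` and `B - C⁻¹` to the origin. -/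
theorem exists_isAut_chart {h k B C : Mat2} (hk : k * h = 1) (hB : B.IsHermitian)
    (hC : C.IsHermitian) :
    ∃ Θ : U2 → U2, IsAut Θ ∧ ∀ S T, IsLag S T →
      IsLag (h * (T - C * (B * T - S))) (kᴴ * (B * T - S)) ∧
      Θ (pt S T) = pt (h * (T - C * (B * T - S))) (kᴴ * (B * T - S)) := by
  have hk' : hᴴ * kᴴ = 1 := by rw [← conjTranspose_mul, hk, conjTranspose_one]

  have hkm : ∀ M, k * (h * M) = M := fun M => by rw [← Matrix.mul_assoc, hk, Matrix.one_mul]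
  have hkm' : ∀ M, hᴴ * (kᴴ * M) = M := fun M => by
    rw [← Matrix.mul_assoc, hk', Matrix.one_mul]
  obtain ⟨Θ, hΘ, hpt⟩ := exists_isAut_of_blocks (h * C) (h * (1 - C * B)) (-kᴴ) (kᴴ * B) 1
    one_ne_zero
    (by simp [conjTranspose_mul, Matrix.mul_assoc, hC.eq, hk', hkm])
    (by simp [conjTranspose_mul, conjTranspose_sub, Matrix.mul_assoc, hC.eq, hB.eq, hkm, hkm',
          Matrix.sub_mul, Matrix.mul_sub, hk])
    (by simp [conjTranspose_mul, Matrix.mul_assoc, hC.eq, hkm, hkm'])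
  refine ⟨Θ, hΘ, fun S T hL => ⟨⟨?_, fun v h1 h2 => ?_⟩, ?_⟩⟩
  · have hp := hL.1
    simp only [pairing] at hp
    have : pairing (h * (T - C * (B * T - S))) (kᴴ * (B * T - S)) (h * (T - C * (B * T - S)))
        (kᴴ * (B * T - S)) = Sᴴ * T - Tᴴ * S := by
      simp only [pairing, conjTranspose_mul, conjTranspose_sub, conjTranspose_conjTranspose,
        Matrix.mul_assoc, hkm, hkm', hC.eq, hB.eq, Matrix.sub_mul, Matrix.mul_sub]
      abel
    rw [this, hp]
  · have hR : (B * T - S) *ᵥ v = 0 := by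
      have := congrArg (fun w => hᴴ *ᵥ w) h2
      simpa only [Matrix.mulVec_mulVec, hkm', Matrix.mulVec_zero] using this
    have hT : T *ᵥ v = 0 := by
      have := congrArg (fun w => k *ᵥ w) h1
      simp only [Matrix.mulVec_mulVec, hkm, Matrix.mulVec_zero] at this
      rwa [Matrix.sub_mulVec, ← Matrix.mulVec_mulVec, hR, Matrix.mulVec_zero, sub_zero] at this
    refine hL.2 v ?_ hT
    rw [Matrix.sub_mulVec, ← Matrix.mulVec_mulVec, hT, Matrix.mulVec_zero, zero_sub] at hR
    exact neg_eq_zero.1 hR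
  · rw [hpt S T hL]
    congr 1 <;> simp only [Matrix.mul_sub, Matrix.sub_mul, Matrix.mul_one, Matrix.mul_assoc,
      Matrix.neg_mul] <;> abel

/-- The chart identifies the matrix interval `[A, B]` with a coordinate domain. -/
theorem exists_matIcc_chart {A B C h k : Mat2} {α δ : ℝ} {β : ℂ} (hB : B.IsHermitian)
    (hAB : (B - A).PosDef) (hC : C.IsHermitian) (hk : k * h = 1)
    (hΛ : h * (C - (B - A)⁻¹) * hᴴ = hmat α β δ) :
    ∃ Θ : U2 → U2, IsAut Θ ∧
      (∀ S T, IsLag S T →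
        IsLag (h * (T - C * (B * T - S))) (kᴴ * (B * T - S)) ∧
        Θ (pt S T) = pt (h * (T - C * (B * T - S))) (kᴴ * (B * T - S))) ∧
      (∀ X ∈ matIcc A B, ∃ x, dom α β δ x ∧ Θ (cayley X) = toU x) ∧
      ∀ x, dom α β δ x → ∃ X ∈ matIcc A B, Θ (cayley X) = toU x := by
  obtain ⟨Θ, hΘ, hpt⟩ := exists_isAut_chart hk hB hC
  set P := B - A with hP
  have hu : IsUnit P.det := isUnit_iff_ne_zero.2 hAB.det_pos.ne'
  have hPH : Pᴴ = P := hAB.isHermitian.eq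
  have hQH : (P⁻¹)ᴴ = P⁻¹ := hAB.inv.isHermitian.eq
  have h1 : P * P⁻¹ = 1 := Matrix.mul_nonsing_inv _ hu
  have hk' : hᴴ * kᴴ = 1 := by rw [← conjTranspose_mul, hk, conjTranspose_one]
  have hkm : ∀ M, hᴴ * (kᴴ * M) = M := fun M => by
    rw [← Matrix.mul_assoc, hk', Matrix.one_mul]
  have form : ∀ S T : Mat2, (h * (T - C * (B * T - S)) + hmat α β δ * (kᴴ * (B * T - S)))ᴴ *
      (kᴴ * (B * T - S)) = (S - A * T)ᴴ * P⁻¹ * (B * T - S) := by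
    intro S T
    have e1 : h * (T - C * (B * T - S)) + hmat α β δ * (kᴴ * (B * T - S))
        = h * (T - P⁻¹ * (B * T - S)) := by
      rw [← hΛ, Matrix.mul_assoc (h * _), hkm, Matrix.mul_assoc, ← Matrix.mul_add, Matrix.sub_mul]
      congr 1
      abel
    have e2 : S - A * T = P * T - (B * T - S) := by rw [hP, Matrix.sub_mul]; abel
    rw [e1, e2, conjTranspose_mul, Matrix.mul_assoc, hkm]
    simp only [conjTranspose_sub, conjTranspose_mul, hPH, hQH, Matrix.sub_mul, Matrix.mul_assoc]
    rw [← Matrix.mul_assoc P, h1, Matrix.one_mul]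
  have factor : ∀ S T g : Mat2, (S * g + hmat α β δ * (T * g))ᴴ * (T * g)
      = gᴴ * ((S + hmat α β δ * T)ᴴ * T) * g := by
    intro S T g
    rw [← Matrix.mul_assoc (hmat α β δ), ← Matrix.add_mul, conjTranspose_mul]
    simp only [Matrix.mul_assoc]
  refine ⟨Θ, hΘ, hpt, fun X hX => ?_, fun x hx => ?_⟩
  · have hXH : X.IsHermitian := by simpa using hB.sub hX.2.isHermitian
    obtain ⟨x, hx⟩ := toU_surjective (Θ (cayley X))
    refine ⟨x, ?_, hx.symm⟩
    obtain ⟨hL, he⟩ := hpt X 1 (isLag_of_isHermitian hXH)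
    rw [cayley_eq_pt, he, toU] at hx
    obtain ⟨g, hS, hT⟩ := exists_right_factor hL (isLag_rep x) hx.symm
    rw [dom_iff_posSemidef, hS, hT, factor, form]
    refine Matrix.PosSemidef.conjTranspose_mul_mul_same ?_ g
    have := (mem_matIcc_iff hB hAB hXH).1 hX
    simpa using this
  · obtain ⟨U, hU⟩ := hΘ.1.2 (toU x)
    obtain ⟨S, T, hST, rfl⟩ := exists_rep U
    obtain ⟨hL, he⟩ := hpt S T hST
    have hq : ((S - A * T)ᴴ * P⁻¹ * (B * T - S)).PosSemidef := by
      obtain ⟨g, hS, hT⟩ := exists_right_factor (isLag_rep x) hL (hU.symm.trans he)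
      rw [← form, hS, hT, factor]
      exact ((dom_iff_posSemidef α β δ x).1 hx).conjTranspose_mul_mul_same g
    have hTdet : T.det ≠ 0 := by
      intro h0
      obtain ⟨v, hv, hTv⟩ := Matrix.exists_mulVec_eq_zero_iff.2 h0
      have hSv : S *ᵥ v ≠ 0 := fun h => hv (hST.2 v h hTv)
      have hpos := hAB.inv.dotProduct_mulVec_pos hSv
      have hn := hq.dotProduct_mulVec_nonneg v
      have e : star v ⬝ᵥ (((S - A * T)ᴴ * P⁻¹ * (B * T - S)) *ᵥ v)
          = -(star (S *ᵥ v) ⬝ᵥ (P⁻¹ *ᵥ (S *ᵥ v))) := by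
        rw [← Matrix.mulVec_mulVec, ← Matrix.mulVec_mulVec, Matrix.sub_mulVec,
          ← Matrix.mulVec_mulVec, hTv, Matrix.dotProduct_mulVec, ← Matrix.star_mulVec,
          Matrix.sub_mulVec, ← Matrix.mulVec_mulVec, hTv, Matrix.mulVec_zero, Matrix.mulVec_zero,
          sub_zero, zero_sub, Matrix.mulVec_neg, dotProduct_neg]
      rw [e] at hn
      exact absurd (add_pos_of_pos_of_nonneg hpos hn) (by simp)
    have hTu : IsUnit T.det := isUnit_iff_ne_zero.2 hTdet
    have hTT : T * T⁻¹ = 1 := Matrix.mul_nonsing_inv _ hTu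
    have hTT' : T⁻¹ * T = 1 := Matrix.nonsing_inv_mul _ hTu
    have hXH : (S * T⁻¹).IsHermitian := by
      have hp : Sᴴ * T = Tᴴ * S := sub_eq_zero.1 hST.1
      have hc : (T⁻¹)ᴴ * Tᴴ = 1 := by rw [← conjTranspose_mul, hTT, conjTranspose_one]
      rw [Matrix.IsHermitian, conjTranspose_mul]
      calc (T⁻¹)ᴴ * Sᴴ = (T⁻¹)ᴴ * (Sᴴ * T) * T⁻¹ := by
            rw [Matrix.mul_assoc, Matrix.mul_assoc, hTT, Matrix.mul_one]
        _ = S * T⁻¹ := by rw [hp, ← Matrix.mul_assoc, hc, Matrix.one_mul]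
    have hXT : S * T⁻¹ * T = S := by rw [Matrix.mul_assoc, hTT', Matrix.mul_one]
    refine ⟨S * T⁻¹, ?_, ?_⟩
    · rw [mem_matIcc_iff hB hAB hXH]
      have := hq.conjTranspose_mul_mul_same T⁻¹
      rw [← hP]
      convert this using 1
      have e1 : S * T⁻¹ - A = (S - A * T) * T⁻¹ := by
        rw [Matrix.sub_mul, Matrix.mul_assoc A, hTT, Matrix.mul_one]
      have e2 : B - S * T⁻¹ = (B * T - S) * T⁻¹ := by
        rw [Matrix.sub_mul, Matrix.mul_assoc B, hTT, Matrix.mul_one]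
      rw [e1, e2, conjTranspose_mul]
      simp only [Matrix.mul_assoc]
    · rw [← hU]
      congr 1
      rw [cayley_eq_pt, pt_eq_pt (isLag_of_isHermitian hXH) hST, pairing, hXH.eq, hXT]
      simp

/-- The matrix at which the ray from `B` in the direction `-y yᴴ` meets the matrices coherent
to `B - C⁻¹`. -/
def edgePt (B C : Mat2) (y : Fin 2 → ℂ) : Mat2 :=
  B - (star y ⬝ᵥ (C *ᵥ y))⁻¹ • vecMulVec y (star y)

theorem edgePt_smul (B C : Mat2) (y : Fin 2 → ℂ) {c : ℂ} (hc : c ≠ 0) :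
    edgePt B C (c • y) = edgePt B C y := by
  have hc' : star c ≠ 0 := star_ne_zero.2 hc
  have : star c * c ≠ 0 := mul_ne_zero hc' hc
  simp only [edgePt, star_smul, Matrix.mulVec_smul, smul_dotProduct, dotProduct_smul,
    vecMulVec_smul, smul_vecMulVec, smul_smul, smul_eq_mul]
  congr 2
  field_simp

theorem isHermitian_edgePt {B C : Mat2} (hB : B.IsHermitian) (hC : C.IsHermitian)
    (y : Fin 2 → ℂ) : (edgePt B C y).IsHermitian := by
  refine hB.sub ?_
  have h1 : star (star y ⬝ᵥ (C *ᵥ y)) = star y ⬝ᵥ (C *ᵥ y) := by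
    rw [← star_dotProduct_star, star_star, Matrix.star_mulVec, hC.eq, Matrix.dotProduct_mulVec,
      dotProduct_comm]
  rw [Matrix.IsHermitian, conjTranspose_smul, star_inv₀, h1]
  congr 1
  ext i j
  simp [vecMulVec_apply, mul_comm]

/-- The parallelity defect of two vectors. -/
def cross (y y' : Fin 2 → ℂ) : ℂ := y 0 * y' 1 - y 1 * y' 0

theorem exists_eq_smul_of_cross_eq_zero {y y' : Fin 2 → ℂ} (hy : y ≠ 0) (hy' : y' ≠ 0)
    (h : cross y y' = 0) : ∃ c : ℂ, c ≠ 0 ∧ y = c • y' := by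
  have key : ∃ c : ℂ, y = c • y' := by
    simp only [cross] at h
    by_cases h0 : y' 0 = 0
    · have h1 : y' 1 ≠ 0 := fun h1 => hy' (by ext i; fin_cases i <;> simp [h0, h1])
      refine ⟨y 1 / y' 1, ?_⟩
      have : y 0 = 0 := by
        rw [h0, mul_zero, sub_zero] at h
        exact (mul_eq_zero.1 h).resolve_right h1
      ext i; fin_cases i <;> simp [h0, h1, this]
    · refine ⟨y 0 / y' 0, ?_⟩
      ext i; fin_cases i
      · simp [h0]
      · simp; field_simp; linear_combination -h
  obtain ⟨c, hc⟩ := key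
  refine ⟨c, ?_, hc⟩
  rintro rfl
  exact hy (by simpa using hc)

theorem cross_eq_zero_of_edgePt_eq {B C : Mat2} (hC : C.PosDef) {y y' : Fin 2 → ℂ}
    (hy : y ≠ 0) (h : edgePt B C y = edgePt B C y') : cross y y' = 0 := by
  have ht := (hC.dotProduct_mulVec_pos hy).ne'
  simp only [edgePt] at h
  have h := sub_right_injective h
  have e : ∀ i j, (star y ⬝ᵥ (C *ᵥ y))⁻¹ * (y i * star (y j))
      = (star y' ⬝ᵥ (C *ᵥ y'))⁻¹ * (y' i * star (y' j)) := fun i j => by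
    simpa [vecMulVec_apply] using congrFun (congrFun h i) j
  obtain ⟨j, hj⟩ := Function.ne_iff.1 hy
  have e0 := e 0 j
  have e1 := e 1 j
  have : (star y ⬝ᵥ (C *ᵥ y))⁻¹ * star (y j) * cross y y' = 0 := by
    simp only [cross]
    linear_combination y' 1 * e0 - y' 0 * e1
  refine (mul_eq_zero.1 this).resolve_left (mul_ne_zero (inv_ne_zero ht) (star_ne_zero.2 hj))

/-- The vector spanning the direction `z`. -/
def dirVec : Option ℂ → Fin 2 → ℂ
  | none => ![0, 1]
  | some z => ![1, -(starRingEnd ℂ) z]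

/-- The vector orthogonal to the direction `z`. -/
def orthVec : Option ℂ → Fin 2 → ℂ
  | none => ![1, 0]
  | some z => ![z, 1]

theorem repT_inf (z : Option ℂ) : repT (.inf z 0) = vecMulVec (dirVec z) ![1, 0] := by
  ext i j
  rcases z with _ | z <;> fin_cases i <;> fin_cases j <;> simp [repT, dirVec, vecMulVec_apply]

theorem repS_inf (z : Option ℂ) : repS (.inf z 0) = vecMulVec (orthVec z) ![0, 1] := by
  ext i j
  rcases z with _ | z <;> fin_cases i <;> fin_cases j <;> simp [repS, orthVec, vecMulVec_apply]

theorem dirVec_ne_zero (z : Option ℂ) : dirVec z ≠ 0 := by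
  rcases z with _ | z
  · exact fun h => by simpa [dirVec] using congrFun h 1
  · exact fun h => by simpa [dirVec] using congrFun h 0

theorem star_dirVec_dotProduct_orthVec (z : Option ℂ) : star (dirVec z) ⬝ᵥ orthVec z = 0 := by
  rcases z with _ | z <;> simp [dirVec, orthVec, dotProduct, Fin.sum_univ_two]

theorem pairing_edgePt {B C h k : Mat2} (hC : C.PosDef) (hk : k * h = 1)
    (hB : B.IsHermitian) (z : Option ℂ) :
    pairing (h * (1 - C * (B * 1 - edgePt B C (hᴴ *ᵥ dirVec z))))
      (kᴴ * (B * 1 - edgePt B C (hᴴ *ᵥ dirVec z))) (repS (.inf z 0)) (repT (.inf z 0)) = 0 := by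
  have hhk : h * k = 1 := mul_eq_one_comm.1 hk
  set y := hᴴ *ᵥ dirVec z with hy
  have hy0 : y ≠ 0 := by
    intro h0
    have := congrArg (fun w => kᴴ *ᵥ w) h0
    simp only [hy, Matrix.mulVec_mulVec, ← conjTranspose_mul, hhk, conjTranspose_one,
      Matrix.one_mulVec, Matrix.mulVec_zero] at this
    exact dirVec_ne_zero z this
  have ht := (hC.dotProduct_mulVec_pos hy0).ne'
  have hRH : (B - edgePt B C y)ᴴ = B - edgePt B C y :=
    (hB.sub (isHermitian_edgePt hB hC.isHermitian y)).eq
  have hR : B - edgePt B C y = (star y ⬝ᵥ (C *ᵥ y))⁻¹ • vecMulVec y (star y) := by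
    simp [edgePt]
  have hort : star y ⬝ᵥ (k *ᵥ orthVec z) = 0 := by
    rw [hy, Matrix.star_mulVec, conjTranspose_conjTranspose, ← Matrix.dotProduct_mulVec,
      Matrix.mulVec_mulVec, hhk, Matrix.one_mulVec, star_dirVec_dotProduct_orthVec]
  rw [Matrix.mul_one, repT_inf, repS_inf, pairing, conjTranspose_mul, conjTranspose_mul,
    conjTranspose_sub, conjTranspose_mul, hRH, hC.isHermitian.eq, conjTranspose_one,
    conjTranspose_conjTranspose, Matrix.mul_assoc, Matrix.mul_assoc, Matrix.mul_vecMulVec,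
    Matrix.mul_vecMulVec k, ← hy, Matrix.sub_mul, Matrix.one_mul, Matrix.mul_assoc,
    Matrix.mul_vecMulVec, hR, Matrix.smul_mul, Matrix.smul_mul, Matrix.vecMulVec_mul_vecMulVec,
    Matrix.vecMulVec_mul_vecMulVec, hort]
  rw [zero_smul, vecMulVec_zero, smul_zero, sub_zero, vecMulVec_smul, smul_smul,
    inv_mul_cancel₀ ht, one_smul, sub_self]

/-- Coordinates on the matrix interval `[A, B]` centered at `Y` and `B`, in which a given
direction `y₁` becomes `none`. -/
theorem exists_coordinates {A B Y : Mat2} (hB : B.IsHermitian) (hAB : (B - A).PosDef)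
    (hY : Y ∈ matIcc A B) (hdet : (B - Y).det ≠ 0) {y₁ : Fin 2 → ℂ} (hy₁ : y₁ ≠ 0) :
    ∃ (α : ℝ) (β : ℂ) (δ : ℝ) (ξ : MP → Mat2) (Θ : U2 → U2), psd α β δ ∧ IsAut Θ ∧
      (∀ x, dom α β δ x → ξ x ∈ matIcc A B ∧ Θ (cayley (ξ x)) = toU x) ∧
      (∀ X ∈ matIcc A B, ∃ x, dom α β δ x ∧ ξ x = X) ∧
      ξ (.fin 0 0 0) = Y ∧ ξ .top = B ∧ ξ (.inf none 0) = edgePt B (B - Y)⁻¹ y₁ ∧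
      (∀ z : ℂ, ∃ y, cross y y₁ ≠ 0 ∧ ξ (.inf (some z) 0) = edgePt B (B - Y)⁻¹ y) ∧
      ∀ y, cross y y₁ ≠ 0 → ∃ z : ℂ, ξ (.inf (some z) 0) = edgePt B (B - Y)⁻¹ y := by
  have hR : (B - Y).PosDef := hY.2.posDef_iff_det_ne_zero.2 hdet
  have hC : (B - Y)⁻¹.PosDef := hR.inv
  have hherm : ∀ X ∈ matIcc A B, X.IsHermitian := fun X hX => by
    simpa using hB.sub hX.2.isHermitian
  have hYH := hherm Y hY
  set C := (B - Y)⁻¹ with hCdef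
  have hu : IsUnit (B - Y).det := isUnit_iff_ne_zero.2 hdet
  have hCR : C * (B - Y) = 1 := Matrix.nonsing_inv_mul _ hu
  have hRC : (B - Y) * C = 1 := Matrix.mul_nonsing_inv _ hu
  set N : ℝ := (y₁ 0).re ^ 2 + (y₁ 0).im ^ 2 + ((y₁ 1).re ^ 2 + (y₁ 1).im ^ 2) with hN
  have hN0 : N ≠ 0 := by
    intro h0
    apply hy₁
    have := sq_nonneg (y₁ 0).re; have := sq_nonneg (y₁ 0).im
    have := sq_nonneg (y₁ 1).re; have := sq_nonneg (y₁ 1).im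
    ext i
    fin_cases i <;> apply Complex.ext <;> simp <;> nlinarith
  have hNc : y₁ 0 * star (y₁ 0) + y₁ 1 * star (y₁ 1) = (N : ℂ) := by
    apply Complex.ext <;> simp [hN, -Complex.ofReal_add, -Complex.ofReal_pow] <;> ring
  have hNc0 : (N : ℂ) ≠ 0 := by exact_mod_cast hN0
  set h : Mat2 := !![-(y₁ 1), y₁ 0; star (y₁ 0), star (y₁ 1)] with hh
  have hhdet : h.det ≠ 0 := by
    rw [hh, Matrix.det_fin_two_of]
    intro h0
    apply hNc0
    rw [← hNc]
    linear_combination -h0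
  have hk : h⁻¹ * h = 1 := Matrix.nonsing_inv_mul _ (isUnit_iff_ne_zero.2 hhdet)
  have hpos : (h * (C - (B - A)⁻¹) * hᴴ).PosSemidef := by
    refine Matrix.PosSemidef.mul_mul_conjTranspose_same ?_ h
    have := ((mem_matIcc_iff hB hAB hYH).1 hY).conjTranspose_mul_mul_same C
    convert this using 1
    have hu' : IsUnit (B - A).det := isUnit_iff_ne_zero.2 hAB.det_pos.ne'
    have e1 : (Y - A)ᴴ = (B - A) - (B - Y) := by
      rw [← hAB.isHermitian.eq, ← hR.isHermitian.eq, ← conjTranspose_sub]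
      congr 1
      abel
    rw [e1, hC.isHermitian.eq, Matrix.sub_mul, Matrix.mul_nonsing_inv _ hu', Matrix.mul_assoc,
      Matrix.mul_assoc, hRC, Matrix.mul_one, Matrix.mul_sub, ← Matrix.mul_assoc, hCR,
      Matrix.mul_one, Matrix.one_mul]
  have hΛ := isHermitian_eq_hmat hpos.isHermitian
  set α := ((h * (C - (B - A)⁻¹) * hᴴ) 0 0).re
  set β := (h * (C - (B - A)⁻¹) * hᴴ) 0 1
  set δ := ((h * (C - (B - A)⁻¹) * hᴴ) 1 1).re
  have hpsd : psd α β δ := by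
    rw [← posSemidef_hmat_iff, ← hΛ]
    exact hpos
  obtain ⟨Θ, hΘ, hpt, hsurj, hex⟩ := exists_matIcc_chart hB hAB hC.isHermitian hk hΛ
  have hex' : ∀ x, ∃ X, dom α β δ x → X ∈ matIcc A B ∧ Θ (cayley X) = toU x := fun x => by
    by_cases hx : dom α β δ x
    · obtain ⟨X, hX⟩ := hex x hx
      exact ⟨X, fun _ => hX⟩
    · exact ⟨0, fun h => absurd h hx⟩
  choose ξ hξ using hex'
  have huniq : ∀ x X, dom α β δ x → X.IsHermitian → Θ (cayley X) = toU x → ξ x = X := by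
    intro x X hx hX he
    refine cayley_injOn (hherm _ (hξ x hx).1) hX (hΘ.1.1 ?_)
    rw [(hξ x hx).2, he]
  have huniq' : ∀ x X, dom α β δ x → X.IsHermitian →
      pairing (h * (1 - C * (B * 1 - X))) (h⁻¹ᴴ * (B * 1 - X)) (repS x) (repT x) = 0 →
      ξ x = X := by
    intro x X hx hX he
    refine huniq x X hx hX ?_
    obtain ⟨hL, hp⟩ := hpt X 1 (isLag_of_isHermitian hX)
    rw [cayley_eq_pt, hp, toU, pt_eq_pt hL (isLag_rep x)]
    exact he
  have hinf : ∀ z, ξ (.inf z 0) = edgePt B C (hᴴ *ᵥ dirVec z) := fun z =>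
    huniq' _ _ (by simpa [dom] using hpsd.lf_nonneg z)
      (isHermitian_edgePt hB hC.isHermitian _) (pairing_edgePt hC hk hB z)
  have hvec : ∀ z : ℂ, hᴴ *ᵥ dirVec (some z)
      = ![-star (y₁ 1) - star z * y₁ 0, star (y₁ 0) - star z * y₁ 1] := by
    intro z
    ext i
    fin_cases i <;> simp [hh, dirVec, Matrix.mulVec, dotProduct, Fin.sum_univ_two] <;> ring
  refine ⟨α, β, δ, ξ, Θ, hpsd, hΘ, hξ, fun X hX => ?_, ?_, ?_, ?_, fun z => ?_, fun y hy => ?_⟩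
  · obtain ⟨x, hx, he⟩ := hsurj X hX
    exact ⟨x, hx, huniq x X hx (hherm X hX) he⟩
  · refine huniq' _ _ (by simpa [dom] using hpsd) hYH ?_
    have e0 : hmat 0 0 0 = 0 := by ext i j; fin_cases i <;> fin_cases j <;> simp [hmat]
    rw [Matrix.mul_one, hCR, sub_self]
    simp [pairing, repS, e0]
  · exact huniq' _ _ trivial hB (by simp [pairing, repT])
  · rw [hinf]
    congr 1
    ext i
    fin_cases i <;> simp [hh, dirVec, Matrix.mulVec, dotProduct, Fin.sum_univ_two]
  · refine ⟨_, ?_, hinf (some z)⟩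
    rw [hvec]
    simp only [cross, Matrix.cons_val_zero, Matrix.cons_val_one]
    intro h0
    apply hNc0
    rw [← hNc]
    linear_combination -h0
  · set q := star (y₁ 0) * y 0 + star (y₁ 1) * y 1 with hq
    refine ⟨star (q / cross y y₁), ?_⟩
    rw [hinf, hvec, star_star]
    have hc : -(N : ℂ) / cross y y₁ ≠ 0 := div_ne_zero (neg_ne_zero.2 hNc0) hy
    rw [← edgePt_smul B C y hc]
    congr 1
    have e0 : -star (y₁ 1) - q / cross y y₁ * y₁ 0 = -(N : ℂ) / cross y y₁ * y 0 := by
      rw [div_mul_eq_mul_div, div_mul_eq_mul_div, eq_div_iff hy, sub_mul, div_mul_cancel₀ _ hy,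
        ← hNc, hq, cross]
      ring
    have e1 : star (y₁ 0) - q / cross y y₁ * y₁ 1 = -(N : ℂ) / cross y y₁ * y 1 := by
      rw [div_mul_eq_mul_div, div_mul_eq_mul_div, eq_div_iff hy, sub_mul, div_mul_cancel₀ _ hy,
        ← hNc, hq, cross]
      ring
    ext i
    fin_cases i
    · exact e0
    · exact e1

/-- **Theorem B.**  A coherency preserver on a matrix interval `[A,B]` (with `A < B`) which is
not standard is degenerate: of type `(𝒞)` or of type `(ℓ)`. -/
theorem theoremB
    (A B : Mat2) (hA : A.IsHermitian) (hB : B.IsHermitian) (hAB : (B - A).PosDef)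
    (φ : Mat2 → U2)
    (hφ : ∀ X ∈ matIcc A B, ∀ Y ∈ matIcc A B, Coherent X Y → CoherentU (φ X) (φ Y))
    (hns : ¬ ∃ Φ : U2 → U2, IsAut Φ ∧ ∀ X ∈ matIcc A B, φ X = Φ (cayley X)) :
    (∃ A₀ ∈ matIcc A B, ∃ B₀ ∈ φ '' matIcc A B,
      ∀ X ∈ matIcc A B, X ≠ A₀ → CoherentU (φ X) B₀) ∨
    (∃ ℓ ℓ' : Set U2, IsLine ℓ ∧ IsLine ℓ' ∧
      ∀ X ∈ matIcc A B, cayley X ∉ ℓ → φ X ∈ ℓ') := by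
  have hBmem : B ∈ matIcc A B := ⟨hAB.posSemidef, by simpa using Matrix.PosSemidef.zero⟩
  have hherm : ∀ X ∈ matIcc A B, X.IsHermitian := fun X hX => by
    simpa using hB.sub hX.2.isHermitian
  by_cases hall : ∀ X ∈ matIcc A B, CoherentU (φ X) (φ B)
  · exact Or.inl ⟨B, hBmem, φ B, ⟨B, hBmem, rfl⟩, fun X hX _ => hall X hX⟩
  push Not at hall
  obtain ⟨Y, hY, hYB⟩ := hall
  have hdet : (B - Y).det ≠ 0 := fun h0 =>
    hYB (hφ B hBmem Y hY ((coherent_iff_det B Y).2 h0)).symm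
  have hC : (B - Y)⁻¹.PosDef := (hY.2.posDef_iff_det_ne_zero.2 hdet).inv
  set E : (Fin 2 → ℂ) → U2 := fun y => φ (edgePt B (B - Y)⁻¹ y) with hE
  have hEpar : ∀ y y' : Fin 2 → ℂ, y ≠ 0 → y' ≠ 0 → cross y y' = 0 → E y = E y' := by
    intro y y' hy hy' h
    obtain ⟨c, hc, rfl⟩ := exists_eq_smul_of_cross_eq_zero hy hy' h
    simp only [hE, edgePt_smul _ _ _ hc]
  have hne : ∀ {y y' : Fin 2 → ℂ}, cross y y' ≠ 0 → y ≠ 0 ∧ y' ≠ 0 := by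
    intro y y' h
    constructor <;> rintro rfl <;> simp [cross] at h
  have hswap : ∀ {y y' : Fin 2 → ℂ}, cross y y' ≠ 0 → cross y' y ≠ 0 := by
    intro y y' h h'
    apply h
    simp only [cross] at h' ⊢
    linear_combination -h'
  -- Everything that is needed from the coordinates adapted to a direction `y₁`.
  have main : ∀ y₁ : Fin 2 → ℂ, y₁ ≠ 0 →
      ((∃ c, ∀ y, cross y y₁ ≠ 0 → E y = c) ∨
        ∃ (S : Set U2) (a b w : Fin 2 → ℂ), E y₁ ∉ S ∧ E w ∉ S ∧ E a ∈ S ∧ E b ∈ S ∧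
          cross w y₁ ≠ 0 ∧ cross a y₁ ≠ 0 ∧ cross b y₁ ≠ 0 ∧ cross a b ≠ 0) →
      (∃ A₀ ∈ matIcc A B, ∃ B₀ ∈ φ '' matIcc A B,
        ∀ X ∈ matIcc A B, X ≠ A₀ → CoherentU (φ X) B₀) ∨
      (∃ ℓ ℓ' : Set U2, IsLine ℓ ∧ IsLine ℓ' ∧
        ∀ X ∈ matIcc A B, cayley X ∉ ℓ → φ X ∈ ℓ') := by
    intro y₁ hy₁ hcase
    obtain ⟨α, β, δ, ξ, Θ, hpsd, hΘ, hξ, hsurj, h0, htop, hnone, hsome, hdir⟩ :=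
      exists_coordinates hB hAB hY hdet hy₁
    have hcohξ : ∀ x y, dom α β δ x → dom α β δ y →
        (CoherentU (cayley (ξ x)) (cayley (ξ y)) ↔ coh x y) := by
      intro x y hx hy
      rw [hΘ.2, (hξ x hx).2, (hξ y hy).2, coherentU_toU]
    have hm : ModelMap α β δ (φ ∘ ξ) := by
      refine ⟨hpsd, fun x y hx hy hxy => ?_, ?_⟩
      · refine hφ _ (hξ x hx).1 _ (hξ y hy).1 ?_
        rwa [← coherentU_cayley (hherm _ (hξ x hx).1) (hherm _ (hξ y hy).1), hcohξ x y hx hy]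
      · simpa only [Function.comp, h0, htop] using hYB
    have hconc : ConcC α β δ (φ ∘ ξ) ∨ ConcL α β δ (φ ∘ ξ) ∨ ConcStd α β δ (φ ∘ ξ) := by
      rcases hcase with ⟨c, hc⟩ | ⟨S, a, b, w, hy₁S, hwS, haS, hbS, hw, ha, hb, hab⟩
      · rcases hm.concC_or_concL_of_const (c := c) fun z => by
          obtain ⟨y, hy, he⟩ := hsome z
          simpa only [Function.comp, he] using hc y hy with h | h
        · exact Or.inl h
        · exact Or.inr (Or.inl h)
      · obtain ⟨zw, hzw⟩ := hdir w hw
        obtain ⟨za, hza⟩ := hdir a ha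
        obtain ⟨zb, hzb⟩ := hdir b hb
        have hzab : za ≠ zb := by
          rintro rfl
          exact hab (cross_eq_zero_of_edgePt_eq hC (hne ha).1 (hza.symm.trans hzb))
        rcases hm.concC_or_concStd (S := S) (w₀ := zw) (a := za) (b := zb)
          (by simpa only [Function.comp, hnone] using hy₁S)
          (by simpa only [Function.comp, hzw] using hwS)
          (by simpa only [Function.comp, hza] using haS)
          (by simpa only [Function.comp, hzb] using hbS) hzab with h | h
        · exact Or.inl h
        · exact Or.inr (Or.inr h)
    rcases hconc with ⟨x₀, b, hx₀, hb, h⟩ | ⟨x₁, x₂, y₁, y₂, hx₁, hx₂, hcx, hx, hy, hcy, h⟩ |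
      ⟨Φ, hΦ, h⟩
    · refine Or.inl ⟨ξ x₀, (hξ x₀ hx₀).1, φ (ξ b), ⟨_, (hξ b hb).1, rfl⟩, fun X hX hne => ?_⟩
      obtain ⟨x, hx, rfl⟩ := hsurj X hX
      exact h x hx fun e => hne (by rw [e])
    · have hne : cayley (ξ x₁) ≠ cayley (ξ x₂) := fun e => by
        have := congrArg Θ e
        rw [(hξ _ hx₁).2, (hξ _ hx₂).2] at this
        exact hx (toU_injective this)
      refine Or.inr ⟨_, _, isLine_of_common hne ((hcohξ _ _ hx₁ hx₂).2 hcx),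
        isLine_of_common hy hcy, fun X hX hXl => ?_⟩
      obtain ⟨x, hx, rfl⟩ := hsurj X hX
      refine h x hx fun hc => hXl ?_
      exact ⟨(hcohξ _ _ hx hx₁).2 hc.1, (hcohξ _ _ hx hx₂).2 hc.2⟩
    · refine absurd ⟨Φ ∘ Θ, hΦ.comp hΘ, fun X hX => ?_⟩ hns
      obtain ⟨x, hx, rfl⟩ := hsurj X hX
      rw [Function.comp, (hξ x hx).2]
      exact h x hx
  by_cases hconst : ∃ c, ∃ y₁ : Fin 2 → ℂ, y₁ ≠ 0 ∧ ∀ y, cross y y₁ ≠ 0 → E y = c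
  · obtain ⟨c, y₁, hy₁, h⟩ := hconst
    exact main y₁ hy₁ (Or.inl ⟨c, h⟩)
  push Not at hconst
  by_cases hinj : ∃ y y' : Fin 2 → ℂ, cross y y' ≠ 0 ∧ E y = E y'
  · obtain ⟨y, y', hyy, hEE⟩ := hinj
    obtain ⟨y₂, h₂, hE₂⟩ := hconst (E y) y (hne hyy).1
    obtain ⟨y₃, h₃, hE₃⟩ := hconst (E y) y₂ (hne h₂).1
    refine main y₂ (hne h₂).1 (Or.inr ⟨{E y}, y, y', y₃, hE₂, hE₃, rfl, hEE.symm, h₃, hswap h₂,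
      fun h0 => hE₂ ?_, hyy⟩)
    rw [← hEpar y' y₂ (hne hyy).2 (hne h₂).1 h0, hEE]
  · push Not at hinj
    refine main ![1, 1] (fun h => by simpa using congrFun h 0) (Or.inr
      ⟨{E ![1, 0], E ![0, 1]}, ![1, 0], ![0, 1], ![1, -1], ?_, ?_, Or.inl rfl, Or.inr rfl,
        ?_, ?_, ?_, ?_⟩)
    · rintro (h | h)
      · exact hinj _ _ (by simp [cross]) h
      · exact hinj _ _ (by simp [cross]) h
    · rintro (h | h)
      · exact hinj _ _ (by simp [cross]) h
      · exact hinj _ _ (by simp [cross]) h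
    all_goals norm_num [cross]
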